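/- Let ε ∈ {1,−1}, α, β ∈ ℝ with 3α² − 8εβ ≠ 0, and let f : ℝ² → ℝ be a smooth function whose 4-jet at the origin is j⁴f(0) = y² + εx⁴ + αx³y + βx²y² (the class Π^p_{v,1}, where the Monge form has an A₃-singularity and the parabolic curve has a Morse singularity at the origin). Then there exist signs ε₁, ε₂ ∈ {1,−1} such that the asymptotic BDE of f is topologically equivalent at 0 to the BDE dy² + (ε₁x² + ε₂y²)dx² = 0, i.e. the BDE with coefficients (a,b,c) = (1, 0, ε₁x² + ε₂y²). -/

import Mathlib

open Asymptotics Filter Set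

noncomputable section

/-- Partial derivative in the first variable (∂/∂x). -/
def pdx (f : ℝ × ℝ → ℝ) (p : ℝ × ℝ) : ℝ := deriv (fun s => f (s, p.2)) p.1

/-- Partial derivative in the second variable (∂/∂y). -/
def pdy (f : ℝ × ℝ → ℝ) (p : ℝ × ℝ) : ℝ := deriv (fun s => f (p.1, s)) p.2

/-- f_xx -/
def fxx (f : ℝ × ℝ → ℝ) : ℝ × ℝ → ℝ := pdx (pdx f)
/-- f_xy -/
def fxy (f : ℝ × ℝ → ℝ) : ℝ × ℝ → ℝ := pdy (pdx f)
/-- f_yy -/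
def fyy (f : ℝ × ℝ → ℝ) : ℝ × ℝ → ℝ := pdy (pdy f)

/-- The discriminant δ = f_xy² − f_xx·f_yy of the asymptotic BDE of `f`. -/
def bdeDiscr (f : ℝ × ℝ → ℝ) : ℝ × ℝ → ℝ := fun p => (fxy f p) ^ 2 - fxx f p * fyy f p

/-- The BDE `a dy² + 2b dxdy + c dx² = 0`, regarded as the family of quadratic
forms `ω_p(v) = a(p)v₂² + 2b(p)v₁v₂ + c(p)v₁²`. -/
def BDE (a b c : ℝ × ℝ → ℝ) : (ℝ × ℝ) → (ℝ × ℝ) → ℝ :=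
  fun p v => a p * v.2 ^ 2 + 2 * b p * v.1 * v.2 + c p * v.1 ^ 2

/-- The asymptotic BDE `f_yy dy² + 2 f_xy dxdy + f_xx dx² = 0` of the surface `z = f(x,y)`. -/
def asymBDE (f : ℝ × ℝ → ℝ) : (ℝ × ℝ) → (ℝ × ℝ) → ℝ := BDE (fyy f) (fxy f) (fxx f)

/-- `j^k f(0) = P` : the degree-k Taylor polynomial of `f` at the origin is `P`,
i.e. `f − P = o(‖(x,y)‖^k)` as `(x,y) → 0`. -/
def HasJetAt0 (f P : ℝ × ℝ → ℝ) (k : ℕ) : Prop :=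
  (fun p => f p - P p) =o[nhds (0 : ℝ × ℝ)] fun p => ‖p‖ ^ k

/-- `γ` is an integral curve of the BDE `ω` on the open interval `I`:
`γ` is C¹ on `I` with nowhere-vanishing derivative annihilating `ω`. -/
def IsIntegralCurveOnBDE (ω : (ℝ × ℝ) → (ℝ × ℝ) → ℝ) (γ : ℝ → ℝ × ℝ) (I : Set ℝ) : Prop :=
  (∃ a b : ℝ, I = Set.Ioo a b) ∧
  ∃ dγ : ℝ → ℝ × ℝ, ContinuousOn dγ I ∧
    ∀ t ∈ I, HasDerivAt γ (dγ t) t ∧ dγ t ≠ 0 ∧ ω (γ t) (dγ t) = 0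

/-- Topological equivalence of two BDEs at the origin: a local homeomorphism
fixing `0` sending integral curves of one to integral curves of the other. -/
def TopEquivAt0 (ω Ω : (ℝ × ℝ) → (ℝ × ℝ) → ℝ) : Prop :=
  ∃ (U V : Set (ℝ × ℝ)) (h hinv : ℝ × ℝ → ℝ × ℝ),
    IsOpen U ∧ IsOpen V ∧ (0 : ℝ × ℝ) ∈ U ∧ (0 : ℝ × ℝ) ∈ V ∧ h 0 = 0 ∧
    ContinuousOn h U ∧ ContinuousOn hinv V ∧
    Set.BijOn h U V ∧ Set.InvOn hinv h U V ∧
    (∀ γ I, IsIntegralCurveOnBDE ω γ I → Set.MapsTo γ I U →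
      ∃ σ J, IsIntegralCurveOnBDE Ω σ J ∧ h '' (γ '' I) = σ '' J) ∧
    (∀ σ J, IsIntegralCurveOnBDE Ω σ J → Set.MapsTo σ J V →
      ∃ γ I, IsIntegralCurveOnBDE ω γ I ∧ hinv '' (σ '' J) = γ '' I)

/-- Smooth equivalence of two BDEs at the origin: a local C^∞ diffeomorphism `h`
fixing `0` pulling one family of quadratic forms back to a nonvanishing multiple
of the other. -/
def SmoothEquivAt0 (ω Ω : (ℝ × ℝ) → (ℝ × ℝ) → ℝ) : Prop :=
  ∃ (U V : Set (ℝ × ℝ)) (h hinv : ℝ × ℝ → ℝ × ℝ) (ρ : ℝ × ℝ → ℝ),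
    IsOpen U ∧ IsOpen V ∧ (0 : ℝ × ℝ) ∈ U ∧ (0 : ℝ × ℝ) ∈ V ∧ h 0 = 0 ∧
    ContDiffOn ℝ (⊤ : ℕ∞) h U ∧ ContDiffOn ℝ (⊤ : ℕ∞) hinv V ∧
    Set.BijOn h U V ∧ Set.InvOn hinv h U V ∧
    ContDiffOn ℝ (⊤ : ℕ∞) ρ U ∧ (∀ p ∈ U, ρ p ≠ 0) ∧
    (∀ p ∈ U, ∀ v : ℝ × ℝ, Ω (h p) (fderiv ℝ h p v) = ρ p * ω p v)

/-- Fiber topological equivalence at `0` of two 2-parameter families of BDEs: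
a homeomorphism `φ` of parameter spaces (onto its image), fixing `0`, such that
corresponding members of the families are topologically equivalent at `0`. -/
def FiberTopEquivAt0 (ω Ω : (ℝ × ℝ) → (ℝ × ℝ) → (ℝ × ℝ) → ℝ) : Prop :=
  ∃ (W : Set (ℝ × ℝ)) (φ ψ : ℝ × ℝ → ℝ × ℝ),
    W ∈ nhds (0 : ℝ × ℝ) ∧ φ 0 = 0 ∧
    ContinuousOn φ W ∧ ContinuousOn ψ (φ '' W) ∧
    Set.InvOn ψ φ W (φ '' W) ∧
    ∀ q ∈ W, TopEquivAt0 (ω q) (Ω (φ q))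

local notation "𝕍" => ℝ × ℝ

structure Fld (G : ℝ → ℝ → ℝ) (M K : ℝ) : Prop where
  cont : Continuous (fun p : 𝕍 => G p.1 p.2)
  bd : ∀ t y, |G t y| ≤ M
  lip : ∀ t y y', |G t y - G t y'| ≤ K * |y - y'|
  K0 : 0 ≤ K

theorem Fld.M0 {G M K} (h : Fld G M K) : 0 ≤ M := (abs_nonneg _).trans (h.bd 0 0)

theorem ode_est (w w' : ℝ → ℝ) (K : ℝ) (hK : 0 ≤ K) (hw : ∀ t, HasDerivAt w (w' t) t)
    (hb : ∀ t, |w' t| ≤ K * |w t|) (s t : ℝ) : |w t| ≤ Real.exp (K * |t - s|) * |w s| := by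
  have h1 : ∀ t, |w t * w' t| ≤ K * (w t) ^ 2 := fun t => by
    rw [abs_mul, ← sq_abs (w t)]; nlinarith [hb t, abs_nonneg (w t)]
  have hd : ∀ c t, HasDerivAt (fun t => (w t) ^ 2 * Real.exp (c * t))
      ((2 * (w t * w' t) + c * (w t) ^ 2) * Real.exp (c * t)) t := fun c t => by
    have := ((hw t).pow 2).mul ((((hasDerivAt_id t).const_mul c)).exp)
    refine this.congr_deriv ?_
    simp; ring
  have hA : Antitone (fun t => (w t) ^ 2 * Real.exp (-(2 * K) * t)) := by
    apply antitone_of_deriv_nonpos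
    · exact fun t => (hd _ t).differentiableAt
    · intro t; rw [(hd _ t).deriv]
      have := (abs_le.1 (h1 t)).2
      exact mul_nonpos_of_nonpos_of_nonneg (by linarith) (Real.exp_pos _).le
  have hM : Monotone (fun t => (w t) ^ 2 * Real.exp ((2 * K) * t)) := by
    apply monotone_of_deriv_nonneg
    · exact fun t => (hd _ t).differentiableAt
    · intro t; rw [(hd _ t).deriv]
      have := (abs_le.1 (h1 t)).1
      exact mul_nonneg (by linarith) (Real.exp_pos _).le
  have key : (w t) ^ 2 ≤ Real.exp (2 * K * |t - s|) * (w s) ^ 2 := by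
    rcases le_total s t with h | h
    · rw [abs_of_nonneg (by linarith)]
      have := hA h
      simp only at this
      have e := Real.exp_pos (2 * K * t)
      have := mul_le_mul_of_nonneg_right this e.le
      have e1 : w t ^ 2 * Real.exp (-(2 * K) * t) * Real.exp (2 * K * t) = w t ^ 2 := by
        rw [mul_assoc, ← Real.exp_add]; simp
      have e2 : Real.exp (2 * K * (t - s)) = Real.exp (-(2 * K) * s) * Real.exp (2 * K * t) := by
        rw [← Real.exp_add]; congr 1; ring
      rw [e2]; linarith
    · rw [abs_of_nonpos (by linarith)]
      have := hM h
      simp only at this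
      have e := Real.exp_pos (-(2 * K * t))
      have := mul_le_mul_of_nonneg_right this e.le
      have e1 : w t ^ 2 * Real.exp (2 * K * t) * Real.exp (-(2 * K * t)) = w t ^ 2 := by
        rw [mul_assoc, ← Real.exp_add]; simp
      have e2 : Real.exp (2 * K * -(t - s)) = Real.exp (2 * K * s) * Real.exp (-(2 * K * t)) := by
        rw [← Real.exp_add]; congr 1; ring
      rw [e2]; linarith
  have : (w t) ^ 2 ≤ (Real.exp (K * |t - s|) * |w s|) ^ 2 := by
    refine key.trans (le_of_eq ?_)
    rw [mul_pow, sq_abs, ← Real.exp_nat_mul]; congr 2; push_cast; ring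
  have h2 := sq_le_sq.1 this
  rwa [abs_of_nonneg (a := Real.exp (K * |t - s|) * |w s|) (by positivity)] at h2

theorem Fld.exists_sol {G M K} (h : Fld G M K) (t0 y0 : ℝ) :
    ∃ φ : ℝ → ℝ, φ t0 = y0 ∧ ∀ t, HasDerivAt φ (G t (φ t)) t := by
  have hM := h.M0
  have loc : ∀ n : ℕ, ∃ α : ℝ → ℝ, α t0 = y0 ∧
      ∀ t ∈ Ioo (t0 - (n + 1)) (t0 + (n + 1)), HasDerivAt α (G t (α t)) t := by
    intro n
    have hn : (0 : ℝ) ≤ n := n.cast_nonneg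
    have P : IsPicardLindelof G (tmin := t0 - (n + 1)) (tmax := t0 + (n + 1))
        ⟨t0, by constructor <;> linarith⟩ y0 (⟨M, hM⟩ * (n + 1)) 0 ⟨M, hM⟩ ⟨K, h.K0⟩ := by
      refine ⟨fun t _ => ?_, fun x _ => ?_, fun t _ x _ => h.bd t x, ?_⟩
      · exact LipschitzOnWith.of_dist_le_mul fun x _ y _ => h.lip t x y
      · exact (h.cont.comp (by fun_prop : Continuous fun t : ℝ => (t, x))).continuousOn
      · simp; exact le_of_eq rfl
    obtain ⟨α, h1, h2⟩ := P.exists_eq_forall_mem_Icc_hasDerivWithinAt₀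
    exact ⟨α, h1, fun t ht => (h2 t (Ioo_subset_Icc_self ht)).hasDerivAt (Icc_mem_nhds ht.1 ht.2)⟩
  choose α h1 h2 using loc
  have hu : ∀ n m : ℕ, n ≤ m → ∀ t ∈ Ioo (t0 - (n + 1)) (t0 + (n + 1)), α n t = α m t := by
    intro n m hnm
    have hnm' : (n : ℝ) ≤ m := by exact_mod_cast hnm
    have hn : (0 : ℝ) ≤ n := n.cast_nonneg
    have := ODE_solution_unique_of_mem_Ioo (v := G) (s := fun _ => univ) (K := ⟨K, h.K0⟩)
      (f := α n) (g := α m) (a := t0 - (n + 1)) (b := t0 + (n + 1)) (t₀ := t0)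
      (fun t _ => LipschitzOnWith.of_dist_le_mul fun x _ y _ => h.lip t x y)
      (by constructor <;> linarith) (fun t ht => ⟨h2 n t ht, trivial⟩)
      (fun t ht => ⟨h2 m t ⟨by linarith [ht.1], by linarith [ht.2]⟩, trivial⟩)
      (by rw [h1, h1])
    exact this
  have hmem : ∀ s (N : ℕ), ⌈|s - t0|⌉₊ ≤ N → s ∈ Ioo (t0 - (N + 1)) (t0 + (N + 1)) := by
    intro s N hN
    have := Nat.le_ceil (|s - t0|)
    have h3 : |s - t0| < N + 1 := by
      have : (⌈|s - t0|⌉₊ : ℝ) ≤ N := by exact_mod_cast hN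
      linarith
    rw [abs_lt] at h3; constructor <;> linarith [h3.1, h3.2]
  refine ⟨fun t => α ⌈|t - t0|⌉₊ t, h1 _, fun t => ?_⟩
  set N := ⌈|t - t0|⌉₊ with hN
  have hev : (fun t => α ⌈|t - t0|⌉₊ t) =ᶠ[nhds t] α N := by
    filter_upwards [Ioo_mem_nhds (hmem t N le_rfl).1 (hmem t N le_rfl).2] with s hs
    rcases le_total ⌈|s - t0|⌉₊ N with h | h
    · exact hu _ _ h _ (hmem s _ le_rfl)
    · exact (hu _ _ h s hs).symm
  exact (h2 N t (hmem t N le_rfl)).congr_of_eventuallyEq hev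

def Fld.sol {G M K} (h : Fld G M K) (t0 y0 : ℝ) : ℝ → ℝ := (h.exists_sol t0 y0).choose

theorem Fld.sol_self {G M K} (h : Fld G M K) (t0 y0 : ℝ) : h.sol t0 y0 t0 = y0 :=
  (h.exists_sol t0 y0).choose_spec.1
theorem Fld.sol_deriv {G M K} (h : Fld G M K) (t0 y0 t : ℝ) :
    HasDerivAt (h.sol t0 y0) (G t (h.sol t0 y0 t)) t :=
  (h.exists_sol t0 y0).choose_spec.2 t

theorem Fld.est {G M K} (h : Fld G M K) {a b : ℝ → ℝ} (ha : ∀ t, HasDerivAt a (G t (a t)) t)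
    (hb : ∀ t, HasDerivAt b (G t (b t)) t) (s t : ℝ) :
    |a t - b t| ≤ Real.exp (K * |t - s|) * |a s - b s| :=
  ode_est (fun t => a t - b t) _ K h.K0 (fun t => (ha t).sub (hb t)) (fun t => h.lip _ _ _) s t

theorem Fld.uniq {G M K} (h : Fld G M K) {a b : ℝ → ℝ} (ha : ∀ t, HasDerivAt a (G t (a t)) t)
    (hb : ∀ t, HasDerivAt b (G t (b t)) t) {s : ℝ} (hs : a s = b s) : a = b := by
  funext t
  have := h.est ha hb s t
  rw [hs] at this; simp at this; linarith [sub_eq_zero.1 this]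

theorem Fld.sol_trans {G M K} (h : Fld G M K) (t0 y0 t1 : ℝ) :
    h.sol t1 (h.sol t0 y0 t1) = h.sol t0 y0 :=
  h.uniq (s := t1) (h.sol_deriv _ _) (h.sol_deriv _ _) (h.sol_self _ _)

theorem Fld.sol_lt {G M K} (h : Fld G M K) {a b : ℝ → ℝ} (ha : ∀ t, HasDerivAt a (G t (a t)) t)
    (hb : ∀ t, HasDerivAt b (G t (b t)) t) {s : ℝ} (hs : a s < b s) (t : ℝ) : a t < b t := by
  by_contra hc
  push Not at hc
  have hcont : Continuous (fun t => b t - a t) :=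
    continuous_iff_continuousAt.2 fun t => ((hb t).sub (ha t)).continuousAt
  have : (0 : ℝ) ∈ (fun t => b t - a t) '' univ := by
    apply (isPreconnected_univ.image _ hcont.continuousOn).ordConnected.out
      (mem_image_of_mem _ (mem_univ t)) (mem_image_of_mem _ (mem_univ s))
    simp; constructor <;> linarith
  obtain ⟨x, -, hx⟩ := this
  have := h.uniq ha hb (s := x) (by simp at hx; linarith)
  rw [this] at hs; exact lt_irrefl _ hs

def Fld.phi {G M K} (h : Fld G M K) (t u : ℝ) : ℝ := h.sol 0 u t
def Fld.lab {G M K} (h : Fld G M K) (t y : ℝ) : ℝ := h.sol t y 0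

theorem Fld.phi_lab {G M K} (h : Fld G M K) (t y : ℝ) : h.phi t (h.lab t y) = y := by
  unfold Fld.phi Fld.lab; rw [h.sol_trans, h.sol_self]
theorem Fld.lab_phi {G M K} (h : Fld G M K) (t y : ℝ) : h.lab t (h.phi t y) = y := by
  unfold Fld.phi Fld.lab; rw [h.sol_trans, h.sol_self]
theorem Fld.lab_zero {G M K} (h : Fld G M K) (y : ℝ) : h.lab 0 y = y := h.sol_self _ _
theorem Fld.phi_zero {G M K} (h : Fld G M K) (y : ℝ) : h.phi 0 y = y := h.sol_self _ _
theorem Fld.phi_deriv {G M K} (h : Fld G M K) (u t : ℝ) :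
    HasDerivAt (fun s => h.phi s u) (G t (h.phi t u)) t := h.sol_deriv _ _ _
theorem Fld.phi_mono {G M K} (h : Fld G M K) (t : ℝ) : StrictMono (h.phi t) := fun u v huv =>
  h.sol_lt (s := 0) (h.sol_deriv _ _) (h.sol_deriv _ _) (by rwa [h.sol_self, h.sol_self]) t
theorem Fld.lab_mono {G M K} (h : Fld G M K) (t : ℝ) : StrictMono (h.lab t) := fun u v huv => by
  rw [← (h.phi_mono t).lt_iff_lt, h.phi_lab, h.phi_lab]; exact huv
theorem Fld.phi_cont {G M K} (h : Fld G M K) (t : ℝ) : Continuous (h.phi t) :=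
  (h.phi_mono t).monotone.continuous_of_surjective fun y => ⟨_, h.phi_lab t y⟩

theorem Fld.sol_dist {G M K} (h : Fld G M K) (t0 y0 s t : ℝ) :
    |h.sol t0 y0 s - h.sol t0 y0 t| ≤ M * |s - t| := by
  have := Convex.norm_image_sub_le_of_norm_hasDerivWithin_le (f := h.sol t0 y0) (s := univ)
    (fun x _ => (h.sol_deriv t0 y0 x).hasDerivWithinAt) (fun x _ => h.bd _ _) convex_univ
    (mem_univ t) (mem_univ s)
  simpa using this

theorem Fld.lab_lip {G M K} (h : Fld G M K) (t y y' : ℝ) :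
    |h.lab t y - h.lab t y'| ≤ Real.exp (K * |t|) * |y - y'| := by
  have := h.est (h.sol_deriv t y) (h.sol_deriv t y') t 0
  simpa [h.sol_self, Fld.lab] using this

theorem Fld.lab_lip2 {G M K} (h : Fld G M K) (t y t' y' : ℝ) :
    |h.lab t y - h.lab t' y'| ≤ Real.exp (K * |t'|) * |h.sol t y t' - y'| := by
  have : h.lab t y = h.lab t' (h.sol t y t') := by unfold Fld.lab; rw [h.sol_trans]
  rw [this]; exact h.lab_lip _ _ _

theorem Fld.lab_cont {G M K} (h : Fld G M K) : Continuous (fun p : 𝕍 => h.lab p.1 p.2) := by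
  rw [continuous_iff_continuousAt]
  rintro ⟨t, y⟩
  rw [ContinuousAt, tendsto_iff_dist_tendsto_zero]
  have hb : ∀ p : 𝕍, dist (h.lab p.1 p.2) (h.lab t y) ≤
      Real.exp (K * |p.1|) * (M * |p.1 - t| + |y - p.2|) := by
    intro p
    rw [dist_comm, Real.dist_eq]
    refine (h.lab_lip2 t y p.1 p.2).trans ?_
    gcongr
    have h1 := h.sol_dist t y p.1 t
    rw [h.sol_self] at h1
    calc |h.sol t y p.1 - p.2| ≤ |h.sol t y p.1 - y| + |y - p.2| := abs_sub_le _ _ _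
      _ ≤ _ := by gcongr
  refine squeeze_zero (fun _ => dist_nonneg) hb ?_
  have : Continuous (fun p : 𝕍 => Real.exp (K * |p.1|) * (M * |p.1 - t| + |y - p.2|)) := by
    fun_prop
  have := this.tendsto (t, y)
  simpa using this

theorem Fld.lab_const {G M K} (h : Fld G M K) {τ η τ' : ℝ → ℝ} {I : Set ℝ} (hI : IsOpen I)
    (hI' : IsPreconnected I) (h1 : ∀ t ∈ I, HasDerivAt τ (τ' t) t)
    (h2 : ∀ t ∈ I, HasDerivAt η (G (τ t) (η t) * τ' t) t) {s t : ℝ} (hs : s ∈ I) (ht : t ∈ I) :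
    h.lab (τ s) (η s) = h.lab (τ t) (η t) := by
  have hd : ∀ t ∈ I, HasDerivAt (fun t => h.lab (τ t) (η t)) 0 t := by
    intro t ht
    have k1 : HasDerivAt (fun s => h.sol (τ t) (η t) (τ s) - η s) 0 t := by
      have := (HasDerivAt.comp t (h.sol_deriv (τ t) (η t) (τ t)) (h1 t ht)).sub (h2 t ht)
      rw [h.sol_self, sub_self] at this
      exact this
    rw [hasDerivAt_iff_isLittleO] at k1 ⊢
    simp only [h.sol_self, sub_self, smul_zero, sub_zero] at k1 ⊢
    have hc : ContinuousAt (fun s => Real.exp (K * |τ s|)) t := by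
      have := (h1 t ht).continuousAt
      fun_prop
    have hO : (fun s => Real.exp (K * |τ s|)) =O[nhds t] (fun _ => (1 : ℝ)) :=
      hc.isBigO_one _
    have := hO.mul_isLittleO k1
    simp only [one_mul] at this
    refine IsBigO.trans_isLittleO ?_ this
    refine IsBigO.of_bound 1 (Eventually.of_forall fun s => ?_)
    simp only [one_mul, norm_mul, Real.norm_eq_abs, Real.abs_exp]
    rw [abs_sub_comm]; exact h.lab_lip2 _ _ _ _
  exact hI.is_const_of_deriv_eq_zero hI' (fun x hx => (hd x hx).differentiableAt.differentiableWithinAt)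
    (fun x hx => (hd x hx).deriv) hs ht

structure Net (GA GB : ℝ → ℝ → ℝ) (M K : ℝ) : Prop where
  A : Fld GA M K
  B : Fld GB M K
  le : ∀ t y, GA t y ≤ GB t y
  dense : ∀ t1 t2, t1 < t2 → ∃ t ∈ Ioo t1 t2, ∀ y, GA t y < GB t y
  far : ∃ T, 0 < T ∧ ∀ t y, T ≤ |t| → GA t y = -1 ∧ GB t y = 1

theorem Net.cmp_le {GA GB M K} (h : Net GA GB M K) {a b : ℝ → ℝ}
    (ha : ∀ t, HasDerivAt a (GA t (a t)) t)
    (hb : ∀ t, HasDerivAt b (GB t (b t)) t) {t1 t2 : ℝ} (h1 : a t1 ≤ b t1) (h12 : t1 ≤ t2) :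
    a t2 ≤ b t2 := by
  have key : ∀ ε > 0, a t2 - b t2 ≤ ε * Real.exp ((K + 1) * (t2 - t1)) := by
    intro ε hε
    have hd := fun t => (ha t).sub (hb t)
    refine image_le_of_deriv_right_lt_deriv_boundary (f := fun t => a t - b t)
      (f' := fun t => GA t (a t) - GB t (b t)) (a := t1) (b := t2)
      (B := fun t => ε * Real.exp ((K + 1) * (t - t1)))
      (B' := fun t => ε * (Real.exp ((K + 1) * (t - t1)) * (K + 1)))
      (fun t _ => (hd t).continuousAt.continuousWithinAt) (fun t _ => (hd t).hasDerivWithinAt)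
      ?_ ?_ ?_ ⟨h12, le_rfl⟩
    · simp; linarith
    · intro t
      have := ((((hasDerivAt_id t).sub_const t1).const_mul (K + 1)).exp).const_mul ε
      simpa using this
    · intro t _ ht
      have e := Real.exp_pos ((K + 1) * (t - t1))
      have h3 := h.le t (b t)
      have h4 := (abs_le.1 (h.A.lip t (a t) (b t))).2
      have h5 : 0 < ε * Real.exp ((K + 1) * (t - t1)) := by positivity
      rw [abs_of_nonneg (by rw [ht]; positivity)] at h4
      rw [ht] at h4
      nlinarith
  have h2 : Tendsto (fun ε : ℝ => ε * Real.exp ((K + 1) * (t2 - t1))) (nhdsWithin 0 (Ioi 0)) (nhds 0) := by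
    have : Continuous (fun ε : ℝ => ε * Real.exp ((K + 1) * (t2 - t1))) := by fun_prop
    have := (this.tendsto 0).mono_left (nhdsWithin_le_nhds (s := Ioi 0))
    simpa using this
  have := ge_of_tendsto h2 (by filter_upwards [self_mem_nhdsWithin] with ε hε using key ε hε)
  linarith

theorem Net.cmp {GA GB M K} (h : Net GA GB M K) {a b : ℝ → ℝ}
    (ha : ∀ t, HasDerivAt a (GA t (a t)) t)
    (hb : ∀ t, HasDerivAt b (GB t (b t)) t) {t1 t2 : ℝ} (h1 : a t1 ≤ b t1) (h12 : t1 < t2) :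
    a t2 < b t2 := by
  refine lt_of_le_of_ne (h.cmp_le ha hb h1 h12.le) fun he => ?_
  have key : ∀ t ∈ Ioo t1 t2, b t = a t := by
    intro t ht
    refine le_antisymm ?_ (h.cmp_le ha hb h1 ht.1.le)
    by_contra hc
    push Not at hc
    have h3 := h.cmp_le (h.A.sol_deriv t (b t)) hb (t1 := t) (t2 := t2) (by rw [h.A.sol_self]) ht.2.le
    have h4 := h.A.sol_lt ha (h.A.sol_deriv t (b t)) (s := t) (by rwa [h.A.sol_self]) t2
    linarith
  obtain ⟨t, ht, hlt⟩ := h.dense t1 t2 h12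
  have e : (fun s => b s) =ᶠ[nhds t] a := by
    filter_upwards [Ioo_mem_nhds ht.1 ht.2] with s hs using key s hs
  have := ((ha t).congr_of_eventuallyEq e).unique (hb t)
  rw [key t ht] at this
  linarith [hlt (a t)]

theorem Net.exists_cross {GA GB M K} (h : Net GA GB M K) (u v : ℝ) :
    ∃ t, h.B.phi t u = h.A.phi t v := by
  obtain ⟨T, hT, hfar⟩ := h.far
  set d := fun t => h.B.phi t u - h.A.phi t v with hd
  have hder : ∀ t, HasDerivAt d (GB t (h.B.phi t u) - GA t (h.A.phi t v)) t := fun t =>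
    (h.B.phi_deriv u t).sub (h.A.phi_deriv v t)
  have hc : Continuous d := continuous_iff_continuousAt.2 fun t => (hder t).continuousAt
  have hr : ∀ t ≥ T, d t = d T + 2 * (t - T) := by
    intro t ht
    have := (convex_Ici T).is_const_of_fderivWithin_eq_zero (𝕜 := ℝ) (f := fun t => d t - 2 * (t - T))
      (by
        intro s _
        exact ((hder s).sub (((hasDerivAt_id s).sub_const T).const_mul 2)).differentiableAt.differentiableWithinAt)
      (by
        intro s hs
        have h1 := ((hder s).sub (((hasDerivAt_id s).sub_const T).const_mul 2))
        obtain ⟨f1, _⟩ := hfar s (h.A.phi s v) (by rw [abs_of_nonneg] <;> simp at hs <;> linarith)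
        obtain ⟨_, f2⟩ := hfar s (h.B.phi s u) (by rw [abs_of_nonneg] <;> simp at hs <;> linarith)
        rw [f1, f2] at h1
        norm_num at h1
        have h2 := h1.hasFDerivAt.hasFDerivWithinAt (s := Ici T)
        have h3 := h2.fderivWithin ((uniqueDiffOn_Ici T) s hs)
        refine Eq.trans h3 ?_
        ext; simp)
      (mem_Ici.2 ht) self_mem_Ici
    simp at this; linarith
  have hl : ∀ t ≤ -T, d t = d (-T) + 2 * (t + T) := by
    intro t ht
    have := (convex_Iic (-T)).is_const_of_fderivWithin_eq_zero (𝕜 := ℝ) (f := fun t => d t - 2 * (t + T))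
      (by
        intro s _
        exact ((hder s).sub (((hasDerivAt_id s).add_const T).const_mul 2)).differentiableAt.differentiableWithinAt)
      (by
        intro s hs
        have h1 := ((hder s).sub (((hasDerivAt_id s).add_const T).const_mul 2))
        obtain ⟨f1, _⟩ := hfar s (h.A.phi s v) (by rw [abs_of_nonpos] <;> simp at hs <;> linarith)
        obtain ⟨_, f2⟩ := hfar s (h.B.phi s u) (by rw [abs_of_nonpos] <;> simp at hs <;> linarith)
        rw [f1, f2] at h1
        norm_num at h1
        have h2 := h1.hasFDerivAt.hasFDerivWithinAt (s := Iic (-T))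
        have h3 := h2.fderivWithin ((uniqueDiffOn_Iic (-T)) s hs)
        refine Eq.trans h3 ?_
        ext; simp)
      (mem_Iic.2 ht) self_mem_Iic
    simp at this; linarith
  have h0 : (0 : ℝ) ∈ d '' univ := by
    apply (isPreconnected_univ.image _ hc.continuousOn).ordConnected.out
      (mem_image_of_mem _ (mem_univ (-T - |d (-T)|))) (mem_image_of_mem _ (mem_univ (T + |d T|)))
    rw [hr (T + |d T|) (by linarith [abs_nonneg (d T)]),
      hl (-T - |d (-T)|) (by linarith [abs_nonneg (d (-T))])]
    constructor
    · linarith [le_abs_self (d (-T)), abs_nonneg (d (-T))]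
    · linarith [neg_abs_le (d T), abs_nonneg (d T)]
  obtain ⟨t, -, ht⟩ := h0
  exact ⟨t, by simp [hd] at ht; linarith⟩

def Net.time {GA GB M K} (h : Net GA GB M K) (p : 𝕍) : ℝ := (h.exists_cross p.1 p.2).choose
theorem Net.time_spec {GA GB M K} (h : Net GA GB M K) (p : 𝕍) :
    h.B.phi (h.time p) p.1 = h.A.phi (h.time p) p.2 := (h.exists_cross p.1 p.2).choose_spec

theorem Net.time_lt {GA GB M K} (h : Net GA GB M K) (p : 𝕍) (c : ℝ) :
    h.time p < c ↔ h.A.phi c p.2 < h.B.phi c p.1 := by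
  constructor
  · intro hc
    exact h.cmp (h.A.phi_deriv _) (h.B.phi_deriv _) (h.time_spec p).ge hc
  · intro hc
    by_contra hn
    push Not at hn
    have := h.time_spec p
    rcases hn.eq_or_lt with e | e
    · rw [e] at hc; linarith
    · have := h.cmp (h.A.phi_deriv p.2) (h.B.phi_deriv p.1) hc.le e; linarith

theorem Net.lt_time {GA GB M K} (h : Net GA GB M K) (p : 𝕍) (c : ℝ) :
    c < h.time p ↔ h.B.phi c p.1 < h.A.phi c p.2 := by
  constructor
  · intro hc
    by_contra hn
    push Not at hn
    have := h.cmp (h.A.phi_deriv p.2) (h.B.phi_deriv p.1) hn hc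
    linarith [h.time_spec p]
  · intro hc
    by_contra hn
    push Not at hn
    have := h.cmp_le (h.A.phi_deriv p.2) (h.B.phi_deriv p.1) (h.time_spec p).ge hn
    linarith

theorem Net.time_cont {GA GB M K} (h : Net GA GB M K) : Continuous h.time := by
  refine OrderTopology.continuous_iff.2 fun c => ⟨?_, ?_⟩
  · have : h.time ⁻¹' Ioi c = {p : 𝕍 | h.B.phi c p.1 < h.A.phi c p.2} := by
      ext p; exact h.lt_time p c
    rw [this]
    exact isOpen_lt ((h.B.phi_cont c).comp continuous_fst) ((h.A.phi_cont c).comp continuous_snd)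
  · have : h.time ⁻¹' Iio c = {p : 𝕍 | h.A.phi c p.2 < h.B.phi c p.1} := by
      ext p; exact h.time_lt p c
    rw [this]
    exact isOpen_lt ((h.A.phi_cont c).comp continuous_snd) ((h.B.phi_cont c).comp continuous_fst)

theorem Net.time_eq {GA GB M K} (h : Net GA GB M K) {p : 𝕍} {c : ℝ}
    (hc : h.B.phi c p.1 = h.A.phi c p.2) : h.time p = c := by
  rcases lt_trichotomy (h.time p) c with e | e | e
  · rw [h.time_lt] at e; linarith
  · exact e
  · rw [h.lt_time] at e; linarith

theorem Fld.phi_cont2 {G M K} (h : Fld G M K) : Continuous (fun p : 𝕍 => h.phi p.1 p.2) := by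
  refine OrderTopology.continuous_iff.2 fun c => ⟨?_, ?_⟩
  · have : (fun p : 𝕍 => h.phi p.1 p.2) ⁻¹' Ioi c = {p : 𝕍 | h.lab p.1 c < p.2} := by
      ext p; simp only [mem_preimage, mem_Ioi, mem_ofPred_eq]
      rw [← (h.phi_mono p.1).lt_iff_lt (a := h.lab p.1 c), h.phi_lab]
    rw [this]
    exact isOpen_lt (h.lab_cont.comp (by fun_prop : Continuous fun p : 𝕍 => (p.1, c))) continuous_snd
  · have : (fun p : 𝕍 => h.phi p.1 p.2) ⁻¹' Iio c = {p : 𝕍 | p.2 < h.lab p.1 c} := by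
      ext p; simp only [mem_preimage, mem_Iio, mem_ofPred_eq]
      rw [← (h.phi_mono p.1).lt_iff_lt (b := h.lab p.1 c), h.phi_lab]
    rw [this]
    exact isOpen_lt continuous_snd (h.lab_cont.comp (by fun_prop : Continuous fun p : 𝕍 => (p.1, c)))

def Net.Phi {GA GB M K} (h : Net GA GB M K) : 𝕍 ≃ₜ 𝕍 where
  toFun p := (h.B.lab p.1 p.2, h.A.lab p.1 p.2)
  invFun p := (h.time p, h.A.phi (h.time p) p.2)
  left_inv p := by
    have : h.time (h.B.lab p.1 p.2, h.A.lab p.1 p.2) = p.1 :=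
      h.time_eq (by simp [Fld.phi_lab])
    simp only [this, h.A.phi_lab]
  right_inv p := by
    have := h.time_spec p
    ext
    · simp only [← this, h.B.lab_phi]
    · simp only [h.A.lab_phi]
  continuous_toFun := h.B.lab_cont.prodMk h.A.lab_cont
  continuous_invFun := h.time_cont.prodMk
    (h.A.phi_cont2.comp (h.time_cont.prodMk continuous_snd))

theorem Net.Phi_apply {GA GB M K} (h : Net GA GB M K) (p : 𝕍) :
    h.Phi p = (h.B.lab p.1 p.2, h.A.lab p.1 p.2) := rfl
theorem Net.Phi_symm_fst {GA GB M K} (h : Net GA GB M K) (p : 𝕍) :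
    (h.Phi.symm p).1 = h.time p := rfl
theorem Net.Phi_symm_A {GA GB M K} (h : Net GA GB M K) (p : 𝕍) :
    (h.Phi.symm p).2 = h.A.phi (h.Phi.symm p).1 p.2 := rfl
theorem Net.Phi_symm_B {GA GB M K} (h : Net GA GB M K) (p : 𝕍) :
    (h.Phi.symm p).2 = h.B.phi (h.Phi.symm p).1 p.1 := (h.time_spec p).symm

def clp (a b t : ℝ) : ℝ := max a (min t b)

theorem clp_lip (a b t t' : ℝ) : |clp a b t - clp a b t'| ≤ |t - t'| := by
  unfold clp
  refine (abs_max_sub_max_le_max _ _ _ _).trans ?_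
  simp only [sub_self, abs_zero]
  refine max_le (abs_nonneg _) ?_
  refine (abs_min_sub_min_le_max _ _ _ _).trans ?_
  simp

theorem clp_mem {a b : ℝ} (h : a ≤ b) (t : ℝ) : clp a b t ∈ Icc a b :=
  ⟨le_max_left _ _, max_le h (min_le_right _ _)⟩

theorem clp_of_mem {a b t : ℝ} (h : t ∈ Icc a b) : clp a b t = t := by
  unfold clp; rw [min_eq_left h.2, max_eq_right h.1]

theorem clp_cont (a b : ℝ) : Continuous (clp a b) := by unfold clp; fun_prop

theorem Net.exists_cutoff {gA gB : ℝ → ℝ → ℝ} {t1 t2 M K : ℝ} {Y : Set ℝ} {π : ℝ → ℝ}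
    (h12 : t1 ≤ t2)
    (hπ : ∀ y, π y ∈ Y) (hπ1 : ∀ y y', |π y - π y'| ≤ |y - y'|) (hπ2 : ∀ y ∈ Y, π y = y)
    (cA : ContinuousOn (fun p : 𝕍 => gA p.1 p.2) (Icc t1 t2 ×ˢ Y))
    (cB : ContinuousOn (fun p : 𝕍 => gB p.1 p.2) (Icc t1 t2 ×ˢ Y))
    (bA : ∀ t ∈ Icc t1 t2, ∀ y ∈ Y, |gA t y| ≤ M) (bB : ∀ t ∈ Icc t1 t2, ∀ y ∈ Y, |gB t y| ≤ M)
    (lA : ∀ t ∈ Icc t1 t2, ∀ y ∈ Y, ∀ y' ∈ Y, |gA t y - gA t y'| ≤ K * |y - y'|)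
    (lB : ∀ t ∈ Icc t1 t2, ∀ y ∈ Y, ∀ y' ∈ Y, |gB t y - gB t y'| ≤ K * |y - y'|)
    (hle : ∀ t ∈ Icc t1 t2, ∀ y ∈ Y, gA t y ≤ gB t y)
    (hlt : ∀ t ∈ Ioo t1 t2, t ≠ 0 → ∀ y ∈ Y, gA t y < gB t y)
    (hK : 0 ≤ K) :
    ∃ GA GB M', Net GA GB M' K ∧ (∀ t ∈ Icc t1 t2, ∀ y ∈ Y, GA t y = gA t y) ∧
      (∀ t ∈ Icc t1 t2, ∀ y ∈ Y, GB t y = gB t y) := by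
  set χ : ℝ → ℝ := fun t => max 0 (1 - |t - clp t1 t2 t|) with hχ
  have hπc : Continuous π := by
    have : LipschitzWith 1 π := LipschitzWith.of_dist_le_mul fun x y => by
      simpa [Real.dist_eq] using hπ1 x y
    exact this.continuous
  have χc : Continuous χ := by have := clp_cont t1 t2; simp only [hχ]; fun_prop
  have χ0 : ∀ t, 0 ≤ χ t := fun t => le_max_left _ _
  have χ1 : ∀ t, χ t ≤ 1 := fun t => max_le zero_le_one (by linarith [abs_nonneg (t - clp t1 t2 t)])
  have χe : ∀ t ∈ Icc t1 t2, χ t = 1 := fun t ht => by simp [hχ, clp_of_mem ht]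
  have χlt : ∀ t, t ∉ Icc t1 t2 → χ t < 1 := fun t ht => by
    refine max_lt one_pos ?_
    have : t - clp t1 t2 t ≠ 0 := fun h => ht (by
      rw [sub_eq_zero.1 h]; exact clp_mem h12 t)
    linarith [abs_pos.2 this]
  have fld : ∀ (g : ℝ → ℝ → ℝ) (e : ℝ), |e| ≤ 1 →
      ContinuousOn (fun p : 𝕍 => g p.1 p.2) (Icc t1 t2 ×ˢ Y) →
      (∀ t ∈ Icc t1 t2, ∀ y ∈ Y, |g t y| ≤ M) →
      (∀ t ∈ Icc t1 t2, ∀ y ∈ Y, ∀ y' ∈ Y, |g t y - g t y'| ≤ K * |y - y'|) →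
      Fld (fun t y => χ t * g (clp t1 t2 t) (π y) + (1 - χ t) * e) (M + 1) K := by
    intro g e he hc hb hl
    refine ⟨?_, ?_, ?_, hK⟩
    · have h1 : Continuous (fun p : 𝕍 => g (clp t1 t2 p.1) (π p.2)) := by
        have : Continuous (fun p : 𝕍 => (clp t1 t2 p.1, π p.2)) :=
          ((clp_cont t1 t2).comp continuous_fst).prodMk (hπc.comp continuous_snd)
        exact hc.comp_continuous this fun p => ⟨clp_mem h12 _, hπ _⟩
      exact ((χc.comp continuous_fst).mul h1).add
        ((continuous_const.sub (χc.comp continuous_fst)).mul continuous_const)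
    · intro t y
      have h1 := hb _ (clp_mem h12 t) _ (hπ y)
      have hM : 0 ≤ M := (abs_nonneg _).trans h1
      have h0 := χ0 t
      have h2 := χ1 t
      calc _ ≤ |χ t * g (clp t1 t2 t) (π y)| + |(1 - χ t) * e| := abs_add_le _ _
        _ = χ t * |g (clp t1 t2 t) (π y)| + (1 - χ t) * |e| := by
          rw [abs_mul, abs_mul, abs_of_nonneg h0, abs_of_nonneg (by linarith : 0 ≤ 1 - χ t)]
        _ ≤ 1 * M + 1 * 1 := by gcongr; linarith
        _ = _ := by ring
    · intro t y y'
      have h1 := hl _ (clp_mem h12 t) _ (hπ y) _ (hπ y')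
      have : χ t * g (clp t1 t2 t) (π y) + (1 - χ t) * e - (χ t * g (clp t1 t2 t) (π y') + (1 - χ t) * e)
        = χ t * (g (clp t1 t2 t) (π y) - g (clp t1 t2 t) (π y')) := by ring
      rw [this, abs_mul, abs_of_nonneg (χ0 t)]
      calc _ ≤ 1 * (K * |y - y'|) := by
            gcongr
            · exact χ1 t
            · exact h1.trans (mul_le_mul_of_nonneg_left (hπ1 y y') hK)
        _ = _ := one_mul _
  refine ⟨_, _, M + 1, ⟨fld gA (-1) (by simp) cA bA lA, fld gB 1 (by simp) cB bB lB, ?_, ?_, ?_⟩, ?_, ?_⟩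
  · intro t y
    have := hle _ (clp_mem h12 t) _ (hπ y)
    nlinarith [χ0 t, χ1 t]
  · intro s1 s2 hs
    have : ∃ t ∈ Ioo s1 s2, t ∉ ({t1, t2, 0} : Set ℝ) := by
      by_contra hcon
      push Not at hcon
      have hfin : (Ioo s1 s2).Finite := (Set.toFinite ({t1, t2, 0} : Set ℝ)).subset hcon
      exact (Ioo_infinite hs) hfin
    obtain ⟨t, ht, hn⟩ := this
    refine ⟨t, ht, fun y => ?_⟩
    simp only [mem_insert_iff, mem_singleton_iff, not_or] at hn
    have h1 := hle _ (clp_mem h12 t) _ (hπ y)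
    by_cases hI : t ∈ Icc t1 t2
    · have h2 := hlt t ⟨lt_of_le_of_ne hI.1 (Ne.symm hn.1), lt_of_le_of_ne hI.2 hn.2.1⟩ hn.2.2 _ (hπ y)
      simp only [χe t hI, clp_of_mem hI]; linarith
    · have := χlt t hI
      nlinarith [χ0 t]
  · refine ⟨|t1| + |t2| + 1, by positivity, fun t y ht => ?_⟩
    have : χ t = 0 := by
      refine max_eq_left ?_
      have hm := clp_mem h12 t
      have : |clp t1 t2 t| ≤ |t1| + |t2| := by
        rw [abs_le]
        constructor
        · linarith [neg_abs_le t1, abs_nonneg t2, hm.1]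
        · linarith [le_abs_self t2, abs_nonneg t1, hm.2]
      have := abs_sub_abs_le_abs_sub t (clp t1 t2 t)
      linarith
    simp [this]
  · intro t ht y hy
    simp [χe t ht, clp_of_mem ht, hπ2 y hy]
  · intro t ht y hy
    simp [χe t ht, clp_of_mem ht, hπ2 y hy]

def CurveOn (Q : 𝕍 → 𝕍 → Prop) (γ dγ : ℝ → 𝕍) (a b : ℝ) : Prop :=
  ContinuousOn dγ (Ioo a b) ∧ ∀ t ∈ Ioo a b, HasDerivAt γ (dγ t) t ∧ dγ t ≠ 0 ∧ Q (γ t) (dγ t)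

def Curve (Q : 𝕍 → 𝕍 → Prop) (S : Set 𝕍) : Prop :=
  ∃ γ dγ a b, CurveOn Q γ dγ a b ∧ S = γ '' Ioo a b

def TEF {ι : Type} (C D : ι → Set 𝕍 → Prop) : Prop :=
  ∃ e : OpenPartialHomeomorph 𝕍 𝕍, (0 : 𝕍) ∈ e.source ∧ e 0 = 0 ∧
    ∀ i S, S ⊆ e.source → (C i S ↔ D i (e '' S))

theorem TEF.symm {ι : Type} {C D : ι → Set 𝕍 → Prop} (h : TEF C D) : TEF D C := by
  obtain ⟨e, h0, h1, h2⟩ := h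
  have h3 : (0 : 𝕍) ∈ e.target := by have := e.map_source h0; rwa [h1] at this
  refine ⟨e.symm, h3, ?_, ?_⟩
  · have := e.left_inv h0; rwa [h1] at this
  · intro i S hS
    rw [h2 i (e.symm '' S)]
    · have k : e '' (e.symm '' S) = S := e.toPartialEquiv.image_symm_image_of_subset_target hS
      rw [k]
    · rintro _ ⟨x, hx, rfl⟩
      exact e.map_target (hS hx)

theorem TEF.trans {ι : Type} {C D E : ι → Set 𝕍 → Prop} (h : TEF C D) (h' : TEF D E) :
    TEF C E := by
  obtain ⟨e, h0, h1, h2⟩ := h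
  obtain ⟨f, k0, k1, k2⟩ := h'
  refine ⟨e.trans f, ?_, ?_, ?_⟩
  · simp [h0, h1, k0]
  · simp [h1, k1]
  · intro i S hS
    have hs1 : S ⊆ e.source := fun x hx => by have := hS hx; simp at this; exact this.1
    have hs2 : e '' S ⊆ f.source := by
      rintro _ ⟨x, hx, rfl⟩; have := hS hx; simp at this; exact this.2
    rw [h2 i S hs1, k2 i _ hs2, image_image]; rfl

theorem TEF.congr {ι : Type} {C C' D : ι → Set 𝕍 → Prop} (h : TEF C D) {W : Set 𝕍}
    (hW : IsOpen W) (h0 : (0 : 𝕍) ∈ W) (hC : ∀ i S, S ⊆ W → (C i S ↔ C' i S)) : TEF C' D := by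
  obtain ⟨e, k0, k1, k2⟩ := h
  refine ⟨e.restrOpen W hW, by simp [k0, h0], by simp [k1], ?_⟩
  intro i S hS
  have : S ⊆ e.source ∩ W := by simpa using hS
  rw [← hC i S (this.trans inter_subset_right), k2 i S (this.trans inter_subset_left)]
  rfl

theorem topEquiv_of_TEF {ω Ω : 𝕍 → 𝕍 → ℝ}
    (h : TEF (fun _ : Unit => Curve (fun p v => ω p v = 0)) (fun _ => Curve (fun p v => Ω p v = 0))) :
    TopEquivAt0 ω Ω := by
  have cv : ∀ (ω : 𝕍 → 𝕍 → ℝ) S, Curve (fun p v => ω p v = 0) S ↔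
      ∃ γ I, IsIntegralCurveOnBDE ω γ I ∧ S = γ '' I := by
    intro ω S
    constructor
    · rintro ⟨γ, dγ, a, b, h, rfl⟩
      exact ⟨γ, _, ⟨⟨a, b, rfl⟩, dγ, h.1, h.2⟩, rfl⟩
    · rintro ⟨γ, I, ⟨⟨a, b, rfl⟩, dγ, h1, h2⟩, rfl⟩
      exact ⟨γ, dγ, a, b, ⟨h1, h2⟩, rfl⟩
  obtain ⟨e, h0, h1, h2⟩ := h
  refine ⟨e.source, e.target, e, e.symm, e.open_source, e.open_target, h0, ?_, h1,
    e.continuousOn, e.continuousOn_symm, e.bijOn, e.invOn, ?_, ?_⟩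
  · have := e.map_source h0; rwa [h1] at this
  · intro γ I hγ hm
    exact (cv Ω _).1 ((h2 () (γ '' I) hm.image_subset).1 ((cv ω _).2 ⟨γ, I, hγ, rfl⟩))
  · intro γ I hγ hm
    refine (cv ω _).1 ((h2 () (e.symm '' (γ '' I)) ?_).2 ?_)
    · rintro _ ⟨x, hx, rfl⟩
      exact e.map_target (hm.image_subset hx)
    · have k : e '' (e.symm '' (γ '' I)) = γ '' I :=
        e.toPartialEquiv.image_symm_image_of_subset_target hm.image_subset
      rw [k]
      exact (cv Ω _).2 ⟨γ, I, hγ, rfl⟩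

theorem Curve.congr {Q Q' : 𝕍 → 𝕍 → Prop} {W : Set 𝕍}
    (h : ∀ p ∈ W, ∀ v, Q p v ↔ Q' p v) {S : Set 𝕍} (hS : S ⊆ W) : Curve Q S ↔ Curve Q' S := by
  constructor
  · rintro ⟨γ, dγ, a, b, ⟨h1, h2⟩, rfl⟩
    exact ⟨γ, dγ, a, b, ⟨h1, fun t ht => ⟨(h2 t ht).1, (h2 t ht).2.1,
      (h _ (hS (mem_image_of_mem _ ht)) _).1 (h2 t ht).2.2⟩⟩, rfl⟩
  · rintro ⟨γ, dγ, a, b, ⟨h1, h2⟩, rfl⟩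
    exact ⟨γ, dγ, a, b, ⟨h1, fun t ht => ⟨(h2 t ht).1, (h2 t ht).2.1,
      (h _ (hS (mem_image_of_mem _ ht)) _).2 (h2 t ht).2.2⟩⟩, rfl⟩

theorem Curve.linear_aux {Q : 𝕍 → 𝕍 → Prop} (L : 𝕍 ≃L[ℝ] 𝕍) {S : Set 𝕍}
    (h : Curve (fun p v => Q (L p) (L v)) S) : Curve Q (L '' S) := by
  obtain ⟨γ, dγ, a, b, ⟨h1, h2⟩, rfl⟩ := h
  refine ⟨fun t => L (γ t), fun t => L (dγ t), a, b, ⟨L.continuous.comp_continuousOn h1, fun t ht => ?_⟩, ?_⟩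
  · obtain ⟨k1, k2, k3⟩ := h2 t ht
    exact ⟨L.hasFDerivAt.comp_hasDerivAt t k1, by simpa using k2, k3⟩
  · rw [image_image]

theorem Curve.linear {Q : 𝕍 → 𝕍 → Prop} (L : 𝕍 ≃L[ℝ] 𝕍) {S : Set 𝕍} :
    Curve (fun p v => Q (L p) (L v)) S ↔ Curve Q (L '' S) := by
  refine ⟨Curve.linear_aux L, fun h => ?_⟩
  have : L.symm '' (L '' S) = S := by rw [image_image]; simp
  rw [← this]
  apply Curve.linear_aux L.symm
  simpa using h

theorem exists_Ioo {T : Set ℝ} (ho : IsOpen T) (hc : IsPreconnected T) (hb : ∃ C, ∀ t ∈ T, |t| ≤ C) :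
    ∃ a b, T = Ioo a b := by
  obtain ⟨C, hC⟩ := hb
  rcases T.eq_empty_or_nonempty with rfl | hne
  · exact ⟨0, 0, by simp⟩
  have bB : BddBelow T := ⟨-C, fun t ht => (abs_le.1 (hC t ht)).1⟩
  have bA : BddAbove T := ⟨C, fun t ht => (abs_le.1 (hC t ht)).2⟩
  refine ⟨sInf T, sSup T, ?_⟩
  apply Subset.antisymm
  · intro t ht
    obtain ⟨l, u, hlu, hsub⟩ := mem_nhds_iff_exists_Ioo_subset.1 (ho.mem_nhds ht)
    constructor
    · have : (l + t) / 2 ∈ T := hsub ⟨by linarith [hlu.1], by linarith [hlu.1, hlu.2]⟩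
      linarith [csInf_le bB this, hlu.1]
    · have : (u + t) / 2 ∈ T := hsub ⟨by linarith [hlu.1, hlu.2], by linarith [hlu.2]⟩
      linarith [le_csSup bA this, hlu.2]
  · exact IsConnected.Ioo_csInf_csSup_subset ⟨hne, hc⟩ bB bA

theorem isOpen_image_of_deriv {f f' : ℝ → ℝ} {I : Set ℝ} (hI : IsOpen I) (hc : IsPreconnected I)
    (hf : ∀ t ∈ I, HasDerivAt f (f' t) t) (h0 : ∀ t ∈ I, f' t ≠ 0) : IsOpen (f '' I) := by
  have hp : IsPreconnected (f '' I) :=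
    hc.image _ fun t ht => (hf t ht).continuousAt.continuousWithinAt
  rw [isOpen_iff_mem_nhds]
  rintro _ ⟨t, ht, rfl⟩
  have h1 : ∃ s ∈ I, f t < f s := by
    by_contra hcon
    push Not at hcon
    exact h0 t ht (IsLocalMax.hasDerivAt_eq_zero
      (by filter_upwards [hI.mem_nhds ht] with s hs using hcon s hs) (hf t ht))
  have h2 : ∃ s ∈ I, f s < f t := by
    by_contra hcon
    push Not at hcon
    exact h0 t ht (IsLocalMin.hasDerivAt_eq_zero
      (by filter_upwards [hI.mem_nhds ht] with s hs using hcon s hs) (hf t ht))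
  obtain ⟨s1, hs1, l1⟩ := h1
  obtain ⟨s2, hs2, l2⟩ := h2
  exact mem_of_superset (Icc_mem_nhds l2 l1)
    (hp.ordConnected.out (mem_image_of_mem _ hs2) (mem_image_of_mem _ hs1))

def Seg (S : Set 𝕍) : Prop :=
  (∃ u J, IsOpen J ∧ IsPreconnected J ∧ S = (fun v : ℝ => ((u, v) : 𝕍)) '' J) ∨
  (∃ v J, IsOpen J ∧ IsPreconnected J ∧ S = (fun u : ℝ => ((u, v) : 𝕍)) '' J)

theorem leaf {GA GB M K} (h : Net GA GB M K) {R : Set 𝕍} {κ : 𝕍 → 𝕍}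
    {Q : 𝕍 → 𝕍 → Prop} (inj : InjOn κ R) (bdd : ∃ C, ∀ p ∈ R, |(κ p).1| ≤ C)
    (c1 : ∀ γ dγ a b, CurveOn Q γ dγ a b → (∀ t ∈ Ioo a b, γ t ∈ R) →
      ∃ τ' : ℝ → ℝ, (∀ t ∈ Ioo a b, HasDerivAt (fun t => (κ (γ t)).1) (τ' t) t ∧ τ' t ≠ 0) ∧
      ((∀ t ∈ Ioo a b, HasDerivAt (fun t => (κ (γ t)).2) (GA (κ (γ t)).1 (κ (γ t)).2 * τ' t) t) ∨
       (∀ t ∈ Ioo a b, HasDerivAt (fun t => (κ (γ t)).2) (GB (κ (γ t)).1 (κ (γ t)).2 * τ' t) t)))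
    (c2 : ∀ Y a b, ((∀ t ∈ Ioo a b, HasDerivAt Y (GA t (Y t)) t) ∨
        (∀ t ∈ Ioo a b, HasDerivAt Y (GB t (Y t)) t)) → (∀ t ∈ Ioo a b, (t, Y t) ∈ κ '' R) →
      ∃ γ dγ, CurveOn Q γ dγ a b ∧ ∀ t ∈ Ioo a b, γ t ∈ R ∧ κ (γ t) = (t, Y t))
    {S : Set 𝕍} (hS : S ⊆ R) :
    Curve Q S ↔ Seg ((fun p => h.Phi (κ p)) '' S) := by
  constructor
  · rintro ⟨γ, dγ, a, b, hγ, rfl⟩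
    obtain ⟨τ', h1, h2⟩ := c1 γ dγ a b hγ (fun t ht => hS (mem_image_of_mem _ ht))
    rcases (Ioo a b).eq_empty_or_nonempty with he | ⟨t0, ht0⟩
    · left; refine ⟨0, ∅, isOpen_empty, isPreconnected_empty, ?_⟩; simp [he]
    have hTo := isOpen_image_of_deriv isOpen_Ioo isPreconnected_Ioo (fun t ht => (h1 t ht).1)
      (fun t ht => (h1 t ht).2)
    have hTp : IsPreconnected ((fun t => (κ (γ t)).1) '' Ioo a b) :=
      isPreconnected_Ioo.image _ fun t ht => (h1 t ht).1.continuousAt.continuousWithinAt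
    rcases h2 with h2 | h2
    · right
      have hl := fun t ht => h.A.lab_const isOpen_Ioo isPreconnected_Ioo (fun t ht => (h1 t ht).1) h2
        (s := t) (t := t0) ht ht0
      set v0 := h.A.lab (κ (γ t0)).1 (κ (γ t0)).2
      have hS' : (fun p => h.Phi (κ p)) '' (γ '' Ioo a b) =
          (fun u : ℝ => ((u, v0) : 𝕍)) '' {u | h.time (u, v0) ∈ (fun t => (κ (γ t)).1) '' Ioo a b} := by
        ext q; constructor
        · rintro ⟨_, ⟨t, ht, rfl⟩, rfl⟩
          refine ⟨(h.Phi (κ (γ t))).1, ?_, ?_⟩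
          · refine ⟨t, ht, ?_⟩
            rw [← hl t ht]
            have : h.time (h.Phi (κ (γ t))) = (κ (γ t)).1 := by rw [← h.Phi_symm_fst]; simp
            exact this.symm
          · rw [← hl t ht]; rfl
        · rintro ⟨u, ⟨t, ht, he⟩, rfl⟩
          refine ⟨γ t, mem_image_of_mem _ ht, ?_⟩
          show h.Phi (κ (γ t)) = (u, v0)
          rw [← h.Phi.symm.injective.eq_iff, h.Phi.symm_apply_apply]
          ext
          · exact he
          · rw [h.Phi_symm_A, h.Phi_symm_fst, ← he]; show _ = h.A.phi (κ (γ t)).1 v0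
            rw [← hl t ht, h.A.phi_lab]
      refine ⟨v0, _, ?_, ?_, hS'⟩
      · exact hTo.preimage (h.time_cont.comp (by fun_prop : Continuous fun u : ℝ => (u, v0)))
      · have : {u | h.time (u, v0) ∈ (fun t => (κ (γ t)).1) '' Ioo a b} =
            (fun s => h.B.lab s (h.A.phi s v0)) '' ((fun t => (κ (γ t)).1) '' Ioo a b) := by
          ext u; constructor
          · intro hu
            refine ⟨_, hu, ?_⟩
            have := h.time_spec (u, v0); simp only at this ⊢
            rw [← this, h.B.lab_phi]
          · rintro ⟨s, hs, rfl⟩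
            have : h.time (h.B.lab s (h.A.phi s v0), v0) = s := h.time_eq (by simp [Fld.phi_lab])
            simp only [mem_ofPred_eq, this]; exact hs
        rw [this]
        refine hTp.image _ (Continuous.continuousOn ?_)
        exact h.B.lab_cont.comp (continuous_id.prodMk
          (h.A.phi_cont2.comp (by fun_prop : Continuous fun s : ℝ => (s, v0))))
    · left
      have hl := fun t ht => h.B.lab_const isOpen_Ioo isPreconnected_Ioo (fun t ht => (h1 t ht).1) h2
        (s := t) (t := t0) ht ht0
      set v0 := h.B.lab (κ (γ t0)).1 (κ (γ t0)).2
      have hS' : (fun p => h.Phi (κ p)) '' (γ '' Ioo a b) =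
          (fun u : ℝ => ((v0, u) : 𝕍)) '' {u | h.time (v0, u) ∈ (fun t => (κ (γ t)).1) '' Ioo a b} := by
        ext q; constructor
        · rintro ⟨_, ⟨t, ht, rfl⟩, rfl⟩
          refine ⟨(h.Phi (κ (γ t))).2, ?_, ?_⟩
          · refine ⟨t, ht, ?_⟩
            rw [← hl t ht]
            have : h.time (h.Phi (κ (γ t))) = (κ (γ t)).1 := by rw [← h.Phi_symm_fst]; simp
            exact this.symm
          · rw [← hl t ht]; rfl
        · rintro ⟨u, ⟨t, ht, he⟩, rfl⟩
          refine ⟨γ t, mem_image_of_mem _ ht, ?_⟩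
          show h.Phi (κ (γ t)) = (v0, u)
          rw [← h.Phi.symm.injective.eq_iff, h.Phi.symm_apply_apply]
          ext
          · exact he
          · rw [h.Phi_symm_B, h.Phi_symm_fst, ← he]; show _ = h.B.phi (κ (γ t)).1 v0
            rw [← hl t ht, h.B.phi_lab]
      refine ⟨v0, _, ?_, ?_, hS'⟩
      · exact hTo.preimage (h.time_cont.comp (by fun_prop : Continuous fun u : ℝ => (v0, u)))
      · have : {u | h.time (v0, u) ∈ (fun t => (κ (γ t)).1) '' Ioo a b} =
            (fun s => h.A.lab s (h.B.phi s v0)) '' ((fun t => (κ (γ t)).1) '' Ioo a b) := by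
          ext u; constructor
          · intro hu
            refine ⟨_, hu, ?_⟩
            have := h.time_spec (v0, u); simp only at this ⊢
            rw [this, h.A.lab_phi]
          · rintro ⟨s, hs, rfl⟩
            have : h.time (v0, h.A.lab s (h.B.phi s v0)) = s := h.time_eq (by simp [Fld.phi_lab])
            simp only [mem_ofPred_eq, this]; exact hs
        rw [this]
        refine hTp.image _ (Continuous.continuousOn ?_)
        exact h.A.lab_cont.comp (continuous_id.prodMk
          (h.B.phi_cont2.comp (by fun_prop : Continuous fun s : ℝ => (s, v0))))
  · have fin : ∀ (T : Set ℝ) (Y : ℝ → ℝ), IsOpen T → IsPreconnected T →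
        ((∀ t, HasDerivAt Y (GA t (Y t)) t) ∨ (∀ t, HasDerivAt Y (GB t (Y t)) t)) →
        (κ '' S = (fun t => (t, Y t)) '' T) → Curve Q S := by
      intro T Y hT hT' hY hST
      obtain ⟨C, hC⟩ := bdd
      have hmem : ∀ t ∈ T, ∃ p ∈ S, κ p = (t, Y t) := fun t ht => by
        have : (t, Y t) ∈ κ '' S := by rw [hST]; exact ⟨t, ht, rfl⟩
        exact this
      obtain ⟨a, b, rfl⟩ := exists_Ioo hT hT' ⟨C, fun t ht => by
        obtain ⟨p, hp, he⟩ := hmem t ht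
        have := hC p (hS hp); rw [he] at this; exact this⟩
      obtain ⟨γ, dγ, g1, g2⟩ := c2 Y a b (hY.imp (fun h t _ => h t) (fun h t _ => h t))
        (fun t ht => by obtain ⟨p, hp, he⟩ := hmem t ht; exact ⟨p, hS hp, he⟩)
      refine ⟨γ, dγ, a, b, g1, ?_⟩
      ext p; constructor
      · intro hp
        have : κ p ∈ κ '' S := mem_image_of_mem _ hp
        rw [hST] at this
        obtain ⟨t, ht, he⟩ := this
        exact ⟨t, ht, inj (g2 t ht).1 (hS hp) (by rw [(g2 t ht).2, ← he])⟩
      · rintro ⟨t, ht, rfl⟩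
        obtain ⟨p, hp, he⟩ := hmem t ht
        have := inj (hS hp) (g2 t ht).1 (by rw [(g2 t ht).2, ← he])
        rwa [← this]
    have himg : ∀ X : Set 𝕍, (fun p => h.Phi (κ p)) '' S = X → κ '' S = h.Phi.symm '' X := by
      rintro _ rfl
      rw [image_image]; simp
    rintro (⟨u, J, hJ, hJ', he⟩ | ⟨v, J, hJ, hJ', he⟩)
    · refine fin ((fun v => h.time (u, v)) '' J) (fun t => h.B.phi t u) ?_ ?_
        (Or.inr fun t => h.B.phi_deriv u t) ?_
      · have : (fun v => h.time (u, v)) '' J = (fun t => h.A.lab t (h.B.phi t u)) ⁻¹' J := by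
          ext t; constructor
          · rintro ⟨v, hv, rfl⟩
            have := h.time_spec (u, v); simp only at this
            simp only [mem_preimage]
            rw [this, h.A.lab_phi]; exact hv
          · intro ht
            exact ⟨_, ht, h.time_eq (by simp [Fld.phi_lab])⟩
        rw [this]
        exact hJ.preimage (h.A.lab_cont.comp (continuous_id.prodMk
          (h.B.phi_cont2.comp (by fun_prop : Continuous fun s : ℝ => (s, u)))))
      · exact hJ'.image _ (h.time_cont.comp (by fun_prop : Continuous fun v : ℝ => (u, v))).continuousOn
      · rw [himg _ he, image_image, image_image]
        refine image_congr fun v _ => ?_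
        ext
        · rfl
        · exact h.Phi_symm_B (u, v)
    · refine fin ((fun u => h.time (u, v)) '' J) (fun t => h.A.phi t v) ?_ ?_
        (Or.inl fun t => h.A.phi_deriv v t) ?_
      · have : (fun u => h.time (u, v)) '' J = (fun t => h.B.lab t (h.A.phi t v)) ⁻¹' J := by
          ext t; constructor
          · rintro ⟨u, hv, rfl⟩
            have := h.time_spec (u, v); simp only at this
            simp only [mem_preimage]
            rw [← this, h.B.lab_phi]; exact hv
          · intro ht
            exact ⟨_, ht, h.time_eq (by simp [Fld.phi_lab])⟩
        rw [this]
        exact hJ.preimage (h.B.lab_cont.comp (continuous_id.prodMk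
          (h.A.phi_cont2.comp (by fun_prop : Continuous fun s : ℝ => (s, v)))))
      · exact hJ'.image _ (h.time_cont.comp (by fun_prop : Continuous fun u : ℝ => (u, v))).continuousOn
      · rw [himg _ he, image_image, image_image]
        refine image_congr fun u _ => ?_
        ext
        · rfl
        · exact h.Phi_symm_A (u, v)

structure NF (σ r : ℝ) (D Ds Dc B : 𝕍 → ℝ) : Prop where
  r0 : 0 < r
  r1 : r ≤ 1 / 10
  hD : ∀ p, ‖p‖ ≤ r → HasFDerivAt D (Ds p • ContinuousLinearMap.fst ℝ ℝ ℝ + Dc p • ContinuousLinearMap.snd ℝ ℝ ℝ) p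
  D0 : D 0 = 0
  Ds0 : Ds 0 = 0
  Dc0 : Dc 0 = 0
  B0 : B 0 = 0
  ls : ∀ p p', ‖p‖ ≤ r → ‖p'‖ ≤ r → |(Ds p - 2 * p.1) - (Ds p' - 2 * p'.1)| ≤ ‖p - p'‖ / 100
  lc : ∀ p p', ‖p‖ ≤ r → ‖p'‖ ≤ r →
    |(Dc p - 2 * σ * p.2) - (Dc p' - 2 * σ * p'.2)| ≤ ‖p - p'‖ / 100
  lb : ∀ p p', ‖p‖ ≤ r → ‖p'‖ ≤ r → |B p - B p'| ≤ ‖p - p'‖ / 100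

def QH (D B : 𝕍 → ℝ) (p v : 𝕍) : Prop := (v.2 + B p * v.1) ^ 2 = D p * v.1 ^ 2
def QV (D B : 𝕍 → ℝ) (p v : 𝕍) : Prop := (v.1 + B p * v.2) ^ 2 = D p * v.2 ^ 2

section
variable {σ r : ℝ} {D Ds Dc B : 𝕍 → ℝ}

theorem NF.ds (h : NF σ r D Ds Dc B) {p : 𝕍} (hp : ‖p‖ ≤ r) : |Ds p - 2 * p.1| ≤ ‖p‖ / 100 := by
  have := h.ls p 0 hp (by simpa using h.r0.le)
  simpa [h.Ds0] using this
theorem NF.dc (h : NF σ r D Ds Dc B) {p : 𝕍} (hp : ‖p‖ ≤ r) : |Dc p - 2 * σ * p.2| ≤ ‖p‖ / 100 := by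
  have := h.lc p 0 hp (by simpa using h.r0.le)
  simpa [h.Dc0] using this
theorem NF.db (h : NF σ r D Ds Dc B) {p : 𝕍} (hp : ‖p‖ ≤ r) : |B p| ≤ ‖p‖ / 100 := by
  have := h.lb p 0 hp (by simpa using h.r0.le)
  simpa [h.B0] using this

theorem NF.E (h : NF σ r D Ds Dc B) {p p' : 𝕍} (hp : ‖p‖ ≤ r) (hp' : ‖p'‖ ≤ r) :
    |(D p - p.1 ^ 2 - σ * p.2 ^ 2) - (D p' - p'.1 ^ 2 - σ * p'.2 ^ 2)| ≤
      max ‖p‖ ‖p'‖ * ‖p - p'‖ / 50 := by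
  set m := max ‖p‖ ‖p'‖
  have hm : m ≤ r := max_le hp hp'
  have key := Convex.norm_image_sub_le_of_norm_hasFDerivWithin_le (𝕜 := ℝ)
    (f := fun p : 𝕍 => D p - p.1 ^ 2 - σ * p.2 ^ 2)
    (f' := fun p => (Ds p - 2 * p.1) • ContinuousLinearMap.fst ℝ ℝ ℝ + (Dc p - 2 * σ * p.2) • ContinuousLinearMap.snd ℝ ℝ ℝ)
    (s := Metric.closedBall (0 : 𝕍) m) (C := m / 50) (x := p') (y := p) ?_ ?_ (convex_closedBall _ _)
    (by simp [m]) (by simp [m])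
  · rw [Real.norm_eq_abs] at key
    refine key.trans (le_of_eq ?_); ring
  · intro x hx
    have hx' : ‖x‖ ≤ r := (by simpa using hx : ‖x‖ ≤ m).trans hm
    have h1 := h.hD x hx'
    have h2 : HasFDerivAt (fun p : 𝕍 => p.1 ^ 2) _ x := (hasFDerivAt_fst (𝕜 := ℝ) (p := x)).pow 2
    have h3 : HasFDerivAt (fun p : 𝕍 => σ * p.2 ^ 2) _ x := ((hasFDerivAt_snd (𝕜 := ℝ) (p := x)).pow 2).const_mul σ
    refine ((h1.sub h2).sub h3).hasFDerivWithinAt.congr_fderiv ?_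
    ext <;> simp <;> ring
  · intro x hx
    have hxm : ‖x‖ ≤ m := by simpa using hx
    have hx' : ‖x‖ ≤ r := hxm.trans hm
    refine ContinuousLinearMap.opNorm_le_bound _ (by positivity) fun v => ?_
    have h1 := h.ds hx'
    have h2 := h.dc hx'
    have v1 : |v.1| ≤ ‖v‖ := norm_fst_le v
    have v2 : |v.2| ≤ ‖v‖ := norm_snd_le v
    simp only [ContinuousLinearMap.add_apply, ContinuousLinearMap.smul_apply, ContinuousLinearMap.coe_fst',
      ContinuousLinearMap.coe_snd', smul_eq_mul, Real.norm_eq_abs]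
    calc _ ≤ |(Ds x - 2 * x.1) * v.1| + |(Dc x - 2 * σ * x.2) * v.2| := abs_add_le _ _
      _ = |(Ds x - 2 * x.1)| * |v.1| + |(Dc x - 2 * σ * x.2)| * |v.2| := by rw [abs_mul, abs_mul]
      _ ≤ (m / 100) * ‖v‖ + (m / 100) * ‖v‖ := by
        gcongr
        · exact h1.trans (by gcongr)
        · exact h2.trans (by gcongr)
      _ = _ := by ring

theorem NF.E0 (h : NF σ r D Ds Dc B) {p : 𝕍} (hp : ‖p‖ ≤ r) :
    |(D p - p.1 ^ 2 - σ * p.2 ^ 2)| ≤ ‖p‖ ^ 2 / 50 := by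
  have := h.E (p := p) (p' := 0) hp (by simpa using h.r0.le)
  simp [h.D0] at this
  calc _ ≤ _ := this
    _ = _ := by ring

theorem contOn_of_lip {f : 𝕍 → ℝ} {C r : ℝ} (h : ∀ p p', ‖p‖ ≤ r → ‖p'‖ ≤ r → |f p - f p'| ≤ C * ‖p - p'‖) :
    ContinuousOn f {p | ‖p‖ ≤ r} := by
  have : LipschitzOnWith (Real.toNNReal C) f {p | ‖p‖ ≤ r} := by
    refine LipschitzOnWith.of_dist_le_mul fun p hp q hq => ?_
    rw [Real.dist_eq, dist_eq_norm]
    refine (h p q hp hq).trans ?_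
    gcongr
    exact Real.le_coe_toNNReal C
  exact this.continuousOn

theorem NF.cB (h : NF σ r D Ds Dc B) : ContinuousOn B {p | ‖p‖ ≤ r} :=
  contOn_of_lip (C := 1 / 100) fun p p' hp hp' => (h.lb p p' hp hp').trans (le_of_eq (by ring))
theorem NF.cD (h : NF σ r D Ds Dc B) : ContinuousOn D {p | ‖p‖ ≤ r} :=
  fun p hp => (h.hD p hp).continuousAt.continuousWithinAt
theorem NF.cDs (h : NF σ r D Ds Dc B) : ContinuousOn Ds {p | ‖p‖ ≤ r} := by
  have := contOn_of_lip (f := fun p => Ds p - 2 * p.1) (C := 1 / 100) (r := r)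
    fun p p' hp hp' => (h.ls p p' hp hp').trans (le_of_eq (by ring))
  have h2 := this.add (by fun_prop : ContinuousOn (fun p : 𝕍 => 2 * p.1) {p | ‖p‖ ≤ r})
  refine h2.congr fun p _ => ?_
  simp
theorem NF.cDc (h : NF σ r D Ds Dc B) : ContinuousOn Dc {p | ‖p‖ ≤ r} := by
  have := contOn_of_lip (f := fun p => Dc p - 2 * σ * p.2) (C := 1 / 100) (r := r)
    fun p p' hp hp' => (h.lc p p' hp hp').trans (le_of_eq (by ring))
  have h2 := this.add (by fun_prop : ContinuousOn (fun p : 𝕍 => 2 * σ * p.2) {p | ‖p‖ ≤ r})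
  refine h2.congr fun p _ => ?_
  simp

end

theorem sgn_lemma {I : Set ℝ} (hI : IsPreconnected I) {w1 w2 β δ : ℝ → ℝ} (c1 : ContinuousOn w1 I)
    (c2 : ContinuousOn w2 I) (cβ : ContinuousOn β I) (cδ : ContinuousOn δ I)
    (h : ∀ t ∈ I, (w2 t + β t * w1 t) ^ 2 = δ t * w1 t ^ 2) (hδ : ∀ t ∈ I, 0 < δ t)
    (h0 : ∀ t ∈ I, w1 t ≠ 0 ∨ w2 t ≠ 0) :
    (∀ t ∈ I, w1 t ≠ 0) ∧ ((∀ t ∈ I, w2 t = (-√(δ t) - β t) * w1 t) ∨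
      (∀ t ∈ I, w2 t = (√(δ t) - β t) * w1 t)) := by
  have hn : ∀ t ∈ I, w1 t ≠ 0 := by
    intro t ht hw
    have := h t ht
    rw [hw] at this
    rcases h0 t ht with k | k
    · exact k hw
    · simp at this; exact k this
  refine ⟨hn, ?_⟩
  have := hI.eq_or_eq_neg_of_sq_eq (f := fun t => w2 t + β t * w1 t) (g := fun t => √(δ t) * w1 t)
    (by fun_prop) (by fun_prop) (fun t ht => by
      simp only [Pi.pow_apply]
      rw [h t ht, mul_pow, Real.sq_sqrt (hδ t ht).le]) (fun {t} ht => mul_ne_zero (Real.sqrt_pos.2 (hδ t ht)).ne' (hn t ht))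
  rcases this with k | k
  · right; intro t ht; have := k ht; simp only at this; linarith
  · left; intro t ht; have := k ht; simp only [Pi.neg_apply] at this; linarith

def Fam (C : Set 𝕍 → Prop) (R L : Set 𝕍) (i : Fin 3) (S : Set 𝕍) : Prop :=
  C S ∧ (match i with
    | 0 => (0 : 𝕍) ∉ S
    | 1 => S ⊆ R
    | 2 => S ⊆ L)

section
variable {r : ℝ} {D Ds Dc B : 𝕍 → ℝ}

theorem NF.D_lower (h : NF 1 r D Ds Dc B) {p : 𝕍} (hp : ‖p‖ ≤ r) : (9 / 10 * ‖p‖) ^ 2 ≤ D p := by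
  have h1 := (abs_le.1 (h.E0 hp)).1
  have h2 : ‖p‖ ^ 2 ≤ p.1 ^ 2 + p.2 ^ 2 := by
    rw [Prod.norm_def]
    rcases max_cases ‖p.1‖ ‖p.2‖ with ⟨e, _⟩ | ⟨e, _⟩ <;> rw [e, Real.norm_eq_abs, sq_abs] <;> nlinarith [sq_nonneg p.1, sq_nonneg p.2]
  nlinarith [sq_nonneg ‖p‖]

theorem NF.sqrtD (h : NF 1 r D Ds Dc B) {p p' : 𝕍} (hp : ‖p‖ ≤ r) (hp' : ‖p'‖ ≤ r) :
    |√(D p) - √(D p')| ≤ 3 * ‖p - p'‖ := by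
  have l1 := Real.le_sqrt_of_sq_le (h.D_lower hp)
  have l2 := Real.le_sqrt_of_sq_le (h.D_lower hp')
  have q1 := Real.sq_sqrt ((sq_nonneg _).trans (h.D_lower hp))
  have q2 := Real.sq_sqrt ((sq_nonneg _).trans (h.D_lower hp'))
  have n1 := norm_nonneg p
  have n2 := norm_nonneg p'
  have n3 := norm_nonneg (p - p')
  rcases (add_nonneg n1 n2).eq_or_lt with e | e
  · have z1 : p = 0 := norm_eq_zero.1 (by linarith)
    have z2 : p' = 0 := norm_eq_zero.1 (by linarith)
    subst z1; subst z2; simp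
  have hE := h.E hp hp'
  have hm : max ‖p‖ ‖p'‖ ≤ ‖p‖ + ‖p'‖ := max_le (by linarith) (by linarith)
  have a1 : |p.1 ^ 2 - p'.1 ^ 2| ≤ (‖p‖ + ‖p'‖) * ‖p - p'‖ := by
    rw [sq_sub_sq, abs_mul]
    gcongr
    · exact (abs_add_le _ _).trans (add_le_add (norm_fst_le p) (norm_fst_le p'))
    · exact norm_fst_le (p - p')
  have a2 : |p.2 ^ 2 - p'.2 ^ 2| ≤ (‖p‖ + ‖p'‖) * ‖p - p'‖ := by
    rw [sq_sub_sq, abs_mul]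
    gcongr
    · exact (abs_add_le _ _).trans (add_le_add (norm_snd_le p) (norm_snd_le p'))
    · exact norm_snd_le (p - p')
  have a3 : |D p - D p'| ≤ (2 + 1 / 50) * ((‖p‖ + ‖p'‖) * ‖p - p'‖) := by
    have : max ‖p‖ ‖p'‖ * ‖p - p'‖ ≤ (‖p‖ + ‖p'‖) * ‖p - p'‖ := by gcongr
    rw [abs_le] at *
    constructor <;> linarith [a1.1, a1.2, a2.1, a2.2, hE.1, hE.2]
  have a4 : |√(D p) - √(D p')| * (√(D p) + √(D p')) = |D p - D p'| := by
    rw [← abs_of_nonneg (by positivity : 0 ≤ √(D p) + √(D p')), ← abs_mul]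
    congr 1
    linarith [q1, q2, sq_sub_sq (√(D p)) (√(D p'))]
  have a5 : |√(D p) - √(D p')| * (9 / 10 * (‖p‖ + ‖p'‖)) ≤ 3 * ‖p - p'‖ * (9 / 10 * (‖p‖ + ‖p'‖)) := by
    have h1 : |√(D p) - √(D p')| * (9 / 10 * (‖p‖ + ‖p'‖)) ≤ |√(D p) - √(D p')| * (√(D p) + √(D p')) := by
      gcongr; linarith
    have h2 : 0 ≤ (‖p‖ + ‖p'‖) * ‖p - p'‖ := by positivity
    linarith
  exact le_of_mul_le_mul_right a5 (by positivity)

theorem caseN (h : NF 1 r D Ds Dc B) :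
    TEF (Fam (Curve (QH D B)) {p | 0 < p.1} {p | p.1 < 0}) (Fam Seg {p | p.1 < p.2} {p | p.2 < p.1}) := by
  have r0 := h.r0
  have hbox : ∀ t ∈ Icc (-r) r, ∀ y ∈ Icc (-r) r, ‖((t, y) : 𝕍)‖ ≤ r := by
    intro t ht y hy
    rw [Prod.norm_def]
    exact max_le (abs_le.2 ht) (abs_le.2 hy)
  have csq : ContinuousOn (fun p => √(D p)) {p | ‖p‖ ≤ r} := h.cD.sqrt
  have hsub : Icc (-r) r ×ˢ Icc (-r) r ⊆ {p : 𝕍 | ‖p‖ ≤ r} := fun p hp => hbox _ hp.1 _ hp.2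
  have nb : ∀ y y' t : ℝ, ‖((t, y) : 𝕍) - (t, y')‖ = |y - y'| := by
    intro y y' t; simp [Prod.norm_def]
  have bsq : ∀ p : 𝕍, ‖p‖ ≤ r → |√(D p)| ≤ 3 * r := by
    intro p hp
    have := h.sqrtD (p' := 0) hp (by simpa using r0.le)
    simp [h.D0] at this
    linarith
  have bB : ∀ p : 𝕍, ‖p‖ ≤ r → |B p| ≤ r := fun p hp => (h.db hp).trans (by linarith [norm_nonneg p])
  obtain ⟨GA, GB, M, net, hA, hB⟩ := Net.exists_cutoff (gA := fun t y => -√(D (t, y)) - B (t, y))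
    (gB := fun t y => √(D (t, y)) - B (t, y)) (t1 := -r) (t2 := r) (M := 4 * r) (K := 4)
    (Y := Icc (-r) r) (π := clp (-r) r) (by linarith) (clp_mem (by linarith)) (clp_lip _ _)
    (fun y hy => clp_of_mem hy)
    (((csq.neg).sub h.cB).mono hsub) ((csq.sub h.cB).mono hsub)
    (fun t ht y hy => by
      have h1 := bsq _ (hbox t ht y hy)
      have h2 := bB _ (hbox t ht y hy)
      rw [abs_le] at *; constructor <;> linarith [h1.1, h1.2, h2.1, h2.2])
    (fun t ht y hy => by
      have h1 := bsq _ (hbox t ht y hy)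
      have h2 := bB _ (hbox t ht y hy)
      rw [abs_le] at *; constructor <;> linarith [h1.1, h1.2, h2.1, h2.2])
    (fun t ht y hy y' hy' => by
      have h1 := h.sqrtD (hbox t ht y hy) (hbox t ht y' hy')
      have h2 := h.lb _ _ (hbox t ht y hy) (hbox t ht y' hy')
      rw [nb] at h1 h2
      have := abs_nonneg (y - y')
      rw [abs_le] at h1 h2 ⊢; constructor <;> linarith [h1.1, h1.2, h2.1, h2.2])
    (fun t ht y hy y' hy' => by
      have h1 := h.sqrtD (hbox t ht y hy) (hbox t ht y' hy')
      have h2 := h.lb _ _ (hbox t ht y hy) (hbox t ht y' hy')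
      rw [nb] at h1 h2
      have := abs_nonneg (y - y')
      rw [abs_le] at h1 h2 ⊢; constructor <;> linarith [h1.1, h1.2, h2.1, h2.2])
    (fun t ht y hy => by linarith [Real.sqrt_nonneg (D (t, y))])
    (fun t ht ht0 y hy => by
      have h1 := h.D_lower (hbox t (Ioo_subset_Icc_self ht) y hy)
      have h2 : 0 < ‖((t, y) : 𝕍)‖ := norm_pos_iff.2 (by simp [ht0])
      have := Real.sqrt_pos.2 (lt_of_lt_of_le (by positivity) h1)
      linarith) (by norm_num)
  set R : Set 𝕍 := {p | ‖p‖ < r ∧ p ≠ 0} with hR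
  have hRI : ∀ p ∈ R, p.1 ∈ Icc (-r) r ∧ p.2 ∈ Icc (-r) r := fun p hp =>
    ⟨abs_le.1 ((norm_fst_le p).trans hp.1.le), abs_le.1 ((norm_snd_le p).trans hp.1.le)⟩
  have hRD : ∀ p ∈ R, 0 < D p := fun p hp =>
    lt_of_lt_of_le (by have := norm_pos_iff.2 hp.2; positivity) (h.D_lower hp.1.le)
  have hRs : R ⊆ {p | ‖p‖ ≤ r} := fun p hp => hp.1.le
  have hleaf : ∀ S, S ⊆ R → (Curve (QH D B) S ↔ Seg (net.Phi '' S)) := by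
    intro S hS
    refine leaf net (κ := fun p => p) (R := R) (fun p _ q _ h => h) ⟨r, fun p hp => abs_le.2 (hRI p hp).1⟩ ?_ ?_ hS
    · intro γ dγ a b ⟨hc, hγ⟩ hm
      have cγ : ContinuousOn γ (Ioo a b) := fun t ht => (hγ t ht).1.continuousAt.continuousWithinAt
      have d1 : ∀ t ∈ Ioo a b, HasDerivAt (fun t => (γ t).1) (dγ t).1 t := fun t ht =>
        (ContinuousLinearMap.fst ℝ ℝ ℝ).hasFDerivAt.comp_hasDerivAt t (hγ t ht).1
      have d2 : ∀ t ∈ Ioo a b, HasDerivAt (fun t => (γ t).2) (dγ t).2 t := fun t ht =>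
        (ContinuousLinearMap.snd ℝ ℝ ℝ).hasFDerivAt.comp_hasDerivAt t (hγ t ht).1
      obtain ⟨s1, s2⟩ := sgn_lemma isPreconnected_Ioo (w1 := fun t => (dγ t).1) (w2 := fun t => (dγ t).2)
        (β := fun t => B (γ t)) (δ := fun t => D (γ t)) (by fun_prop) (by fun_prop)
        (h.cB.comp cγ fun t ht => hRs (hm t ht)) (h.cD.comp cγ fun t ht => hRs (hm t ht))
        (fun t ht => (hγ t ht).2.2) (fun t ht => hRD _ (hm t ht)) (fun t ht => by
          have := (hγ t ht).2.1
          by_contra hcon; push Not at hcon; exact this (Prod.ext hcon.1 hcon.2))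
      refine ⟨fun t => (dγ t).1, fun t ht => ⟨d1 t ht, s1 t ht⟩, ?_⟩
      refine s2.imp (fun k t ht => ?_) (fun k t ht => ?_)
      · rw [hA _ (hRI _ (hm t ht)).1 _ (hRI _ (hm t ht)).2]
        have := d2 t ht
        rw [k t ht] at this; exact this
      · rw [hB _ (hRI _ (hm t ht)).1 _ (hRI _ (hm t ht)).2]
        have := d2 t ht
        rw [k t ht] at this; exact this
    · intro Y a b hY hm
      have hm' : ∀ t ∈ Ioo a b, (t, Y t) ∈ R := fun t ht => by simpa using hm t ht
      have cY : ContinuousOn Y (Ioo a b) := by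
        rcases hY with k | k <;> exact fun t ht => (k t ht).continuousAt.continuousWithinAt
      have cp : ContinuousOn (fun t => (t, Y t)) (Ioo a b) := continuousOn_id.prodMk cY
      have cB := h.cB.comp cp fun t ht => hRs (hm' t ht)
      have cD := csq.comp cp fun t ht => hRs (hm' t ht)
      rcases hY with k | k
      · refine ⟨fun t => (t, Y t), fun t => (1, -√(D (t, Y t)) - B (t, Y t)),
          ⟨continuousOn_const.prodMk (cD.neg.sub cB), fun t ht => ⟨?_, by simp, ?_⟩⟩, fun t ht => ⟨hm' t ht, rfl⟩⟩
        · have := k t ht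
          rw [hA _ (hRI _ (hm' t ht)).1 _ (hRI _ (hm' t ht)).2] at this
          exact (hasDerivAt_id t).prodMk this
        · have := Real.sq_sqrt (hRD _ (hm' t ht)).le
          simp only [QH]; linarith
      · refine ⟨fun t => (t, Y t), fun t => (1, √(D (t, Y t)) - B (t, Y t)),
          ⟨continuousOn_const.prodMk (cD.sub cB), fun t ht => ⟨?_, by simp, ?_⟩⟩, fun t ht => ⟨hm' t ht, rfl⟩⟩
        · have := k t ht
          rw [hB _ (hRI _ (hm' t ht)).1 _ (hRI _ (hm' t ht)).2] at this
          exact (hasDerivAt_id t).prodMk this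
        · have := Real.sq_sqrt (hRD _ (hm' t ht)).le
          simp only [QH]; linarith
  have hΦ0 : net.Phi 0 = 0 := by
    rw [net.Phi_apply]; simp [Fld.lab_zero]
  have hlt : ∀ p, 0 < p.1 ↔ (net.Phi p).1 < (net.Phi p).2 := fun p => by
    have := net.lt_time (net.Phi p) 0
    rw [← net.Phi_symm_fst] at this
    simpa [Fld.phi_zero] using this
  have hgt : ∀ p, p.1 < 0 ↔ (net.Phi p).2 < (net.Phi p).1 := fun p => by
    have := net.time_lt (net.Phi p) 0
    rw [← net.Phi_symm_fst] at this
    simpa [Fld.phi_zero] using this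
  refine ⟨net.Phi.toOpenPartialHomeomorph.restrOpen (Metric.ball 0 r) Metric.isOpen_ball, by simp [r0], by simpa using hΦ0, ?_⟩
  intro i S hS
  have hS' : S ⊆ Metric.ball 0 r := by simpa using hS
  show _ ↔ Fam _ _ _ i (net.Phi '' S)
  have e0 : (0 : 𝕍) ∉ S ↔ (0 : 𝕍) ∉ net.Phi '' S := by
    rw [not_iff_not]
    constructor
    · intro k; exact ⟨0, k, hΦ0⟩
    · rintro ⟨x, hx, he⟩
      have : x = 0 := net.Phi.injective (he.trans hΦ0.symm)
      rwa [← this]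
  have e1 : S ⊆ {p | 0 < p.1} ↔ net.Phi '' S ⊆ {p | p.1 < p.2} := by
    rw [image_subset_iff]
    exact forall₂_congr fun p _ => hlt p
  have e2 : S ⊆ {p | p.1 < 0} ↔ net.Phi '' S ⊆ {p | p.2 < p.1} := by
    rw [image_subset_iff]
    exact forall₂_congr fun p _ => hgt p
  have main : (0 : 𝕍) ∉ S → (Curve (QH D B) S ↔ Seg (net.Phi '' S)) := fun h0 =>
    hleaf S fun p hp => ⟨by simpa using hS' hp, fun e => h0 (e ▸ hp)⟩
  fin_cases i
  · simp only [Fam]; rw [← e0]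
    exact and_congr_left fun k => main k
  · simp only [Fam]; rw [← e1]
    exact and_congr_left fun k => main fun z => by have := k z; simp at this
  · simp only [Fam]; rw [← e2]
    exact and_congr_left fun k => main fun z => by have := k z; simp at this
end

theorem inv_lemma {f f' : ℝ → ℝ} {a b : ℝ} (hf : ∀ t ∈ Ioo a b, HasDerivAt f (f' t) t)
    (h0 : ∀ t ∈ Ioo a b, f' t ≠ 0) :
    ∃ g : ℝ → ℝ, (∀ t ∈ Ioo a b, g (f t) = t) ∧
      ∀ t ∈ Ioo a b, HasDerivAt g (f' t)⁻¹ (f t) := by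
  have inj : InjOn f (Ioo a b) := by
    have key : ∀ s ∈ Ioo a b, ∀ t ∈ Ioo a b, s < t → f s ≠ f t := by
      intro s hs t ht hst he
      have hsub : Icc s t ⊆ Ioo a b := fun x hx => ⟨hs.1.trans_le hx.1, hx.2.trans_lt ht.2⟩
      obtain ⟨c, hc, hc0⟩ := exists_hasDerivAt_eq_zero (f := f) (f' := f') hst
        (fun x hx => (hf x (hsub hx)).continuousAt.continuousWithinAt) he
        (fun x hx => hf x (hsub (Ioo_subset_Icc_self hx)))
      exact h0 c (hsub (Ioo_subset_Icc_self hc)) hc0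
    intro s hs t ht he
    rcases lt_trichotomy s t with h | h | h
    · exact (key s hs t ht h he).elim
    · exact h
    · exact (key t ht s hs h he.symm).elim
  set g := Function.invFunOn f (Ioo a b) with hg
  have gl : ∀ t ∈ Ioo a b, g (f t) = t := fun t ht => inj.leftInvOn_invFunOn ht
  refine ⟨g, gl, fun t ht => ?_⟩
  have op : ∀ c d, a ≤ c → d ≤ b → IsOpen (f '' Ioo c d) := fun c d hc hd =>
    isOpen_image_of_deriv isOpen_Ioo isPreconnected_Ioo (fun s hs => hf s ⟨hc.trans_lt hs.1, hs.2.trans_le hd⟩)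
      (fun s hs => h0 s ⟨hc.trans_lt hs.1, hs.2.trans_le hd⟩)
  have hfg : ∀ᶠ y in nhds (f t), f (g y) = y := by
    filter_upwards [(op a b le_rfl le_rfl).mem_nhds (mem_image_of_mem f ht)]
    rintro _ ⟨s, hs, rfl⟩
    rw [gl s hs]
  have hc : ContinuousAt g (f t) := by
    rw [ContinuousAt, gl t ht]
    intro U hU
    obtain ⟨l, u, hlu, hsub⟩ := mem_nhds_iff_exists_Ioo_subset.1 (inter_mem hU (Ioo_mem_nhds ht.1 ht.2))
    have := (op (max l a) (min u b) (le_max_right _ _) (min_le_right _ _)).mem_nhds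
      (mem_image_of_mem f (⟨max_lt hlu.1 ht.1, lt_min hlu.2 ht.2⟩ : t ∈ Ioo (max l a) (min u b)))
    rw [mem_map]
    refine mem_of_superset this ?_
    rintro _ ⟨s, hs, rfl⟩
    have hs' : s ∈ Ioo l u := ⟨(le_max_left _ _).trans_lt hs.1, hs.2.trans_le (min_le_left _ _)⟩
    have := hsub hs'
    show g (f s) ∈ U
    rw [gl s this.2]
    exact this.1
  refine HasDerivAt.of_local_left_inverse hc ?_ (h0 t ht) hfg
  rw [gl t ht]; exact hf t ht

section
variable {σ r : ℝ} {D Ds Dc B : 𝕍 → ℝ}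

def rfl1 : 𝕍 ≃L[ℝ] 𝕍 :=
  (ContinuousLinearEquiv.neg ℝ).prodCongr (ContinuousLinearEquiv.refl ℝ ℝ)

theorem rfl1_apply (p : 𝕍) : rfl1 p = (-p.1, p.2) := rfl
theorem rfl1_norm (p : 𝕍) : ‖rfl1 p‖ = ‖p‖ := by simp [rfl1_apply, Prod.norm_def]
theorem rfl1_invol (p : 𝕍) : rfl1 (rfl1 p) = p := by simp [rfl1_apply]

theorem NF.reflect (h : NF σ r D Ds Dc B) : NF σ r (fun p => D (rfl1 p)) (fun p => - Ds (rfl1 p))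
    (fun p => Dc (rfl1 p)) (fun p => - B (rfl1 p)) := by
  have hn : ∀ p, ‖p‖ ≤ r → ‖rfl1 p‖ ≤ r := fun p hp => by rwa [rfl1_norm]
  refine ⟨h.r0, h.r1, fun p hp => ?_, ?_, ?_, ?_, ?_, fun p p' hp hp' => ?_, fun p p' hp hp' => ?_, fun p p' hp hp' => ?_⟩
  · have := (h.hD _ (hn p hp)).comp p rfl1.hasFDerivAt
    refine this.congr_fderiv ?_
    ext <;> simp [rfl1_apply]
  · simp [h.D0]
  · simp [h.Ds0]
  · simp [h.Dc0]
  · simp [h.B0]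
  · have := h.ls _ _ (hn p hp) (hn p' hp')
    rw [← map_sub, rfl1_norm] at this
    rw [← abs_neg]
    refine (le_of_eq ?_).trans this
    congr 1; simp [rfl1_apply]; ring
  · have := h.lc _ _ (hn p hp) (hn p' hp')
    rw [← map_sub, rfl1_norm] at this
    exact this
  · have := h.lb _ _ (hn p hp) (hn p' hp')
    rw [← map_sub, rfl1_norm] at this
    rw [← abs_neg]
    refine (le_of_eq ?_).trans this
    congr 1; ring

theorem QH_refl {p v : 𝕍} : QH (fun p => D (rfl1 p)) (fun p => - B (rfl1 p)) p v ↔ QH D B (rfl1 p) (rfl1 v) := by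
  simp [QH, rfl1_apply]

theorem QV_refl {p v : 𝕍} : QV (fun p => D (rfl1 p)) (fun p => - B (rfl1 p)) p v ↔ QV D B (rfl1 p) (rfl1 v) := by
  simp only [QV, rfl1_apply]
  rw [← neg_sq]; ring_nf

theorem rfl1_invol_image (S : Set 𝕍) : rfl1 '' (rfl1 '' S) = S := by
  rw [image_image]; simp [rfl1_invol]

theorem curve_refl_H {S : Set 𝕍} : Curve (QH D B) S ↔
    Curve (QH (fun p => D (rfl1 p)) (fun p => - B (rfl1 p))) (rfl1 '' S) := by
  have h1 := Curve.linear (Q := QH D B) rfl1 (S := rfl1 '' S)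
  rw [rfl1_invol_image] at h1
  rw [← h1]
  exact Curve.congr (W := univ) (fun p _ v => QH_refl.symm) (subset_univ _)

theorem curve_refl_V {S : Set 𝕍} : Curve (QV D B) S ↔
    Curve (QV (fun p => D (rfl1 p)) (fun p => - B (rfl1 p))) (rfl1 '' S) := by
  have h1 := Curve.linear (Q := QV D B) rfl1 (S := rfl1 '' S)
  rw [rfl1_invol_image] at h1
  rw [← h1]
  exact Curve.congr (W := univ) (fun p _ v => QV_refl.symm) (subset_univ _)

theorem QH_ne {p v : 𝕍} (hv : v ≠ 0) (h : QH D B p v) : v.1 ≠ 0 := by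
  intro h1
  simp only [QH, h1] at h
  simp at h
  exact hv (Prod.ext h1 h)

theorem NF.D_upper (h : NF σ r D Ds Dc B) (hσ : |σ| ≤ 1) {p : 𝕍} (hp : ‖p‖ ≤ r) : D p ≤ 3 * ‖p‖ ^ 2 := by
  have h1 := (abs_le.1 (h.E0 hp)).2
  have h2 := abs_le.1 hσ
  have h3 : p.1 ^ 2 ≤ ‖p‖ ^ 2 := by rw [← sq_abs]; gcongr; exact norm_fst_le p
  have h4 : p.2 ^ 2 ≤ ‖p‖ ^ 2 := by rw [← sq_abs]; gcongr; exact norm_snd_le p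
  nlinarith [sq_nonneg p.2]

theorem NF.slope (h : NF σ r D Ds Dc B) (hσ : |σ| ≤ 1) {p v : 𝕍} (hp : ‖p‖ ≤ r) (hQ : QH D B p v) :
    |v.2| ≤ 3 * ‖p‖ * |v.1| := by
  have h1 := h.D_upper hσ hp
  have h2 := h.db hp
  have n := norm_nonneg p
  have h3 : |v.2 + B p * v.1| ≤ 2 * ‖p‖ * |v.1| := by
    apply abs_le_of_sq_le_sq' _ (by positivity) |> abs_le.2
    rw [hQ, mul_pow, sq_abs]
    nlinarith [sq_nonneg v.1, sq_nonneg ‖p‖]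
  have h4 : |B p * v.1| ≤ ‖p‖ / 100 * |v.1| := by rw [abs_mul]; gcongr
  have h5 : |v.2| ≤ |v.2 + B p * v.1| + |B p * v.1| := by
    have := abs_sub (v.2 + B p * v.1) (B p * v.1)
    simpa using this
  have : 0 ≤ ‖p‖ * |v.1| := by positivity
  linarith

theorem NF.graph (h : NF σ r D Ds Dc B) (hσ : |σ| ≤ 1) {S : Set 𝕍} (hS : Curve (QH D B) S)
    (hb : ∀ p ∈ S, ‖p‖ ≤ r ∧ 0 < p.1) (h0 : (0 : 𝕍) ∈ closure S) :
    ∃ β φ φ', 0 < β ∧ S = (fun x : ℝ => ((x, φ x) : 𝕍)) '' Ioo 0 β ∧ ContinuousOn φ' (Ioo 0 β) ∧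
      ∀ x ∈ Ioo 0 β, HasDerivAt φ (φ' x) x ∧ QH D B (x, φ x) (1, φ' x) ∧ |φ x| ≤ x ∧ |φ' x| ≤ 3 * x ∧ |φ x| ≤ 3 * x ^ 2 := by
  obtain ⟨γ, dγ, a, b, ⟨hc, hγ⟩, rfl⟩ := hS
  have d1 : ∀ t ∈ Ioo a b, HasDerivAt (fun t => (γ t).1) (dγ t).1 t := fun t ht =>
    (ContinuousLinearMap.fst ℝ ℝ ℝ).hasFDerivAt.comp_hasDerivAt t (hγ t ht).1
  have d2 : ∀ t ∈ Ioo a b, HasDerivAt (fun t => (γ t).2) (dγ t).2 t := fun t ht =>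
    (ContinuousLinearMap.snd ℝ ℝ ℝ).hasFDerivAt.comp_hasDerivAt t (hγ t ht).1
  have n1 : ∀ t ∈ Ioo a b, (dγ t).1 ≠ 0 := fun t ht => QH_ne (hγ t ht).2.1 (hγ t ht).2.2
  obtain ⟨g, g1, g2⟩ := inv_lemma d1 n1
  obtain ⟨α, β, hT⟩ := exists_Ioo (isOpen_image_of_deriv isOpen_Ioo isPreconnected_Ioo d1 n1)
    (isPreconnected_Ioo.image _ fun t ht => (d1 t ht).continuousAt.continuousWithinAt)
    ⟨r, by rintro _ ⟨t, ht, rfl⟩; exact (norm_fst_le _).trans (hb _ (mem_image_of_mem _ ht)).1⟩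
  have cl : ∀ ε > 0, ∃ t ∈ Ioo a b, ‖γ t‖ < ε := by
    intro ε hε
    obtain ⟨_, ⟨t, ht, rfl⟩, hd⟩ := Metric.mem_closure_iff.1 h0 ε hε
    exact ⟨t, ht, by simpa using hd⟩
  have hβα : α < β := by
    obtain ⟨t, ht, -⟩ := cl 1 one_pos
    have : (γ t).1 ∈ Ioo α β := hT ▸ mem_image_of_mem (fun t => (γ t).1) ht
    exact this.1.trans this.2
  have hα : α = 0 := by
    apply le_antisymm
    · by_contra hcon
      push Not at hcon
      obtain ⟨t, ht, hlt⟩ := cl α hcon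
      have : (γ t).1 ∈ Ioo α β := hT ▸ mem_image_of_mem (fun t => (γ t).1) ht
      have := this.1
      have := (le_abs_self _).trans (norm_fst_le (γ t))
      linarith
    · by_contra hcon
      push Not at hcon
      have hm : min ((α + β) / 2) (α / 2) ∈ Ioo α β :=
        ⟨lt_min (by linarith) (by linarith), (min_le_left _ _).trans_lt (by linarith)⟩
      rw [← hT] at hm
      obtain ⟨t, ht, he⟩ := hm
      have h1 := (hb _ (mem_image_of_mem _ ht)).2
      have h2 := min_le_right ((α + β) / 2) (α / 2)
      simp only at he
      linarith
  subst hα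
  have gx : ∀ x ∈ Ioo 0 β, g x ∈ Ioo a b ∧ (γ (g x)).1 = x := by
    intro x hx
    rw [← hT] at hx
    obtain ⟨t, ht, rfl⟩ := hx
    simp only
    rw [g1 t ht]; exact ⟨ht, rfl⟩
  have gd : ∀ x ∈ Ioo 0 β, HasDerivAt g ((dγ (g x)).1)⁻¹ x := by
    intro x hx
    have := g2 _ (gx x hx).1
    rwa [(gx x hx).2] at this
  have gc : ContinuousOn g (Ioo 0 β) := fun x hx => (gd x hx).continuousAt.continuousWithinAt
  have gm : MapsTo g (Ioo 0 β) (Ioo a b) := fun x hx => (gx x hx).1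
  have φd : ∀ x ∈ Ioo 0 β, HasDerivAt (fun x => (γ (g x)).2) ((dγ (g x)).2 * ((dγ (g x)).1)⁻¹) x :=
    fun x hx => (d2 _ (gx x hx).1).comp x (gd x hx)
  have pe : ∀ x ∈ Ioo 0 β, γ (g x) = (x, (γ (g x)).2) := fun x hx => Prod.ext (gx x hx).2 rfl
  have φQ : ∀ x ∈ Ioo 0 β, QH D B (x, (γ (g x)).2) (1, (dγ (g x)).2 * ((dγ (g x)).1)⁻¹) := by
    intro x hx
    have h1 := (hγ _ (gx x hx).1).2.2
    have h2 := n1 _ (gx x hx).1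
    rw [← pe x hx]
    simp only [QH] at h1 ⊢
    field_simp
    linarith
  have nb : ∀ x ∈ Ioo 0 β, ‖((x, (γ (g x)).2) : 𝕍)‖ ≤ r := by
    intro x hx; rw [← pe x hx]; exact (hb _ (mem_image_of_mem _ (gx x hx).1)).1
  have sl : ∀ x ∈ Ioo 0 β, |(dγ (g x)).2 * ((dγ (g x)).1)⁻¹| ≤ 3 * ‖((x, (γ (g x)).2) : 𝕍)‖ := by
    intro x hx
    have := h.slope hσ (nb x hx) (φQ x hx)
    simpa using this
  have bd : ∀ x ∈ Ioo 0 β, |(γ (g x)).2| ≤ x := by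
    intro x hx
    apply le_of_forall_pos_le_add
    intro ε hε
    obtain ⟨t, ht, hlt⟩ := cl (min x ε) (lt_min hx.1 hε)
    have htm : (γ t).1 ∈ Ioo 0 β := hT ▸ mem_image_of_mem (fun t => (γ t).1) ht
    have gt := g1 t ht
    have key := Convex.norm_image_sub_le_of_norm_hasDerivWithin_le (f := fun x => (γ (g x)).2)
      (f' := fun x => (dγ (g x)).2 * ((dγ (g x)).1)⁻¹) (C := 1) (s := Ioo 0 β) (x := (γ t).1) (y := x)
      (fun z hz => (φd z hz).hasDerivWithinAt) (fun z hz => by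
        have h1 := sl z hz
        have h2 := nb z hz
        have h3 := h.r1
        rw [Real.norm_eq_abs]; linarith) (convex_Ioo _ _) htm hx
    simp only [gt, Real.norm_eq_abs, one_mul] at key
    have k1 := (norm_snd_le (γ t)).trans hlt.le
    have k2 := (norm_fst_le (γ t)).trans hlt.le
    rw [Real.norm_eq_abs] at k1 k2
    have k3 := min_le_left x ε
    have k4 := min_le_right x ε
    have k5 : |x - (γ t).1| ≤ x := abs_le.2 ⟨by linarith [le_abs_self (γ t).1, hx.1], by linarith [htm.1]⟩
    have := abs_sub_abs_le_abs_sub (γ (g x)).2 (γ t).2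
    linarith
  have sl2 : ∀ x ∈ Ioo 0 β, |(dγ (g x)).2 * ((dγ (g x)).1)⁻¹| ≤ 3 * x := by
    intro x hx
    refine (sl x hx).trans ?_
    have : ‖((x, (γ (g x)).2) : 𝕍)‖ ≤ x := by
      rw [Prod.norm_def]
      exact max_le (by rw [Real.norm_eq_abs, abs_of_pos hx.1]) (bd x hx)
    linarith
  have bd2 : ∀ x ∈ Ioo 0 β, |(γ (g x)).2| ≤ 3 * x ^ 2 := by
    intro x hx
    apply le_of_forall_pos_le_add
    intro ε hε
    have s0 : 0 < min x ε := lt_min hx.1 hε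
    have k3 := min_le_left x ε
    have k4 := min_le_right x ε
    set s := min x ε
    have hs : s ∈ Ioo 0 β := ⟨s0, k3.trans_lt hx.2⟩
    have key := Convex.norm_image_sub_le_of_norm_hasDerivWithin_le (f := fun x => (γ (g x)).2)
      (f' := fun x => (dγ (g x)).2 * ((dγ (g x)).1)⁻¹) (C := 3 * x) (s := Ioc 0 x) (x := s) (y := x)
      (fun z hz => (φd z ⟨hz.1, hz.2.trans_lt hx.2⟩).hasDerivWithinAt) (fun z hz => by
        have h1 := sl2 z ⟨hz.1, hz.2.trans_lt hx.2⟩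
        rw [Real.norm_eq_abs]; linarith [hz.2]) (convex_Ioc _ _) ⟨s0, k3⟩ ⟨hx.1, le_rfl⟩
    simp only [Real.norm_eq_abs] at key
    have k1 := bd s hs
    have k5 : |x - s| ≤ x := abs_le.2 ⟨by linarith [hx.1], by linarith⟩
    have k6 : 3 * x * |x - s| ≤ 3 * x * x := by have := hx.1; gcongr
    have := abs_sub_abs_le_abs_sub (γ (g x)).2 (γ (g s)).2
    nlinarith
  refine ⟨β, fun x => (γ (g x)).2, fun x => (dγ (g x)).2 * ((dγ (g x)).1)⁻¹, hβα, ?_, ?_, ?_⟩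
  · ext p; constructor
    · rintro ⟨t, ht, rfl⟩
      refine ⟨(γ t).1, hT ▸ mem_image_of_mem (fun t => (γ t).1) ht, ?_⟩
      have gt := g1 t ht
      simp only [gt]
    · rintro ⟨x, hx, rfl⟩
      refine ⟨g x, (gx x hx).1, pe x hx⟩
  · have c2 : ContinuousOn (fun x => dγ (g x)) (Ioo 0 β) := hc.comp gc gm
    exact (continuous_snd.comp_continuousOn c2).mul ((continuous_fst.comp_continuousOn c2).inv₀
      fun x hx => n1 _ (gx x hx).1)
  · intro x hx
    exact ⟨φd x hx, φQ x hx, bd x hx, sl2 x hx, bd2 x hx⟩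

def Dec (Q : 𝕍 → 𝕍 → Prop) (S : Set 𝕍) : Prop :=
  ∃ S1 S2, Curve Q S1 ∧ Curve Q S2 ∧ S1 ⊆ {p | 0 < p.1} ∧ S2 ⊆ {p | p.1 < 0} ∧
    (0 : 𝕍) ∈ closure S1 ∧ (0 : 𝕍) ∈ closure S2 ∧ S = S1 ∪ {0} ∪ S2

theorem dec_of_curve {S : Set 𝕍} (h0 : (0 : 𝕍) ∈ S) (hS : Curve (QH D B) S) : Dec (QH D B) S := by
  obtain ⟨γ, dγ, a, b, ⟨hc, hγ⟩, rfl⟩ := hS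
  obtain ⟨t0, ht0, e0⟩ := h0
  have d1 : ∀ t ∈ Ioo a b, HasDerivAt (fun t => (γ t).1) (dγ t).1 t := fun t ht =>
    (ContinuousLinearMap.fst ℝ ℝ ℝ).hasFDerivAt.comp_hasDerivAt t (hγ t ht).1
  have n1 : ∀ t ∈ Ioo a b, (dγ t).1 ≠ 0 := fun t ht => QH_ne (hγ t ht).2.1 (hγ t ht).2.2
  have cut : ∀ c d, a ≤ c → d ≤ b → Curve (QH D B) (γ '' Ioo c d) := fun c d hc' hd =>
    ⟨γ, dγ, c, d, ⟨hc.mono (Ioo_subset_Ioo hc' hd), fun t ht => hγ t (Ioo_subset_Ioo hc' hd ht)⟩, rfl⟩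
  have cu := cut t0 b ht0.1.le le_rfl
  have cl := cut a t0 le_rfl ht0.2.le
  have ct : ContinuousAt γ t0 := (hγ t0 ht0).1.continuousAt
  have k1 : (0 : 𝕍) ∈ closure (γ '' Ioo t0 b) := by
    rw [← e0]
    exact ct.continuousWithinAt.mem_closure_image (by rw [closure_Ioo ht0.2.ne]; exact ⟨le_rfl, ht0.2.le⟩)
  have k2 : (0 : 𝕍) ∈ closure (γ '' Ioo a t0) := by
    rw [← e0]
    exact ct.continuousWithinAt.mem_closure_image (by rw [closure_Ioo ht0.1.ne]; exact ⟨ht0.1.le, le_rfl⟩)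
  have hu : Ioo a b = Ioo a t0 ∪ {t0} ∪ Ioo t0 b := by
    ext t; simp only [mem_union, mem_Ioo, mem_singleton_iff]
    constructor
    · rintro ⟨h1, h2⟩
      rcases lt_trichotomy t t0 with h | h | h
      · exact Or.inl (Or.inl ⟨h1, h⟩)
      · exact Or.inl (Or.inr h)
      · exact Or.inr ⟨h, h2⟩
    · rintro ((⟨h1, h2⟩ | rfl) | ⟨h1, h2⟩)
      · exact ⟨h1, h2.trans ht0.2⟩
      · exact ht0
      · exact ⟨ht0.1.trans h1, h2⟩
  have hx0 : (γ t0).1 = 0 := by rw [e0]; rfl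
  have cx : ContinuousOn (fun t => (γ t).1) (Ioo a b) := fun t ht => (d1 t ht).continuousAt.continuousWithinAt
  have cdx : ContinuousOn (fun t => (dγ t).1) (Ioo a b) := continuous_fst.comp_continuousOn hc
  have sg : (∀ t ∈ Ioo a b, 0 < (dγ t).1) ∨ (∀ t ∈ Ioo a b, (dγ t).1 < 0) := by
    by_contra hcon
    push Not at hcon
    obtain ⟨⟨s, hs, h1⟩, ⟨t, ht, h2⟩⟩ := hcon
    obtain ⟨z, hz, hz0⟩ := (isPreconnected_Ioo.image _ cdx).ordConnected.out (mem_image_of_mem _ hs) (mem_image_of_mem _ ht) (show (0 : ℝ) ∈ Icc _ _ from ⟨h1, h2⟩)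
    exact n1 z hz hz0
  rcases sg with sg | sg
  · have mono : StrictMonoOn (fun t => (γ t).1) (Ioo a b) := by
      apply strictMonoOn_of_deriv_pos (convex_Ioo _ _) cx
      intro t ht; rw [interior_Ioo] at ht; rw [(d1 t ht).deriv]; exact sg t ht
    refine ⟨_, _, cu, cl, ?_, ?_, k1, k2, ?_⟩
    · rintro _ ⟨t, ht, rfl⟩
      have := mono ht0 ⟨ht0.1.trans ht.1, ht.2⟩ ht.1
      simp only [hx0] at this; exact this
    · rintro _ ⟨t, ht, rfl⟩
      have := mono ⟨ht.1, ht.2.trans ht0.2⟩ ht0 ht.2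
      simp only [hx0] at this; exact this
    · rw [hu, image_union, image_union, image_singleton, e0, union_comm, union_comm (γ '' Ioo a t0), union_assoc]
  · have mono : StrictAntiOn (fun t => (γ t).1) (Ioo a b) := by
      apply strictAntiOn_of_deriv_neg (convex_Ioo _ _) cx
      intro t ht; rw [interior_Ioo] at ht; rw [(d1 t ht).deriv]; exact sg t ht
    refine ⟨_, _, cl, cu, ?_, ?_, k2, k1, ?_⟩
    · rintro _ ⟨t, ht, rfl⟩
      have := mono ⟨ht.1, ht.2.trans ht0.2⟩ ht0 ht.2
      simp only [hx0] at this; exact this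
    · rintro _ ⟨t, ht, rfl⟩
      have := mono ht0 ⟨ht0.1.trans ht.1, ht.2⟩ ht.1
      simp only [hx0] at this; exact this
    · rw [hu, image_union, image_union, image_singleton, e0]

theorem NF.curve_of_dec (h : NF σ r D Ds Dc B) (hσ : |σ| ≤ 1) {S : Set 𝕍} (hb : ∀ p ∈ S, ‖p‖ ≤ r)
    (hS : Dec (QH D B) S) : Curve (QH D B) S := by
  obtain ⟨S1, S2, c1, c2, p1, p2, z1, z2, rfl⟩ := hS
  obtain ⟨β, φ, φ', b0, rfl, cφ, hφ⟩ := h.graph hσ c1 (fun p hp => ⟨hb p (by simp [hp]), p1 hp⟩) z1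
  have z2' : (0 : 𝕍) ∈ closure (rfl1 '' S2) := by
    have := image_closure_subset_closure_image (f := rfl1) (s := S2) rfl1.continuous (mem_image_of_mem _ z2)
    simpa using this
  obtain ⟨β2, ψ, ψ', b20, hS2, cψ, hψ⟩ := h.reflect.graph hσ (curve_refl_H.1 c2) (by
    rintro _ ⟨p, hp, rfl⟩
    rw [rfl1_norm]
    refine ⟨hb p (by simp [hp]), ?_⟩
    have := p2 hp
    simpa [rfl1_apply] using this) z2'
  have hS2' : S2 = (fun x : ℝ => ((-x, ψ x) : 𝕍)) '' Ioo 0 β2 := by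
    rw [← rfl1_invol_image S2, hS2, image_image]; rfl
  subst hS2'
  have hne : ∀ t ∈ Ioo (-β2) β, t ≠ 0 → (t ∈ Ioo 0 β) ∨ (-t ∈ Ioo 0 β2) := by
    intro t ht h0
    rcases lt_or_gt_of_ne h0 with k | k
    · right; exact ⟨by linarith, by linarith [ht.1]⟩
    · left; exact ⟨k, ht.2⟩
  set Y : ℝ → ℝ := fun t => if 0 < t then φ t else if t < 0 then ψ (-t) else 0 with hY
  set dY : ℝ → ℝ := fun t => if 0 < t then φ' t else if t < 0 then -ψ' (-t) else 0 with hdY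
  have Y0 : Y 0 = 0 := by simp [hY]
  have dY0 : dY 0 = 0 := by simp [hdY]
  have ep : ∀ t ∈ Ioo 0 β, Y =ᶠ[nhds t] φ ∧ dY =ᶠ[nhds t] φ' := by
    intro t ht
    constructor <;>
    · filter_upwards [Ioi_mem_nhds ht.1] with s hs
      simp [hY, hdY, mem_Ioi.1 hs]
  have en : ∀ t, -t ∈ Ioo 0 β2 → Y =ᶠ[nhds t] (fun t => ψ (-t)) ∧ dY =ᶠ[nhds t] (fun t => -ψ' (-t)) := by
    intro t ht
    have : t < 0 := by linarith [ht.1]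
    constructor <;>
    · filter_upwards [Iio_mem_nhds this] with s hs
      simp [hY, hdY, mem_Iio.1 hs, (mem_Iio.1 hs).le.not_gt]
  have Yb : ∀ t ∈ Ioo (-β2) β, |Y t| ≤ |t| := by
    intro t ht
    by_cases h0 : t = 0
    · simp [h0, Y0]
    rcases hne t ht h0 with k | k
    · rw [(ep t k).1.eq_of_nhds]; exact ((hφ t k).2.2.1).trans (le_abs_self _)
    · rw [(en t k).1.eq_of_nhds]; exact ((hψ _ k).2.2.1).trans (neg_le_abs _)
  have dYb : ∀ t ∈ Ioo (-β2) β, |dY t| ≤ 3 * |t| := by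
    intro t ht
    by_cases h0 : t = 0
    · simp [h0, dY0]
    rcases hne t ht h0 with k | k
    · rw [(ep t k).2.eq_of_nhds]; have := ((hφ t k).2.2.2.1); linarith [le_abs_self t]
    · rw [(en t k).2.eq_of_nhds, abs_neg]; have := ((hψ _ k).2.2.2.1); linarith [neg_le_abs t]
  have nz : Ioo (-β2) β ∈ nhds (0 : ℝ) := Ioo_mem_nhds (by linarith) b0
  have cY0 : ContinuousAt Y 0 := by
    rw [ContinuousAt, Y0]
    refine squeeze_zero_norm' (a := fun t => |t|) ?_ ?_
    · filter_upwards [nz] with t ht using Yb t ht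
    · have := (continuous_abs (G := ℝ)).tendsto 0; simpa using this
  have cdY0 : ContinuousAt dY 0 := by
    rw [ContinuousAt, dY0]
    refine squeeze_zero_norm' (a := fun t => 3 * |t|) ?_ ?_
    · filter_upwards [nz] with t ht using dYb t ht
    · have := ((continuous_abs (G := ℝ)).const_mul 3).tendsto 0; simpa using this
  have dne : ∀ t ∈ Ioo (-β2) β, t ≠ 0 → HasDerivAt Y (dY t) t := by
    intro t ht h0
    rcases hne t ht h0 with k | k
    · rw [(ep t k).2.eq_of_nhds]
      exact (hφ t k).1.congr_of_eventuallyEq (ep t k).1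
    · rw [(en t k).2.eq_of_nhds]
      have := (hψ _ k).1.comp t (hasDerivAt_neg t)
      simp only [mul_neg, mul_one] at this
      exact this.congr_of_eventuallyEq (en t k).1
  have dY' : ∀ t ∈ Ioo (-β2) β, HasDerivAt Y (dY t) t := by
    intro t ht
    by_cases h0 : t = 0
    · subst h0
      rw [dY0]
      have hO : Y =O[nhds 0] fun x => ‖x - 0‖ ^ 2 := by
        refine IsBigO.of_bound 3 ?_
        filter_upwards [nz] with t ht
        simp only [sub_zero, norm_pow, Real.norm_eq_abs, abs_abs, sq_abs]
        by_cases h0 : t = 0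
        · simp [h0, Y0]
        rcases hne t ht h0 with k | k
        · rw [(ep t k).1.eq_of_nhds]; exact ((hφ t k).2.2.2.2)
        · rw [(en t k).1.eq_of_nhds]; have := ((hψ _ k).2.2.2.2); simpa using this
      have := (hO.hasFDerivAt one_lt_two).hasDerivAt
      simpa using this
    · exact dne t ht h0
  refine ⟨fun t => (t, Y t), fun t => (1, dY t), -β2, β, ⟨?_, fun t ht => ⟨(hasDerivAt_id t).prodMk (dY' t ht), by simp, ?_⟩⟩, ?_⟩
  · refine continuousOn_const.prodMk fun t ht => ContinuousAt.continuousWithinAt ?_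
    by_cases h0 : t = 0
    · subst h0; exact cdY0
    rcases hne t ht h0 with k | k
    · exact (cφ.continuousAt (isOpen_Ioo.mem_nhds k)).congr (ep t k).2.symm
    · refine ContinuousAt.congr ?_ (en t k).2.symm
      exact ((cψ.continuousAt (isOpen_Ioo.mem_nhds k)).comp (f := fun t => -t) continuousAt_neg).neg
  · by_cases h0 : t = 0
    · subst h0
      simp only [Y0, dY0, QH]
      have e1 := h.B0
      have e2 := h.D0
      rw [Prod.zero_eq_mk] at e1 e2
      simp [e1, e2]
    rcases hne t ht h0 with k | k
    · simp only [(ep t k).1.eq_of_nhds, (ep t k).2.eq_of_nhds]; exact (hφ t k).2.1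
    · simp only [(en t k).1.eq_of_nhds, (en t k).2.eq_of_nhds]
      have := QH_refl.1 (hψ _ k).2.1
      simp only [rfl1_apply, QH] at this ⊢
      simp only [neg_neg] at this
      rw [← neg_sq]
      simp at this ⊢
      linarith
  · ext p
    constructor
    · rintro ((⟨t, ht, rfl⟩ | h0) | ⟨t, ht, rfl⟩)
      · exact ⟨t, ⟨by linarith [ht.1], ht.2⟩, by simp [hY, ht.1]⟩
      · rw [mem_singleton_iff] at h0; subst h0
        exact ⟨0, ⟨by linarith, b0⟩, by simp [Y0]⟩
      · exact ⟨-t, ⟨by linarith [ht.2], by linarith [ht.1]⟩, by simp [hY, ht.1, ht.1.le.not_gt]⟩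
    · rintro ⟨t, ht, rfl⟩
      by_cases h0 : t = 0
      · subst h0; left; right; simp [Y0]
      rcases hne t ht h0 with k | k
      · left; left; exact ⟨t, k, by simp [hY, k.1]⟩
      · right; exact ⟨-t, k, by have : t < 0 := by linarith [k.1]
                                simp [hY, this, this.le.not_gt]⟩
end

theorem origin {σ r D Ds Dc B r' D' Ds' Dc' B'} (h : NF σ r D Ds Dc B) (h' : NF σ r' D' Ds' Dc' B') (hσ : |σ| ≤ 1)
    (H : TEF (Fam (Curve (QH D B)) {p | 0 < p.1} {p | p.1 < 0}) (Fam (Curve (QH D' B')) {p | 0 < p.1} {p | p.1 < 0})) :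
    TEF (fun _ : Unit => Curve (QH D B)) (fun _ => Curve (QH D' B')) := by
  obtain ⟨e, e1, e2, e3⟩ := H
  have oW : IsOpen (e.source ∩ e ⁻¹' Metric.ball 0 r') := e.isOpen_inter_preimage Metric.isOpen_ball
  have e0 : (0 : 𝕍) ∈ e.target := by have := e.map_source e1; rwa [e2] at this
  have e4 : e.symm 0 = 0 := by have := e.left_inv e1; rwa [e2] at this
  refine ⟨(e.restrOpen _ oW).restrOpen (Metric.ball 0 r) Metric.isOpen_ball, ?_, e2, ?_⟩
  · simp [e1, e2, h.r0, h'.r0]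
  intro _ S hS
  show _ ↔ Curve _ (e '' S)
  have hS1 : S ⊆ e.source := fun p hp => by have := hS hp; simp at this; exact this.1.1
  have hS2 : ∀ p ∈ S, ‖p‖ ≤ r := fun p hp => by have := hS hp; simp at this; exact this.2.le
  have hS3 : ∀ p ∈ e '' S, ‖p‖ ≤ r' := by
    rintro _ ⟨p, hp, rfl⟩; have := hS hp; simp at this; exact this.1.2.le
  have z : (0 : 𝕍) ∈ S ↔ (0 : 𝕍) ∈ e '' S := by
    constructor
    · intro k; exact ⟨0, k, e2⟩
    · rintro ⟨x, hx, he⟩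
      have : x = 0 := e.injOn (hS1 hx) e1 (he.trans e2.symm)
      rwa [← this]
  by_cases h0 : (0 : 𝕍) ∈ S
  · have s1 : Curve (QH D B) S ↔ Dec (QH D B) S := ⟨dec_of_curve h0, h.curve_of_dec hσ hS2⟩
    have s2 : Curve (QH D' B') (e '' S) ↔ Dec (QH D' B') (e '' S) := ⟨dec_of_curve (z.1 h0), h'.curve_of_dec hσ hS3⟩
    show Curve (QH D B) S ↔ _
    rw [s1, s2]
    have he := e3 1
    have he2 := e3 2
    simp only [Fam] at he he2
    constructor
    · rintro ⟨S1, S2, c1, c2, p1, p2, z1, z2, rfl⟩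
      have m1 : S1 ⊆ e.source := fun p hp => hS1 (by simp [hp])
      have m2 : S2 ⊆ e.source := fun p hp => hS1 (by simp [hp])
      have k1 := (he S1 m1).1 ⟨c1, p1⟩
      have k2 := (he2 S2 m2).1 ⟨c2, p2⟩
      have ce := (e.continuousAt e1)
      refine ⟨e '' S1, e '' S2, k1.1, k2.1, k1.2, k2.2, ?_, ?_, ?_⟩
      · have := ce.continuousWithinAt.mem_closure_image z1; rwa [e2] at this
      · have := ce.continuousWithinAt.mem_closure_image z2; rwa [e2] at this
      · rw [image_union, image_union, image_singleton, e2]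
    · rintro ⟨S1, S2, c1, c2, p1, p2, z1, z2, hu⟩
      have tt : e '' S ⊆ e.target := by rintro _ ⟨p, hp, rfl⟩; exact e.map_source (hS1 hp)
      have m1 : S1 ⊆ e.target := fun p hp => tt (by rw [hu]; simp [hp])
      have m2 : S2 ⊆ e.target := fun p hp => tt (by rw [hu]; simp [hp])
      have i1 : e '' (e.symm '' S1) = S1 := e.toPartialEquiv.image_symm_image_of_subset_target m1
      have i2 : e '' (e.symm '' S2) = S2 := e.toPartialEquiv.image_symm_image_of_subset_target m2
      have k1 := (he (e.symm '' S1) (by rintro _ ⟨p, hp, rfl⟩; exact e.map_target (m1 hp))).2 (by rw [i1]; exact ⟨c1, p1⟩)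
      have k2 := (he2 (e.symm '' S2) (by rintro _ ⟨p, hp, rfl⟩; exact e.map_target (m2 hp))).2 (by rw [i2]; exact ⟨c2, p2⟩)
      have ce := (e.symm.continuousAt (by simpa using e0))
      refine ⟨_, _, k1.1, k2.1, k1.2, k2.2, ?_, ?_, ?_⟩
      · have := ce.continuousWithinAt.mem_closure_image z1; rwa [e4] at this
      · have := ce.continuousWithinAt.mem_closure_image z2; rwa [e4] at this
      · have : e.symm '' (e '' S) = S := e.toPartialEquiv.symm_image_image_of_subset_source hS1
        rw [← this, hu, image_union, image_union, image_singleton, e4]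
  · have := e3 0 S hS1
    simp only [Fam] at this
    rw [← z] at this
    simpa [h0] using this

theorem implicit_deriv {D : 𝕍 → ℝ} {s c Q : ℝ → ℝ} {t0 a b c' Q' : ℝ}
    (hD : HasFDerivAt D (a • ContinuousLinearMap.fst ℝ ℝ ℝ + b • ContinuousLinearMap.snd ℝ ℝ ℝ) (s t0, c t0))
    (ha : a ≠ 0) (hc : HasDerivAt c c' t0) (hQ : HasDerivAt Q Q' t0)
    (he : ∀ᶠ t in nhds t0, D (s t, c t) = Q t)
    (hs : (fun t => s t - s t0) =O[nhds t0] fun t => t - t0) :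
    HasDerivAt s ((Q' - b * c') / a) t0 := by
  have hs0 : Tendsto s (nhds t0) (nhds (s t0)) := by
    have h1 : Tendsto (fun t => t - t0) (nhds t0) (nhds 0) := by
      have : Continuous (fun t : ℝ => t - t0) := by fun_prop
      simpa using this.tendsto t0
    have h2 := hs.trans_tendsto h1
    have := h2.add_const (s t0)
    simpa using this
  have hp : Tendsto (fun t => (s t, c t)) (nhds t0) (nhds (s t0, c t0)) := hs0.prodMk_nhds hc.continuousAt
  have h1 := hD.isLittleO.comp_tendsto hp
  have hbc : (fun t => c t - c t0) =O[nhds t0] fun t => t - t0 := hc.isBigO_sub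
  have h2 : ((fun p : 𝕍 => p - (s t0, c t0)) ∘ fun t => (s t, c t)) =O[nhds t0] fun t => t - t0 :=
    (hs.prod_left hbc)
  have h3 := h1.trans_isBigO h2
  have h4 := hasDerivAt_iff_isLittleO.1 hc
  have h5 := hasDerivAt_iff_isLittleO.1 hQ
  rw [hasDerivAt_iff_isLittleO]
  have h6 := ((h5.sub (h4.const_mul_left b)).sub h3).const_mul_left a⁻¹
  refine h6.congr' ?_ EventuallyEq.rfl
  have e0 := he.self_of_nhds
  filter_upwards [he] with t ht
  simp only [Function.comp, ht, e0]
  simp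
  field_simp
  ring

def imp (D : 𝕍 → ℝ) (r q c : ℝ) : ℝ := Classical.epsilon fun s => 0 ≤ s ∧ s ≤ r ∧ D (s, c) = q ^ 2

section
variable {r : ℝ} {D Ds Dc B : 𝕍 → ℝ}

theorem pnorm_le {s c r : ℝ} (h1 : |s| ≤ r) (h2 : |c| ≤ r) : ‖((s, c) : 𝕍)‖ ≤ r := by
  rw [Prod.norm_def]; exact max_le h1 h2

theorem NF.inc (h : NF (-1) r D Ds Dc B) {s s' c : ℝ} (h0 : 0 ≤ s') (h1 : s' ≤ s) (hc : |c| ≤ 2 * s)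
    (hs : s ≤ r) (hcr : |c| ≤ r) : 24 / 25 * ((s + s') * (s - s')) ≤ D (s, c) - D (s', c) := by
  have n1 : ‖((s, c) : 𝕍)‖ ≤ r := pnorm_le (by rw [abs_of_nonneg (h0.trans h1)]; exact hs) hcr
  have n2 : ‖((s', c) : 𝕍)‖ ≤ r := pnorm_le (by rw [abs_of_nonneg h0]; linarith) hcr
  have hE := (abs_le.1 (h.E n1 n2)).1
  have m : max ‖((s, c) : 𝕍)‖ ‖((s', c) : 𝕍)‖ ≤ 2 * s :=
    max_le (pnorm_le (by rw [abs_of_nonneg (h0.trans h1)]; linarith) hc)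
      (pnorm_le (by rw [abs_of_nonneg h0]; linarith) hc)
  have m2 : ‖((s, c) : 𝕍) - (s', c)‖ = s - s' := by
    simp [Prod.norm_def, abs_of_nonneg (sub_nonneg.2 h1), h1]
  rw [m2] at hE
  have : max ‖((s, c) : 𝕍)‖ ‖((s', c) : 𝕍)‖ * (s - s') ≤ 2 * s * (s - s') := by
    gcongr
  simp only at hE
  nlinarith [mul_nonneg h0 (sub_nonneg.2 h1)]

theorem NF.cone (h : NF (-1) r D Ds Dc B) {p : 𝕍} (hp : ‖p‖ ≤ r) (hD : 0 ≤ D p) : |p.2| ≤ 103 / 100 * |p.1| := by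
  have hE := (abs_le.1 (h.E0 hp)).2
  have e1 := sq_abs p.1
  have e2 := sq_abs p.2
  have n1 := abs_nonneg p.1
  have n2 := abs_nonneg p.2
  by_contra hcon
  push Not at hcon
  have : ‖p‖ = |p.2| := by rw [Prod.norm_def]; exact max_eq_right (by simp only [Real.norm_eq_abs]; linarith)
  rw [this] at hE
  nlinarith

theorem NF.cone_norm (h : NF (-1) r D Ds Dc B) {p : 𝕍} (hp : ‖p‖ ≤ r) (hD : 0 ≤ D p) : ‖p‖ ≤ 103 / 100 * |p.1| := by
  have := h.cone hp hD
  rw [Prod.norm_def]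
  exact max_le (by rw [Real.norm_eq_abs]; linarith [abs_nonneg p.1]) this

theorem NF.D_le (h : NF (-1) r D Ds Dc B) {p : 𝕍} (hp : ‖p‖ ≤ r) (hD : 0 ≤ D p) :
    D p ≤ (102 / 100 * |p.1|) ^ 2 := by
  have hE := (abs_le.1 (h.E0 hp)).2
  have h1 := h.cone_norm hp hD
  have e1 := sq_abs p.1
  have n1 := abs_nonneg p.1
  have n2 := norm_nonneg p
  have : ‖p‖ ^ 2 ≤ (103 / 100 * |p.1|) ^ 2 := by gcongr
  nlinarith [sq_nonneg p.2]

theorem NF.uniq (h : NF (-1) r D Ds Dc B) {s s' c : ℝ} (h0 : 0 ≤ s') (h1 : 0 ≤ s) (hs : s ≤ r) (hs' : s' ≤ r)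
    (hc : |c| ≤ r) (he : D (s, c) = D (s', c)) (hD : 0 ≤ D (s, c)) : s = s' := by
  have key : ∀ s s', 0 ≤ s' → s ≤ r → s' < s → 0 ≤ D (s, c) → D (s, c) ≠ D (s', c) := by
    intro s s' k0 k1 k2 k3 k4
    have := h.cone (p := (s, c)) (pnorm_le (by rw [abs_of_nonneg (k0.trans k2.le)]; exact k1) hc) k3
    simp only [abs_of_nonneg (k0.trans k2.le)] at this
    have i := h.inc k0 k2.le (by linarith) k1 hc
    have : 0 < (s + s') * (s - s') := mul_pos (by linarith) (by linarith)
    linarith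
  rcases lt_trichotomy s s' with k | k | k
  · exact (key s' s h1 hs' k (he ▸ hD) he.symm).elim
  · exact k
  · exact (key s s' h0 hs k hD he).elim

theorem NF.imp_exists (h : NF (-1) r D Ds Dc B) {q c : ℝ} (hq : |q| ≤ r / 2) (hc : |c| ≤ r / 2) :
    ∃ s, 0 ≤ s ∧ s ≤ 2 * max |q| |c| ∧ D (s, c) = q ^ 2 := by
  set m := max |q| |c|
  have m0 : 0 ≤ m := le_max_of_le_left (abs_nonneg q)
  have mr : 2 * m ≤ r := by have := max_le hq hc; linarith
  have qm : |q| ≤ m := le_max_left _ _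
  have cm : |c| ≤ m := le_max_right _ _
  have cont : ContinuousOn (fun s => D (s, c)) (Icc 0 (2 * m)) :=
    h.cD.comp (by fun_prop) fun s hs => pnorm_le (by rw [abs_of_nonneg hs.1]; exact hs.2.trans mr) (by linarith)
  have e1 := sq_abs q
  have e2 := sq_abs c
  have n1 := abs_nonneg q
  have n2 := abs_nonneg c
  have lo : D (0, c) ≤ q ^ 2 := by
    have hE := (abs_le.1 (h.E0 (p := (0, c)) (pnorm_le (by simpa using h.r0.le) (by linarith)))).2
    have : ‖((0, c) : 𝕍)‖ = |c| := by simp [Prod.norm_def]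
    rw [this] at hE
    simp only at hE
    nlinarith
  have hi : q ^ 2 ≤ D (2 * m, c) := by
    have k : |2 * m| = 2 * m := abs_of_nonneg (by linarith)
    have hE := (abs_le.1 (h.E0 (p := (2 * m, c)) (pnorm_le (by rw [k]; exact mr) (by linarith)))).1
    have : ‖((2 * m, c) : 𝕍)‖ ≤ 2 * m := pnorm_le k.le (by linarith)
    have : ‖((2 * m, c) : 𝕍)‖ ^ 2 ≤ (2 * m) ^ 2 := by gcongr
    simp only at hE
    nlinarith
  obtain ⟨s, hs, he⟩ := intermediate_value_Icc (by linarith) cont ⟨lo, hi⟩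
  exact ⟨s, hs.1, hs.2, he⟩

theorem NF.imp_eq (h : NF (-1) r D Ds Dc B) {s q c : ℝ} (h0 : 0 ≤ s) (hs : s ≤ r) (hc : |c| ≤ r)
    (he : D (s, c) = q ^ 2) : imp D r q c = s := by
  have k := Classical.epsilon_spec (p := fun s => 0 ≤ s ∧ s ≤ r ∧ D (s, c) = q ^ 2) ⟨s, h0, hs, he⟩
  exact h.uniq h0 k.1 k.2.1 hs hc (k.2.2.trans he.symm) (by rw [imp, k.2.2]; positivity)

theorem NF.imp_spec (h : NF (-1) r D Ds Dc B) {q c : ℝ} (hq : |q| ≤ r / 2) (hc : |c| ≤ r / 2) :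
    0 ≤ imp D r q c ∧ imp D r q c ≤ 2 * max |q| |c| ∧ D (imp D r q c, c) = q ^ 2 := by
  obtain ⟨s, h0, h1, h2⟩ := h.imp_exists hq hc
  have := max_le hq hc
  rw [h.imp_eq h0 (by linarith) (by linarith [h.r0]) h2]
  exact ⟨h0, h1, h2⟩

theorem NF.imp_r (h : NF (-1) r D Ds Dc B) {q c : ℝ} (hq : |q| ≤ r / 2) (hc : |c| ≤ r / 2) :
    ‖((imp D r q c, c) : 𝕍)‖ ≤ r := by
  obtain ⟨h0, h1, h2⟩ := h.imp_spec hq hc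
  have := max_le hq hc
  exact pnorm_le (by rw [abs_of_nonneg h0]; linarith) (by linarith [h.r0])

theorem NF.imp_c (h : NF (-1) r D Ds Dc B) {q c : ℝ} (hq : |q| ≤ r / 2) (hc : |c| ≤ r / 2) :
    |c| ≤ 103 / 100 * imp D r q c ∧ |q| ≤ 102 / 100 * imp D r q c ∧
    ‖((imp D r q c, c) : 𝕍)‖ ≤ 103 / 100 * imp D r q c := by
  obtain ⟨h0, h1, h2⟩ := h.imp_spec hq hc
  have h3 := h.imp_r hq hc
  have h4 : 0 ≤ D (imp D r q c, c) := by rw [h2]; positivity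
  refine ⟨?_, ?_, ?_⟩
  · have := h.cone h3 h4; simpa [abs_of_nonneg h0] using this
  · have := h.D_le h3 h4
    rw [h2] at this
    simp only [abs_of_nonneg h0] at this
    exact abs_le_of_sq_le_sq this (by positivity)
  · have := h.cone_norm h3 h4; simpa [abs_of_nonneg h0] using this

theorem NF.imp_lip (h : NF (-1) r D Ds Dc B) {q c q' c' : ℝ} (hq : |q| ≤ r / 2) (hc : |c| ≤ r / 2)
    (hq' : |q'| ≤ r / 2) (hc' : |c'| ≤ r / 2) :
    |imp D r q c - imp D r q' c'| ≤ 11 / 10 * |q - q'| + 11 / 10 * |c - c'| := by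
  obtain ⟨h0, -, h2⟩ := h.imp_spec hq hc
  obtain ⟨h0', -, h2'⟩ := h.imp_spec hq' hc'
  obtain ⟨i1, i2, i3⟩ := h.imp_c hq hc
  obtain ⟨j1, j2, j3⟩ := h.imp_c hq' hc'
  have hE := h.E (h.imp_r hq hc) (h.imp_r hq' hc')
  set s := imp D r q c
  set s' := imp D r q' c'
  rcases (add_nonneg h0 h0').eq_or_lt with e | e
  · have z1 : s = 0 := by linarith
    have z2 : s' = 0 := by linarith
    rw [z1, z2]; simp; positivity
  have m : max ‖((s, c) : 𝕍)‖ ‖((s', c') : 𝕍)‖ ≤ 103 / 100 * (s + s') :=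
    max_le (by linarith) (by linarith)
  have n : ‖((s, c) : 𝕍) - (s', c')‖ ≤ |s - s'| + |c - c'| :=
    pnorm_le (by simp) (by simp)
  have k1 : max ‖((s, c) : 𝕍)‖ ‖((s', c') : 𝕍)‖ * ‖((s, c) : 𝕍) - (s', c')‖ ≤
      103 / 100 * (s + s') * (|s - s'| + |c - c'|) := by gcongr
  have k2 : |q ^ 2 - q' ^ 2| ≤ 102 / 100 * (s + s') * |q - q'| := by
    rw [sq_sub_sq, abs_mul]; gcongr
    exact (abs_add_le _ _).trans (by linarith)
  have k3 : |c ^ 2 - c' ^ 2| ≤ 103 / 100 * (s + s') * |c - c'| := by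
    rw [sq_sub_sq, abs_mul]; gcongr
    exact (abs_add_le _ _).trans (by linarith)
  have k4 : |s - s'| * (s + s') = |s ^ 2 - s' ^ 2| := by
    rw [sq_sub_sq, abs_mul, abs_of_nonneg e.le]; ring
  have k5 : |s ^ 2 - s' ^ 2| ≤ |q ^ 2 - q' ^ 2| + |c ^ 2 - c' ^ 2| +
      103 / 100 * (s + s') * (|s - s'| + |c - c'|) / 50 := by
    rw [h2, h2'] at hE
    simp only at hE
    have a1 := abs_le.1 (hE.trans (div_le_div_of_nonneg_right k1 (by norm_num : (0 : ℝ) ≤ 50)))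
    have a2 := abs_le.1 (le_refl |q ^ 2 - q' ^ 2|)
    have a3 := abs_le.1 (le_refl |c ^ 2 - c' ^ 2|)
    rw [abs_le]; constructor <;> linarith [a1.1, a1.2, a2.1, a2.2, a3.1, a3.2]
  have p1 := abs_nonneg (q - q')
  have p2 := abs_nonneg (c - c')
  have k6 : |s - s'| * (s + s') ≤ (11 / 10 * |q - q'| + 11 / 10 * |c - c'|) * (s + s') := by
    have : |s - s'| * (s + s') * (97 / 100) ≤ (102 / 100 * |q - q'| + 1051 / 1000 * |c - c'|) * (s + s') := by
      nlinarith [mul_nonneg p2 e.le, mul_nonneg p1 e.le, mul_nonneg (abs_nonneg (s - s')) e.le]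
    nlinarith [mul_nonneg p2 e.le, mul_nonneg p1 e.le]
  exact le_of_mul_le_mul_right k6 e

theorem NF.imp_contOn (h : NF (-1) r D Ds Dc B) :
    ContinuousOn (fun x : 𝕍 => imp D r x.1 x.2) {x | ‖x‖ ≤ r / 2} := by
  refine contOn_of_lip (C := 22 / 10) fun p p' hp hp' => ?_
  have := h.imp_lip ((norm_fst_le p).trans hp) ((norm_snd_le p).trans hp) ((norm_fst_le p').trans hp') ((norm_snd_le p').trans hp')
  have h1 := norm_fst_le (p - p')
  have h2 := norm_snd_le (p - p')
  simp only [Prod.fst_sub, Prod.snd_sub, Real.norm_eq_abs] at h1 h2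
  linarith

theorem NF.imp_deriv (h : NF (-1) r D Ds Dc B) {q c : ℝ → ℝ} {t0 q' c' : ℝ} (hq : |q t0| < r / 2) (hc : |c t0| < r / 2)
    (dq : HasDerivAt q q' t0) (dc : HasDerivAt c c' t0) (ha : Ds (imp D r (q t0) (c t0), c t0) ≠ 0) :
    HasDerivAt (fun t => imp D r (q t) (c t))
      ((2 * q t0 * q' - Dc (imp D r (q t0) (c t0), c t0) * c') / Ds (imp D r (q t0) (c t0), c t0)) t0 := by
  have e1 : ∀ᶠ t in nhds t0, |q t| < r / 2 := dq.continuousAt.abs.eventually_lt_const hq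
  have e2 : ∀ᶠ t in nhds t0, |c t| < r / 2 := dc.continuousAt.abs.eventually_lt_const hc
  have hQ : HasDerivAt (fun t => q t ^ 2) (2 * q t0 * q') t0 := by
    have := dq.fun_pow 2; simpa using this
  refine implicit_deriv (Q := fun t => q t ^ 2) (c := c) (h.hD _ (h.imp_r hq.le hc.le)) ha dc hQ ?_ ?_
  · filter_upwards [e1, e2] with t h1 h2
    exact (h.imp_spec h1.le h2.le).2.2
  · have b1 : (fun t => 11 / 10 * |q t - q t0| + 11 / 10 * |c t - c t0|) =O[nhds t0] fun t => t - t0 :=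
      ((dq.isBigO_sub.abs_left).const_mul_left _).add ((dc.isBigO_sub.abs_left).const_mul_left _)
    refine IsBigO.trans (IsBigO.of_bound 1 ?_) b1
    filter_upwards [e1, e2] with t h1 h2
    have := h.imp_lip h1.le h2.le hq.le hc.le
    rw [Real.norm_eq_abs, one_mul]
    exact this.trans (le_abs_self _)

def bdf (D : 𝕍 → ℝ) (r c : ℝ) : ℝ := imp D r 0 c

theorem NF.bdf_le (h : NF (-1) r D Ds Dc B) {c : ℝ} (hc : |c| ≤ r / 2) : bdf D r c ≤ 2 * |c| ∧ |c| ≤ 103 / 100 * bdf D r c ∧ 0 ≤ bdf D r c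
    ∧ D (bdf D r c, c) = 0 := by
  have h0 : |(0 : ℝ)| ≤ r / 2 := by rw [abs_zero]; linarith [h.r0]
  have h1 := h.imp_spec h0 hc
  have h2 := h.imp_c h0 hc
  refine ⟨?_, h2.1, h1.1, ?_⟩
  · have := h1.2.1; simpa [bdf] using this
  · have := h1.2.2; simpa [bdf] using this

theorem NF.bdf_cont (h : NF (-1) r D Ds Dc B) : ContinuousOn (bdf D r) {c | |c| ≤ r / 2} :=
  h.imp_contOn.comp (f := fun c => ((0 : ℝ), c)) (by fun_prop) fun c hc => pnorm_le (by rw [abs_zero]; linarith [h.r0]) hc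

theorem NF.bdf_pos (h : NF (-1) r D Ds Dc B) {s c : ℝ} (hc : |c| ≤ r / 2) (h0 : 0 ≤ s) (hs : s ≤ r) :
    (0 < D (s, c) ↔ bdf D r c < s) ∧ (0 ≤ D (s, c) ↔ bdf D r c ≤ s) := by
  obtain ⟨b1, b2, b3, b4⟩ := h.bdf_le hc
  have cr : |c| ≤ r := by linarith [h.r0]
  have k1 : bdf D r c < s → 0 < D (s, c) := by
    intro k
    have := h.inc b3 k.le (by linarith) hs cr
    have : 0 < (s + bdf D r c) * (s - bdf D r c) := mul_pos (by linarith) (by linarith)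
    linarith
  have k2 : s < bdf D r c → D (s, c) < 0 := by
    intro k
    have := h.inc h0 k.le (by linarith) (by linarith) cr
    have : 0 < (bdf D r c + s) * (bdf D r c - s) := mul_pos (by linarith) (by linarith)
    linarith
  refine ⟨⟨fun k => ?_, k1⟩, ⟨fun k => ?_, fun k => ?_⟩⟩
  · by_contra hh
    push Not at hh
    rcases hh.lt_or_eq with e | e
    · linarith [k2 e]
    · rw [e, b4] at k; exact lt_irrefl _ k
  · by_contra hh
    push Not at hh
    linarith [k2 hh]
  · rcases k.lt_or_eq with e | e
    · exact (k1 e).le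
    · rw [← e, b4]

end

theorem GH {K : Set 𝕍} (hK : IsCompact K) {h : 𝕍 → 𝕍} (hc : ContinuousOn h K) (hi : InjOn h K)
    (h0 : (0 : 𝕍) ∈ interior K) (hh : h 0 = 0) (hn : h '' K ∈ nhds 0) :
    ∃ e : OpenPartialHomeomorph 𝕍 𝕍, (0 : 𝕍) ∈ e.source ∧ e.source ⊆ K ∧ ∀ p, e p = h p := by
  set k := Function.invFunOn h K
  have kl : ∀ p ∈ K, k (h p) = p := fun p hp => hi.leftInvOn_invFunOn hp
  have kr : ∀ P ∈ h '' K, h (k P) = P ∧ k P ∈ K := by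
    rintro _ ⟨p, hp, rfl⟩; rw [kl p hp]; exact ⟨rfl, hp⟩
  have kc : ContinuousOn k (h '' K) := by
    rw [continuousOn_iff_isClosed]
    intro t ht
    refine ⟨h '' (K ∩ t), ((hK.inter_right ht).image_of_continuousOn (hc.mono inter_subset_left)).isClosed, ?_⟩
    ext P; constructor
    · rintro ⟨h1, p, hp, rfl⟩
      have h1' : k (h p) ∈ t := h1
      rw [kl p hp] at h1'
      exact ⟨⟨p, ⟨hp, h1'⟩, rfl⟩, p, hp, rfl⟩
    · rintro ⟨⟨p, ⟨hp, h1⟩, rfl⟩, -⟩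
      refine ⟨?_, p, hp, rfl⟩
      show k (h p) ∈ t
      rwa [kl p hp]
  refine ⟨{ toFun := h, invFun := k, source := interior K ∩ h ⁻¹' interior (h '' K),
            target := interior (h '' K) ∩ k ⁻¹' interior K, map_source' := ?_, map_target' := ?_,
            left_inv' := ?_, right_inv' := ?_, open_source := ?_, open_target := ?_,
            continuousOn_toFun := ?_, continuousOn_invFun := ?_ }, ?_, ?_, fun p => rfl⟩
  · rintro p ⟨h1, h2⟩
    refine ⟨h2, ?_⟩
    show k (h p) ∈ interior K
    rwa [kl p (interior_subset h1)]
  · rintro P ⟨h1, h2⟩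
    refine ⟨h2, ?_⟩
    show h (k P) ∈ interior (h '' K)
    rwa [(kr P (interior_subset h1)).1]
  · rintro p ⟨h1, h2⟩; exact kl p (interior_subset h1)
  · rintro P ⟨h1, h2⟩; exact (kr P (interior_subset h1)).1
  · exact hc.mono fun p hp => interior_subset hp.1
  · exact kc.mono fun p hp => interior_subset hp.1
  · exact (hc.mono interior_subset).isOpen_inter_preimage isOpen_interior isOpen_interior
  · exact (kc.mono interior_subset).isOpen_inter_preimage isOpen_interior isOpen_interior
  · refine ⟨h0, ?_⟩
    show h 0 ∈ interior (h '' K)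
    rw [hh]; exact mem_interior_iff_mem_nhds.2 hn
  · exact fun p hp => interior_subset hp.1

def Fam2 (C1 : Set 𝕍 → Prop) (R : Set 𝕍) (C2 : Set 𝕍 → Prop) (L : Set 𝕍) (i : Fin 2)
    (S : Set 𝕍) : Prop :=
  match i with
    | 0 => C1 S ∧ S ⊆ R
    | 1 => C2 S ∧ S ⊆ L

structure Sec (J C : Set 𝕍 → Prop) (ρ : ℝ) (ξ g : ℝ → ℝ) (ψ : 𝕍 → 𝕍) : Prop where
  ρ0 : 0 < ρ
  ξc : ContinuousOn ξ {c | |c| ≤ ρ}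
  ξ0 : ∀ c, |c| ≤ ρ → c ≠ 0 → 0 < ξ c
  ξ2 : ∀ c, |c| ≤ ρ → ξ c ≤ 2 * |c|
  ξz : ξ 0 = 0
  gc : ContinuousOn g {c | |c| ≤ ρ}
  gm : StrictMonoOn g {c | |c| ≤ ρ}
  g0 : g 0 = 0
  ψc : ContinuousOn ψ {p | ‖p‖ ≤ ρ ∧ ξ p.2 ≤ p.1}
  ψi : InjOn ψ {p | ‖p‖ ≤ ρ ∧ ξ p.2 ≤ p.1}
  ψb : ∀ c, |c| ≤ ρ → ξ c ≤ ρ → ψ (ξ c, c) = (|g c|, g c)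
  ψint : ∀ p, ‖p‖ ≤ ρ → ξ p.2 < p.1 → |(ψ p).2| < (ψ p).1
  ψs : ∃ δ > 0, ∀ P : 𝕍, ‖P‖ < δ → |P.2| ≤ P.1 → ∃ p, ‖p‖ ≤ ρ ∧ ξ p.2 ≤ p.1 ∧ ψ p = P
  cur : ∀ S, (∀ p ∈ S, ‖p‖ < ρ ∧ ξ p.2 < p.1) → (C S ↔ J (ψ '' S))

def midt (ξR ξL : ℝ → ℝ) (p : 𝕍) : ℝ := (p.1 + ξL p.2) / (ξR p.2 + ξL p.2)
def midY (ξR gR ξL gL : ℝ → ℝ) (p : 𝕍) : ℝ := (1 - midt ξR ξL p) * gL p.2 + midt ξR ξL p * gR p.2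
def mid (ξR gR ξL gL : ℝ → ℝ) (p : 𝕍) : 𝕍 :=
  ((2 * midt ξR ξL p - 1) * |midY ξR gR ξL gL p|, midY ξR gR ξL gL p)

theorem Sec.sgn {J C ρ ξ g ψ} (h : Sec J C ρ ξ g ψ) {c : ℝ} (hc : |c| ≤ ρ) :
    (0 < c → 0 < g c) ∧ (c < 0 → g c < 0) := by
  have z : (0 : ℝ) ∈ {c : ℝ | |c| ≤ ρ} := by simpa using h.ρ0.le
  refine ⟨fun k => ?_, fun k => ?_⟩
  · have := h.gm z hc k; rwa [h.g0] at this
  · have := h.gm hc z k; rwa [h.g0] at this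

section
variable {J CR CL : Set 𝕍 → Prop} {ρ : ℝ} {ξR gR ξL gL : ℝ → ℝ} {ψR ψL : 𝕍 → 𝕍}

theorem Sec.ψz (hR : Sec J CR ρ ξR gR ψR) : ψR 0 = 0 := by
  have := hR.ψb 0 (by simpa using hR.ρ0.le) (by rw [hR.ξz]; exact hR.ρ0.le)
  rw [hR.ξz, hR.g0, abs_zero] at this
  exact this

theorem mid_zero (hL : Sec J CL ρ ξL gL ψL) : mid ξR gR ξL gL 0 = 0 := by
  simp [mid, midY, midt, hL.ξz, hL.g0]

theorem mid_facts (hR : Sec J CR ρ ξR gR ψR) (hL : Sec J CL ρ ξL gL ψL) {p : 𝕍} (hp : ‖p‖ ≤ ρ)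
    (h1 : p.1 ≤ ξR p.2) (h2 : -ξL p.2 ≤ p.1) : p = 0 ∨
      (p.2 ≠ 0 ∧ 0 < ξR p.2 ∧ 0 < ξL p.2 ∧ 0 ≤ midt ξR ξL p ∧ midt ξR ξL p ≤ 1 ∧ midY ξR gR ξL gL p ≠ 0) := by
  have hc : |p.2| ≤ ρ := (norm_snd_le p).trans hp
  by_cases h0 : p.2 = 0
  · left
    rw [h0, hR.ξz] at h1
    rw [h0, hL.ξz] at h2
    exact Prod.ext (le_antisymm h1 (by simpa using h2)) h0
  right
  have a := hR.ξ0 _ hc h0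
  have b := hL.ξ0 _ hc h0
  have t0 : 0 ≤ midt ξR ξL p := div_nonneg (by linarith) (by linarith)
  have t1 : midt ξR ξL p ≤ 1 := (div_le_one (by linarith)).2 (by linarith)
  refine ⟨h0, a, b, t0, t1, ?_⟩
  simp only [midY]
  set t := midt ξR ξL p
  rcases lt_or_gt_of_ne h0 with k | k
  · have x := (hR.sgn hc).2 k
    have y := (hL.sgn hc).2 k
    have : (1 - t) * gL p.2 + t * gR p.2 < 0 := by
      rcases t0.eq_or_lt with e | e
      · rw [← e]; linarith
      · have := mul_neg_of_pos_of_neg e x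
        have := mul_nonpos_of_nonneg_of_nonpos (sub_nonneg.2 t1) y.le
        linarith
    exact this.ne
  · have x := (hR.sgn hc).1 k
    have y := (hL.sgn hc).1 k
    have : 0 < (1 - t) * gL p.2 + t * gR p.2 := by
      rcases t0.eq_or_lt with e | e
      · rw [← e]; linarith
      · have := mul_pos e x
        have := mul_nonneg (sub_nonneg.2 t1) y.le
        linarith
    exact this.ne'

theorem mid_inj (hR : Sec J CR ρ ξR gR ψR) (hL : Sec J CL ρ ξL gL ψL) {p p' : 𝕍} (hp : ‖p‖ ≤ ρ)
    (h1 : p.1 ≤ ξR p.2) (h2 : -ξL p.2 ≤ p.1) (hp' : ‖p'‖ ≤ ρ) (h1' : p'.1 ≤ ξR p'.2) (h2' : -ξL p'.2 ≤ p'.1)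
    (he : mid ξR gR ξL gL p = mid ξR gR ξL gL p') : p = p' := by
  have eY : midY ξR gR ξL gL p = midY ξR gR ξL gL p' := congrArg Prod.snd he
  have eX : (2 * midt ξR ξL p - 1) * |midY ξR gR ξL gL p| = (2 * midt ξR ξL p' - 1) * |midY ξR gR ξL gL p'| := congrArg Prod.fst he
  have z : midY ξR gR ξL gL 0 = 0 := congrArg Prod.snd (mid_zero (ξR := ξR) (gR := gR) hL)
  rcases mid_facts hR hL hp h1 h2 with k | ⟨k0, k1, k2, k3, k4, k5⟩ <;> rcases mid_facts hR hL hp' h1' h2' with l | ⟨l0, l1, l2, l3, l4, l5⟩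
  · rw [k, l]
  · rw [k, z] at eY; exact (l5 eY.symm).elim
  · rw [l, z] at eY; exact (k5 eY).elim
  rw [← eY] at eX
  have et : midt ξR ξL p = midt ξR ξL p' := by
    have := mul_right_cancel₀ (abs_ne_zero.2 k5) eX; linarith
  have hc : |p.2| ≤ ρ := (norm_snd_le p).trans hp
  have hc' : |p'.2| ≤ ρ := (norm_snd_le p').trans hp'
  have mono : ∀ t c c', 0 ≤ t → t ≤ 1 → |c| ≤ ρ → |c'| ≤ ρ → c < c' → (1 - t) * gL c + t * gR c < (1 - t) * gL c' + t * gR c' := by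
    intro t c c' t0 t1 m m' hlt
    have a := hR.gm m m' hlt
    have b := hL.gm m m' hlt
    rcases t0.eq_or_lt with e | e
    · rw [← e]; linarith
    · have := mul_lt_mul_of_pos_left a e
      have := mul_le_mul_of_nonneg_left b.le (sub_nonneg.2 t1)
      linarith
  have ec : p.2 = p'.2 := by
    simp only [midY, ← et] at eY
    rcases lt_trichotomy p.2 p'.2 with q | q | q
    · exact ((mono _ _ _ k3 k4 hc hc' q).ne eY).elim
    · exact q
    · exact ((mono _ _ _ k3 k4 hc' hc q).ne eY.symm).elim
  refine Prod.ext ?_ ec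
  simp only [midt, ← ec] at et
  have : ξR p.2 + ξL p.2 ≠ 0 := by linarith
  have := (div_left_inj' this).1 et
  linarith

theorem mid_cont (hR : Sec J CR ρ ξR gR ψR) (hL : Sec J CL ρ ξL gL ψL) :
    ContinuousOn (mid ξR gR ξL gL) {p | ‖p‖ ≤ ρ ∧ p.1 ≤ ξR p.2 ∧ -ξL p.2 ≤ p.1} := by
  set M := {p : 𝕍 | ‖p‖ ≤ ρ ∧ p.1 ≤ ξR p.2 ∧ -ξL p.2 ≤ p.1} with hM
  have m2 : MapsTo Prod.snd M {c : ℝ | |c| ≤ ρ} := fun p hp => (norm_snd_le p).trans hp.1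
  have c1 : ContinuousOn (fun p : 𝕍 => ξR p.2) M := hR.ξc.comp continuousOn_snd m2
  have c2 : ContinuousOn (fun p : 𝕍 => ξL p.2) M := hL.ξc.comp continuousOn_snd m2
  have c3 : ContinuousOn (fun p : 𝕍 => gR p.2) M := hR.gc.comp continuousOn_snd m2
  have c4 : ContinuousOn (fun p : 𝕍 => gL p.2) M := hL.gc.comp continuousOn_snd m2
  intro p hp
  rcases mid_facts hR hL hp.1 hp.2.1 hp.2.2 with k | ⟨k0, k1, k2, k3, k4, k5⟩
  · have hb : ∀ q ∈ M, ‖mid ξR gR ξL gL q‖ ≤ |gL q.2| + |gR q.2| := by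
      intro q hq
      rcases mid_facts hR hL hq.1 hq.2.1 hq.2.2 with l | ⟨l0, l1, l2, l3, l4, l5⟩
      · rw [l, mid_zero hL]; simp; positivity
      have hY : |midY ξR gR ξL gL q| ≤ |gL q.2| + |gR q.2| := by
        simp only [midY]
        refine (abs_add_le _ _).trans (add_le_add ?_ ?_)
        · rw [abs_mul]; exact mul_le_of_le_one_left (abs_nonneg _) (abs_le.2 ⟨by linarith, by linarith⟩)
        · rw [abs_mul]; exact mul_le_of_le_one_left (abs_nonneg _) (abs_le.2 ⟨by linarith, by linarith⟩)
      refine pnorm_le ?_ hY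
      rw [abs_mul, abs_abs]
      refine (mul_le_of_le_one_left (abs_nonneg _) (abs_le.2 ⟨by linarith, by linarith⟩)).trans hY
    subst k
    rw [ContinuousWithinAt, mid_zero hL]
    refine squeeze_zero_norm' (a := fun q : 𝕍 => |gL q.2| + |gR q.2|) ?_ ?_
    · filter_upwards [self_mem_nhdsWithin] with q hq using hb q hq
    · have := (c4.abs.add c3.abs) 0 hp
      have t : Tendsto (fun q : 𝕍 => |gL q.2| + |gR q.2|) (nhdsWithin 0 M) (nhds (|gL (0 : 𝕍).2| + |gR (0 : 𝕍).2|)) := this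
      have z : |gL (0 : 𝕍).2| + |gR (0 : 𝕍).2| = 0 := by simp [hL.g0, hR.g0]
      rwa [z] at t
  · have ct : ContinuousWithinAt (midt ξR ξL) M p :=
      (continuousWithinAt_fst.add (c2 p hp)).div ((c1 p hp).add (c2 p hp)) (by linarith)
    have cY : ContinuousWithinAt (midY ξR gR ξL gL) M p :=
      ((continuousWithinAt_const.sub ct).mul (c4 p hp)).add (ct.mul (c3 p hp))
    exact ((((continuousWithinAt_const.mul ct).sub continuousWithinAt_const)).mul cY.abs).prodMk cY

def glm (ξR gR ξL gL : ℝ → ℝ) (ψR ψL : 𝕍 → 𝕍) (p : 𝕍) : 𝕍 :=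
  open Classical in
  if ξR p.2 ≤ p.1 then ψR p else if ξL p.2 ≤ -p.1 then rfl1 (ψL (rfl1 p)) else mid ξR gR ξL gL p

theorem glm_R {p : 𝕍} (h : ξR p.2 ≤ p.1) : glm ξR gR ξL gL ψR ψL p = ψR p := by simp [glm, h]

theorem Sec.nonneg (hR : Sec J CR ρ ξR gR ψR) {c : ℝ} (hc : |c| ≤ ρ) : 0 ≤ ξR c := by
  by_cases h : c = 0
  · rw [h, hR.ξz]
  · exact (hR.ξ0 c hc h).le

theorem glm_zero (hR : Sec J CR ρ ξR gR ψR) : glm ξR gR ξL gL ψR ψL 0 = 0 := by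
  rw [glm_R (by simp [hR.ξz]), hR.ψz]

theorem glm_L (hR : Sec J CR ρ ξR gR ψR) (hL : Sec J CL ρ ξL gL ψL) {p : 𝕍} (hp : ‖p‖ ≤ ρ)
    (h : ξL p.2 ≤ -p.1) : glm ξR gR ξL gL ψR ψL p = rfl1 (ψL (rfl1 p)) := by
  have hc : |p.2| ≤ ρ := (norm_snd_le p).trans hp
  by_cases k : ξR p.2 ≤ p.1
  · have a := hR.nonneg hc
    have b := hL.nonneg hc
    have : p = 0 := by
      refine Prod.ext (by simp; linarith) ?_
      by_contra h0
      have := hR.ξ0 _ hc h0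
      linarith
    rw [this, glm_zero hR]; simp [hL.ψz]
  · simp [glm, k, h]

theorem glm_M (hR : Sec J CR ρ ξR gR ψR) (hL : Sec J CL ρ ξL gL ψL) {p : 𝕍} (hp : ‖p‖ ≤ ρ)
    (h1 : p.1 ≤ ξR p.2) (h2 : -ξL p.2 ≤ p.1) : glm ξR gR ξL gL ψR ψL p = mid ξR gR ξL gL p := by
  have hc : |p.2| ≤ ρ := (norm_snd_le p).trans hp
  rcases mid_facts hR hL hp h1 h2 with k | ⟨k0, k1, k2, k3, k4, k5⟩
  · rw [k, glm_zero hR, mid_zero hL]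
  by_cases e1 : p.1 = ξR p.2
  · rw [glm_R e1.ge]
    have : p = (ξR p.2, p.2) := Prod.ext e1 rfl
    have hx : ξR p.2 ≤ ρ := by rw [← e1]; exact (le_abs_self _).trans ((norm_fst_le p).trans hp)
    have ht : midt ξR ξL p = 1 := by rw [midt, e1]; exact div_self (by linarith)
    rw [this, hR.ψb _ hc hx, ← this]
    simp [mid, midY, ht]; norm_num
  by_cases e2 : p.1 = -ξL p.2
  · rw [glm_L hR hL hp (by linarith)]
    have : rfl1 p = (ξL p.2, p.2) := by rw [rfl1_apply, e2]; simp
    have hx : ξL p.2 ≤ ρ := by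
      have : ξL p.2 = - p.1 := by linarith
      rw [this]; exact (neg_le_abs _).trans ((norm_fst_le p).trans hp)
    have ht : midt ξR ξL p = 0 := by rw [midt, e2]; simp
    rw [this, hL.ψb _ hc hx]
    simp [mid, midY, ht, rfl1_apply]
  · have l1 : ¬ ξR p.2 ≤ p.1 := fun k => e1 (le_antisymm h1 k)
    have l2 : ¬ ξL p.2 ≤ -p.1 := fun k => e2 (by linarith)
    simp [glm, l1, l2]

theorem glue (hR : Sec J CR ρ ξR gR ψR) (hL : Sec J CL ρ ξL gL ψL) :
    ∃ e : OpenPartialHomeomorph 𝕍 𝕍, (0 : 𝕍) ∈ e.source ∧ e 0 = 0 ∧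
      e.source ⊆ Metric.ball 0 ρ ∧ 
    ∀ i S, S ⊆ e.source → (Fam2 CR {p | ξR p.2 < p.1} (fun S => CL (rfl1 '' S)) {p | ξL p.2 < -p.1} i S ↔
       Fam2 J {P | |P.2| < P.1} (fun S => J (rfl1 '' S)) {P | |P.2| < -P.1} i (e '' S)) := by
  have ρ0 := hR.ρ0
  set h := glm ξR gR ξL gL ψR ψL with hh
  set K : Set 𝕍 := Metric.closedBall 0 ρ with hK
  have memK : ∀ p, p ∈ K ↔ ‖p‖ ≤ ρ := fun p => by simp [hK]
  have m2 : MapsTo Prod.snd K {c : ℝ | |c| ≤ ρ} := fun p hp => (norm_snd_le p).trans ((memK p).1 hp)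
  have c1 : ContinuousOn (fun p : 𝕍 => ξR p.2) K := hR.ξc.comp continuousOn_snd m2
  have c2 : ContinuousOn (fun p : 𝕍 => ξL p.2) K := hL.ξc.comp continuousOn_snd m2
  have clK : IsClosed K := Metric.isClosed_closedBall
  have clA : IsClosed {p ∈ K | ξR p.2 ≤ p.1} := clK.isClosed_le c1 continuousOn_fst
  have clC : IsClosed {p ∈ K | ξL p.2 ≤ -p.1} := clK.isClosed_le c2 continuousOn_fst.neg
  have clM : IsClosed ({p ∈ K | p.1 ≤ ξR p.2} ∩ {p ∈ K | -ξL p.2 ≤ p.1}) :=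
    (clK.isClosed_le continuousOn_fst c1).inter (clK.isClosed_le c2.neg continuousOn_fst)
  have cA : ContinuousOn h {p ∈ K | ξR p.2 ≤ p.1} := by
    refine (hR.ψc.mono ?_).congr fun p hp => glm_R hp.2
    exact fun p hp => ⟨(memK p).1 hp.1, hp.2⟩
  have cC : ContinuousOn h {p ∈ K | ξL p.2 ≤ -p.1} := by
    refine ContinuousOn.congr ?_ fun p hp => glm_L hR hL ((memK p).1 hp.1) hp.2
    refine rfl1.continuous.comp_continuousOn (hL.ψc.comp rfl1.continuous.continuousOn ?_)
    intro p hp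
    exact ⟨by rw [rfl1_norm]; exact (memK p).1 hp.1, hp.2⟩
  have cM : ContinuousOn h ({p ∈ K | p.1 ≤ ξR p.2} ∩ {p ∈ K | -ξL p.2 ≤ p.1}) := by
    refine ((mid_cont hR hL).mono ?_).congr fun p hp => glm_M hR hL ((memK p).1 hp.1.1) hp.1.2 hp.2.2
    exact fun p hp => ⟨(memK p).1 hp.1.1, hp.1.2, hp.2.2⟩
  have tri : ∀ p, p ∈ K → ξR p.2 ≤ p.1 ∨ (p.1 ≤ ξR p.2 ∧ -ξL p.2 ≤ p.1) ∨ ξL p.2 ≤ -p.1 := by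
    intro p hp
    by_cases a : ξR p.2 ≤ p.1
    · exact Or.inl a
    by_cases b : ξL p.2 ≤ -p.1
    · exact Or.inr (Or.inr b)
    · push Not at a b; exact Or.inr (Or.inl ⟨a.le, by linarith⟩)
  have cont : ContinuousOn h K := by
    refine ((cA.union_of_isClosed cM clA clM).union_of_isClosed cC (clA.union clM) clC).mono ?_
    intro p hp
    rcases tri p hp with a | a | a
    · exact Or.inl (Or.inl ⟨hp, a⟩)
    · exact Or.inl (Or.inr ⟨⟨hp, a.1⟩, ⟨hp, a.2⟩⟩)
    · exact Or.inr ⟨hp, a⟩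
  have locA : ∀ p ∈ K, ξR p.2 ≤ p.1 → |(h p).2| ≤ (h p).1 ∧ ((h p).1 ≤ |(h p).2| → p.1 ≤ ξR p.2 ∧ -ξL p.2 ≤ p.1) := by
    intro p hp a
    rw [hh, glm_R a]
    have hc : |p.2| ≤ ρ := m2 hp
    rcases a.lt_or_eq with b | b
    · have := hR.ψint p ((memK p).1 hp) b
      exact ⟨this.le, fun k => absurd k (not_le.2 this)⟩
    · have e : p = (ξR p.2, p.2) := Prod.ext b.symm rfl
      have hx : ξR p.2 ≤ ρ := by rw [b]; exact (le_abs_self _).trans ((norm_fst_le p).trans ((memK p).1 hp))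
      rw [e, hR.ψb _ hc hx]
      exact ⟨le_rfl, fun _ => ⟨le_rfl, by linarith [hR.nonneg hc, hL.nonneg hc]⟩⟩
  have locC : ∀ p ∈ K, ξL p.2 ≤ -p.1 → |(h p).2| ≤ -(h p).1 ∧ (-(h p).1 ≤ |(h p).2| → p.1 ≤ ξR p.2 ∧ -ξL p.2 ≤ p.1) := by
    intro p hp a
    rw [hh, glm_L hR hL ((memK p).1 hp) a]
    have hc : |p.2| ≤ ρ := m2 hp
    rcases a.lt_or_eq with b | b
    · have := hL.ψint (rfl1 p) (by rw [rfl1_norm]; exact (memK p).1 hp) b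
      rw [rfl1_apply (ψL _)]
      simp only [neg_neg]
      exact ⟨this.le, fun k => absurd k (not_le.2 this)⟩
    · have e : rfl1 p = (ξL p.2, p.2) := Prod.ext b.symm rfl
      have hx : ξL p.2 ≤ ρ := by rw [b]; exact (neg_le_abs _).trans ((norm_fst_le p).trans ((memK p).1 hp))
      rw [e, hL.ψb _ hc hx, rfl1_apply]
      simp only [neg_neg]
      exact ⟨le_rfl, fun _ => ⟨by linarith [hR.nonneg hc, hL.nonneg hc], by linarith⟩⟩
  have locM : ∀ p ∈ K, p.1 ≤ ξR p.2 → -ξL p.2 ≤ p.1 → |(h p).1| ≤ |(h p).2| := by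
    intro p hp a b
    rw [hh, glm_M hR hL ((memK p).1 hp) a b]
    rcases mid_facts hR hL ((memK p).1 hp) a b with k | ⟨k0, k1, k2, k3, k4, k5⟩
    · rw [k, mid_zero hL]; simp
    · simp only [mid]; rw [abs_mul, abs_abs]
      exact (mul_le_of_le_one_left (abs_nonneg _) (abs_le.2 ⟨by linarith, by linarith⟩))
  have injM : ∀ p ∈ K, ∀ p' ∈ K, (p.1 ≤ ξR p.2 ∧ -ξL p.2 ≤ p.1) → (p'.1 ≤ ξR p'.2 ∧ -ξL p'.2 ≤ p'.1) → h p = h p' → p = p' := by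
    intro p hp p' hp' a a' he
    rw [hh, glm_M hR hL ((memK p).1 hp) a.1 a.2, glm_M hR hL ((memK p').1 hp') a'.1 a'.2] at he
    exact mid_inj hR hL ((memK p).1 hp) a.1 a.2 ((memK p').1 hp') a'.1 a'.2 he
  have inj : InjOn h K := by
    intro p hp p' hp' he
    have AM : ∀ p ∈ K, ∀ p' ∈ K, h p = h p' → ξR p.2 ≤ p.1 → (p'.1 ≤ ξR p'.2 ∧ -ξL p'.2 ≤ p'.1) → p = p' := by
      intro p hp p' hp' he a b
      have k := locM p' hp' b.1 b.2
      rw [← he] at k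
      exact injM p hp p' hp' ((locA p hp a).2 ((le_abs_self _).trans k)) b he
    have CM : ∀ p ∈ K, ∀ p' ∈ K, h p = h p' → ξL p.2 ≤ -p.1 → (p'.1 ≤ ξR p'.2 ∧ -ξL p'.2 ≤ p'.1) → p = p' := by
      intro p hp p' hp' he a b
      have k := locM p' hp' b.1 b.2
      rw [← he] at k
      exact injM p hp p' hp' ((locC p hp a).2 ((neg_le_abs _).trans k)) b he
    have AC : ∀ p ∈ K, ∀ p' ∈ K, h p = h p' → ξR p.2 ≤ p.1 → ξL p'.2 ≤ -p'.1 → p = p' := by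
      intro p hp p' hp' he a b
      have k := (locC p' hp' b).1
      have l := (locA p hp a)
      rw [← he] at k
      have := abs_nonneg (h p).2
      have m := l.2 (by linarith [l.1])
      exact (CM p' hp' p hp he.symm b m).symm
    rcases tri p hp with a | a | a <;> rcases tri p' hp' with b | b | b
    · rw [hh, glm_R a, glm_R b] at he
      exact hR.ψi ⟨(memK p).1 hp, a⟩ ⟨(memK p').1 hp', b⟩ he
    · exact AM p hp p' hp' he a b
    · exact AC p hp p' hp' he a b
    · exact (AM p' hp' p hp he.symm b a).symm
    · exact injM p hp p' hp' a b he
    · exact (CM p' hp' p hp he.symm b a).symm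
    · exact (AC p' hp' p hp he.symm b a).symm
    · exact CM p hp p' hp' he a b
    · rw [hh, glm_L hR hL ((memK p).1 hp) a, glm_L hR hL ((memK p').1 hp') b] at he
      have := hL.ψi (x₁ := rfl1 p) (x₂ := rfl1 p') ⟨by rw [rfl1_norm]; exact (memK p).1 hp, a⟩
        ⟨by rw [rfl1_norm]; exact (memK p').1 hp', b⟩ (rfl1.injective he)
      exact rfl1.injective this
  have surj : h '' K ∈ nhds 0 := by
    obtain ⟨δ1, δ10, s1⟩ := hR.ψs
    obtain ⟨δ2, δ20, s2⟩ := hL.ψs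
    have m1 : |ρ / 2| ≤ ρ := by rw [abs_of_pos (by linarith)]; linarith
    have m1' : |-(ρ / 2)| ≤ ρ := by rw [abs_neg]; exact m1
    have a1 := (hR.sgn m1).1 (by linarith)
    have a2 := (hR.sgn m1').2 (by linarith)
    have a3 := (hL.sgn m1).1 (by linarith)
    have a4 := (hL.sgn m1').2 (by linarith)
    set δ3 := min (min (gR (ρ / 2)) (gL (ρ / 2))) (min (-gR (-(ρ / 2))) (-gL (-(ρ / 2))))
    have δ30 : 0 < δ3 := lt_min (lt_min a1 a3) (lt_min (by linarith) (by linarith))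
    have b1 : δ3 ≤ gR (ρ / 2) := (min_le_left _ _).trans (min_le_left _ _)
    have b2 : δ3 ≤ gL (ρ / 2) := (min_le_left _ _).trans (min_le_right _ _)
    have b3 : δ3 ≤ -gR (-(ρ / 2)) := (min_le_right _ _).trans (min_le_left _ _)
    have b4 : δ3 ≤ -gL (-(ρ / 2)) := (min_le_right _ _).trans (min_le_right _ _)
    have : Metric.ball (0 : 𝕍) (min δ1 (min δ2 δ3)) ∈ nhds 0 :=
      Metric.ball_mem_nhds _ (lt_min δ10 (lt_min δ20 δ30))
    refine mem_of_superset this fun P hP => ?_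
    have hP' : ‖P‖ < min δ1 (min δ2 δ3) := by simpa using hP
    by_cases q1 : |P.2| ≤ P.1
    · obtain ⟨p, p1, p2, p3⟩ := s1 P (hP'.trans_le (min_le_left _ _)) q1
      exact ⟨p, (memK p).2 p1, by rw [hh, glm_R p2, p3]⟩
    by_cases q2 : |P.2| ≤ -P.1
    · obtain ⟨p, p1, p2, p3⟩ := s2 (rfl1 P) (by rw [rfl1_norm]; exact hP'.trans_le ((min_le_right _ _).trans (min_le_left _ _))) q2
      have n : ‖rfl1 p‖ ≤ ρ := by rw [rfl1_norm]; exact p1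
      refine ⟨rfl1 p, (memK _).2 n, ?_⟩
      rw [hh, glm_L hR hL n (by simpa [rfl1_apply] using p2), rfl1_invol, p3, rfl1_invol]
    push Not at q1 q2
    have Y0 : 0 < |P.2| := by
      rcases le_total 0 P.1 with k | k <;> linarith
    set t := (P.1 / |P.2| + 1) / 2 with ht
    have f1 : P.1 / |P.2| < 1 := (div_lt_one Y0).2 q1
    have f2 : -1 < P.1 / |P.2| := by rw [lt_div_iff₀ Y0]; linarith
    have t0 : 0 ≤ t := by rw [ht]; linarith
    have t1 : t ≤ 1 := by rw [ht]; linarith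
    have P2 : |P.2| ≤ δ3 := (norm_snd_le P).trans (hP'.le.trans ((min_le_right _ _).trans (min_le_right _ _)))
    have sub : Icc (-(ρ / 2)) (ρ / 2) ⊆ {c : ℝ | |c| ≤ ρ} := fun c hc => by
      have := abs_le.2 hc; show |c| ≤ ρ; linarith
    have cg : ContinuousOn (fun c => (1 - t) * gL c + t * gR c) (Icc (-(ρ / 2)) (ρ / 2)) :=
      (continuousOn_const.mul (hL.gc.mono sub)).add (continuousOn_const.mul (hR.gc.mono sub))
    have P3 := abs_le.1 P2
    obtain ⟨c, hc, hcY⟩ := intermediate_value_Icc (by linarith) cg (show P.2 ∈ Icc _ _ from ⟨by nlinarith, by nlinarith⟩)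
    simp only at hcY
    have hc1 : |c| ≤ ρ / 2 := abs_le.2 hc
    have hcρ : |c| ≤ ρ := by linarith
    have c0 : c ≠ 0 := by
      rintro rfl
      rw [hL.g0, hR.g0] at hcY
      rw [← hcY] at Y0; simp at Y0
    have x1 := hR.ξ0 c hcρ c0
    have x2 := hL.ξ0 c hcρ c0
    have x3 := hR.ξ2 c hcρ
    have x4 := hL.ξ2 c hcρ
    set s := -ξL c + t * (ξR c + ξL c) with hs
    have s1 : -ξL c ≤ s := by rw [hs]; nlinarith
    have s2 : s ≤ ξR c := by rw [hs]; nlinarith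
    have n : ‖((s, c) : 𝕍)‖ ≤ ρ := pnorm_le (abs_le.2 ⟨by linarith, by linarith⟩) hcρ
    refine ⟨(s, c), (memK _).2 n, ?_⟩
    rw [hh, glm_M hR hL n s2 s1]
    have e1 : midt ξR ξL (s, c) = t := by
      simp only [midt, hs]
      rw [div_eq_iff (by linarith)]; ring
    have e2 : midY ξR gR ξL gL (s, c) = P.2 := by simp only [midY, e1]; exact hcY
    refine Prod.ext ?_ e2
    simp only [mid, e1, e2, ht]
    field_simp
    ring
  have h0 : h 0 = 0 := glm_zero hR
  obtain ⟨e, e1, e2, e3⟩ := GH (isCompact_closedBall _ _) cont inj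
    (by rw [interior_closedBall _ ρ0.ne']; simp [ρ0]) h0 surj
  refine ⟨e.restrOpen (Metric.ball 0 ρ) Metric.isOpen_ball, by simp [e1, ρ0], by simp [e3, h0], by simp, ?_⟩
  intro i S hS
  have hSb : ∀ p ∈ S, ‖p‖ < ρ := fun p hp => by have := hS hp; simp at this; exact this.2
  have hSK : ∀ p ∈ S, p ∈ K := fun p hp => (memK p).2 (hSb p hp).le
  have eS : (e.restrOpen (Metric.ball 0 ρ) Metric.isOpen_ball) '' S = h '' S := image_congr fun p _ => e3 p
  rw [eS]
  fin_cases i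
  · simp only [Fam2]
    have k : S ⊆ {p | ξR p.2 < p.1} ↔ h '' S ⊆ {P | |P.2| < P.1} := by
      rw [image_subset_iff]
      refine forall₂_congr fun p hp => ?_
      show ξR p.2 < p.1 ↔ |(h p).2| < (h p).1
      constructor
      · intro k; rw [hh, glm_R k.le]; exact hR.ψint p (hSb p hp).le k
      · intro k
        rcases tri p (hSK p hp) with a | a | a
        · rcases a.lt_or_eq with b | b
          · exact b
          · have := locM p (hSK p hp) b.ge (by linarith [hR.nonneg (m2 (hSK p hp)), hL.nonneg (m2 (hSK p hp))])
            linarith [le_abs_self (h p).1]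
        · have := locM p (hSK p hp) a.1 a.2
          linarith [le_abs_self (h p).1]
        · have := (locC p (hSK p hp) a).1
          linarith [abs_nonneg (h p).2]
    rw [← k]
    refine and_congr_left fun l => ?_
    rw [hR.cur S fun p hp => ⟨hSb p hp, l hp⟩]
    have : h '' S = ψR '' S := image_congr fun p hp => glm_R (le_of_lt (l hp))
    rw [this]
  · simp only [Fam2]
    have k : S ⊆ {p | ξL p.2 < -p.1} ↔ h '' S ⊆ {P | |P.2| < -P.1} := by
      rw [image_subset_iff]
      refine forall₂_congr fun p hp => ?_
      show ξL p.2 < -p.1 ↔ |(h p).2| < -(h p).1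
      constructor
      · intro k
        rw [hh, glm_L hR hL (hSb p hp).le k.le]
        have := hL.ψint (rfl1 p) (by rw [rfl1_norm]; exact (hSb p hp).le) k
        rw [rfl1_apply (ψL _)]; simpa using this
      · intro k
        rcases tri p (hSK p hp) with a | a | a
        · have := (locA p (hSK p hp) a).1
          linarith [abs_nonneg (h p).2]
        · have := locM p (hSK p hp) a.1 a.2
          linarith [neg_le_abs (h p).1]
        · rcases a.lt_or_eq with b | b
          · exact b
          · have := locM p (hSK p hp) (by linarith [hR.nonneg (m2 (hSK p hp)), hL.nonneg (m2 (hSK p hp))]) (by linarith)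
            linarith [neg_le_abs (h p).1]
    rw [← k]
    refine and_congr_left fun l => ?_
    have : rfl1 '' (h '' S) = ψL '' (rfl1 '' S) := by
      rw [image_image, image_image]
      refine image_congr fun p hp => ?_
      rw [hh, glm_L hR hL (hSb p hp).le (le_of_lt (l hp)), rfl1_invol]
    rw [this]
    refine hL.cur _ ?_
    rintro _ ⟨p, hp, rfl⟩
    rw [rfl1_norm]
    exact ⟨hSb p hp, l hp⟩

end

section
variable {r : ℝ} {D Ds Dc B : 𝕍 → ℝ}

theorem abs_mul_sub_le {a b a' b' A B' da db : ℝ} (h1 : |a - a'| ≤ da) (h2 : |b - b'| ≤ db) (h3 : |b| ≤ B')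
    (h4 : |a'| ≤ A) : |a * b - a' * b'| ≤ da * B' + A * db := by
  have : a * b - a' * b' = (a - a') * b + a' * (b - b') := by ring
  rw [this]
  refine (abs_add_le _ _).trans (add_le_add ?_ ?_)
  · rw [abs_mul]; exact mul_le_mul h1 h3 (abs_nonneg _) ((abs_nonneg _).trans h1)
  · rw [abs_mul]; exact mul_le_mul h4 h2 (abs_nonneg _) ((abs_nonneg _).trans h4)

def zH (D B : 𝕍 → ℝ) (r e q y : ℝ) : ℝ := e * q - B (imp D r q y, y)
def WH (D Ds Dc B : 𝕍 → ℝ) (r e q y : ℝ) : ℝ :=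
  Ds (imp D r q y, y) + Dc (imp D r q y, y) * zH D B r e q y
def gH (D Ds Dc B : 𝕍 → ℝ) (r e q y : ℝ) : ℝ := 2 * q * zH D B r e q y / WH D Ds Dc B r e q y

theorem NF.imp_s1 (h : NF (-1) r D Ds Dc B) {q y : ℝ} (hq : |q| ≤ r / 2) (hy : |y| ≤ r / 2) :
    0 ≤ imp D r q y ∧ imp D r q y ≤ 1 / 10 := by
  have h0 := (h.imp_spec hq hy).1
  have h1 := (norm_fst_le _).trans (h.imp_r hq hy)
  refine ⟨h0, ?_⟩
  rw [Real.norm_eq_abs, abs_of_nonneg h0] at h1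
  exact h1.trans h.r1

theorem NF.H_pt (h : NF (-1) r D Ds Dc B) {e q y : ℝ} (he : |e| = 1) (hq : |q| ≤ r / 2) (hy : |y| ≤ r / 2) :
    198 / 100 * imp D r q y ≤ Ds (imp D r q y, y) ∧ |Dc (imp D r q y, y)| ≤ 208 / 100 * imp D r q y ∧
    |zH D B r e q y| ≤ 1031 / 1000 * imp D r q y ∧ 17 / 10 * imp D r q y ≤ WH D Ds Dc B r e q y ∧
    |2 * q * zH D B r e q y| ≤ 22 / 10 * imp D r q y ^ 2 := by
  obtain ⟨s0, s1⟩ := h.imp_s1 hq hy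
  obtain ⟨i1, i2, i3⟩ := h.imp_c hq hy
  have i4 := h.imp_r hq hy
  have a1 := abs_le.1 (h.ds i4)
  have a2 := abs_le.1 (h.dc i4)
  have a3 := abs_le.1 (h.db i4)
  have y1 := abs_le.1 i1
  have eq : |e * q| = |q| := by rw [abs_mul, he, one_mul]
  have q1 := abs_le.1 (eq.le.trans i2)
  simp only at a1 a2
  have k1 : 198 / 100 * imp D r q y ≤ Ds (imp D r q y, y) := by linarith [a1.1]
  have k2 : |Dc (imp D r q y, y)| ≤ 208 / 100 * imp D r q y := by
    rw [abs_le]; constructor <;> linarith [a2.1, a2.2, y1.1, y1.2]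
  have k3 : |zH D B r e q y| ≤ 1031 / 1000 * imp D r q y := by
    rw [abs_le, zH]; constructor <;> linarith [a3.1, a3.2, q1.1, q1.2]
  refine ⟨k1, k2, k3, ?_, ?_⟩
  · have : |Dc (imp D r q y, y) * zH D B r e q y| ≤ (208 / 100 * imp D r q y) * (1031 / 1000 * (1 / 10)) := by
      rw [abs_mul]; exact mul_le_mul k2 (k3.trans (by linarith)) (abs_nonneg _) (by linarith)
    have := (abs_le.1 this).1
    rw [WH]; linarith
  · rw [abs_mul, abs_mul, abs_two]
    calc 2 * |q| * |zH D B r e q y| ≤ 2 * (102 / 100 * imp D r q y) * (1031 / 1000 * imp D r q y) := by gcongr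
      _ ≤ _ := by nlinarith [sq_nonneg (imp D r q y)]

theorem NF.imp_dp (h : NF (-1) r D Ds Dc B) {q y q' y' : ℝ} (hq : |q| ≤ r / 2) (hy : |y| ≤ r / 2)
    (hq' : |q'| ≤ r / 2) (hy' : |y'| ≤ r / 2) :
    |B (imp D r q y, y) - B (imp D r q' y', y')| ≤ 11 / 1000 * (|q - q'| + |y - y'|) ∧
    |Ds (imp D r q y, y) - Ds (imp D r q' y', y')| ≤ 23 / 10 * (|q - q'| + |y - y'|) ∧
    |Dc (imp D r q y, y) - Dc (imp D r q' y', y')| ≤ 21 / 10 * (|q - q'| + |y - y'|) := by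
  have l := h.imp_lip hq hy hq' hy'
  have m1 := h.imp_r hq hy
  have m2 := h.imp_r hq' hy'
  have d1 := abs_nonneg (q - q')
  have d2 := abs_nonneg (y - y')
  have n : ‖((imp D r q y, y) : 𝕍) - (imp D r q' y', y')‖ ≤ 11 / 10 * (|q - q'| + |y - y'|) := by
    refine pnorm_le (l.trans (by linarith)) ?_
    linarith
  have a1 := h.ls _ _ m1 m2
  have a2 := h.lc _ _ m1 m2
  have a3 := h.lb _ _ m1 m2
  have l' := abs_le.1 l
  have l2 := abs_le.1 (le_refl |y - y'|)
  simp only at a1 a2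
  rw [abs_le] at a1 a2 a3
  refine ⟨?_, ?_, ?_⟩ <;> rw [abs_le] <;> constructor <;> linarith [a1.1, a1.2, a2.1, a2.2, a3.1, a3.2, l'.1, l'.2, l2.1, l2.2]

set_option maxHeartbeats 1000000 in
theorem NF.H_lip (h : NF (-1) r D Ds Dc B) {e q y q' y' : ℝ} (he : |e| = 1) (hq : |q| ≤ r / 2) (hy : |y| ≤ r / 2)
    (hq' : |q'| ≤ r / 2) (hy' : |y'| ≤ r / 2) :
    |gH D Ds Dc B r e q y - gH D Ds Dc B r e q' y'| ≤ 5 * (|q - q'| + |y - y'|) := by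
  wlog hs : imp D r q' y' ≤ imp D r q y generalizing q y q' y'
  · rw [abs_sub_comm, abs_sub_comm q, abs_sub_comm y]
    exact this hq' hy' hq hy (le_of_not_ge hs)
  obtain ⟨s0, s1⟩ := h.imp_s1 hq hy
  obtain ⟨s0', s1'⟩ := h.imp_s1 hq' hy'
  obtain ⟨b1, b2, b3, b4, b5⟩ := h.H_pt he hq hy
  obtain ⟨c1, c2, c3, c4, c5⟩ := h.H_pt he hq' hy'
  obtain ⟨i1, i2, i3⟩ := h.imp_c hq hy
  obtain ⟨j1, j2, j3⟩ := h.imp_c hq' hy'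
  obtain ⟨d1, d2, d3⟩ := h.imp_dp hq hy hq' hy'
  have dd0 : |q - q'| ≤ |q - q'| + |y - y'| := by linarith [abs_nonneg (y - y')]
  set d := |q - q'| + |y - y'| with hd
  have d0 : 0 ≤ d := by positivity
  set s := imp D r q y
  set s' := imp D r q' y'
  rcases s0.eq_or_lt with k | sp
  · have k' : s' = 0 := le_antisymm (by linarith) s0'
    rw [← k, mul_zero] at i1 i2
    rw [k', mul_zero] at j1 j2
    rw [abs_nonpos_iff.1 i1, abs_nonpos_iff.1 i2, abs_nonpos_iff.1 j1, abs_nonpos_iff.1 j2, sub_self, abs_zero]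
    positivity
  have dz : |zH D B r e q y - zH D B r e q' y'| ≤ 11 / 10 * d := by
    have : zH D B r e q y - zH D B r e q' y' = e * (q - q') - (B (s, y) - B (s', y')) := by simp only [zH, s, s']; ring
    rw [this]
    refine (abs_sub _ _).trans ?_
    rw [abs_mul, he, one_mul]; linarith
  have dW : |WH D Ds Dc B r e q y - WH D Ds Dc B r e q' y'| ≤ 3 * d := by
    have k := abs_mul_sub_le d3 dz (b3.trans (by linarith : _ ≤ (104 / 1000 : ℝ))) (c2.trans (by linarith : _ ≤ (208 / 1000 : ℝ)))
    rw [abs_le] at k d2 ⊢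
    simp only [WH]
    constructor <;> linarith [k.1, k.2, d2.1, d2.2]
  have dN : |2 * q * zH D B r e q y - 2 * q' * zH D B r e q' y'| ≤ 44 / 10 * s * d := by
    have k := abs_mul_sub_le dd0 dz b3 j2
    have : 2 * q * zH D B r e q y - 2 * q' * zH D B r e q' y' = 2 * (q * zH D B r e q y - q' * zH D B r e q' y') := by ring
    rw [this, abs_mul, abs_two]
    have m1 : d * s' ≤ d * s := mul_le_mul_of_nonneg_left hs d0
    have m3 := mul_nonneg d0 s0
    linarith
  have g' : |gH D Ds Dc B r e q' y'| ≤ 13 / 10 * s' := by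
    rw [gH, abs_div, abs_of_nonneg ((by positivity : 0 ≤ 17 / 10 * s').trans c4)]
    rcases s0'.eq_or_lt with k | sp'
    · rw [← k] at c5 ⊢
      have : |2 * q' * zH D B r e q' y'| = 0 := le_antisymm (by simpa using c5) (abs_nonneg _)
      rw [this]; simp
    · rw [div_le_iff₀ (by linarith)]
      have m2 := mul_le_mul_of_nonneg_left c4 s0'
      linarith [sq s', sq_nonneg s']
  have W0 : 0 < WH D Ds Dc B r e q y := by linarith
  have key : gH D Ds Dc B r e q y - gH D Ds Dc B r e q' y' =
      ((2 * q * zH D B r e q y - 2 * q' * zH D B r e q' y') - gH D Ds Dc B r e q' y' * (WH D Ds Dc B r e q y - WH D Ds Dc B r e q' y'))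
        / WH D Ds Dc B r e q y := by
    have hN : gH D Ds Dc B r e q' y' * WH D Ds Dc B r e q' y' = 2 * q' * zH D B r e q' y' := by
      rcases s0'.eq_or_lt with k | sp'
      · rw [← k] at j2
        have : q' = 0 := abs_nonpos_iff.1 (by simpa using j2)
        simp [gH, this]
      · rw [gH, div_mul_cancel₀]; linarith
    rw [eq_div_iff W0.ne', sub_mul, mul_sub, hN]
    nth_rewrite 1 [gH]
    rw [div_mul_cancel₀ _ W0.ne']
    ring
  rw [key, abs_div, abs_of_pos W0, div_le_iff₀ W0]
  have t : |gH D Ds Dc B r e q' y' * (WH D Ds Dc B r e q y - WH D Ds Dc B r e q' y')| ≤ 13 / 10 * s' * (3 * d) := by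
    rw [abs_mul]; exact mul_le_mul g' dW (abs_nonneg _) (by linarith)
  have := (abs_sub (2 * q * zH D B r e q y - 2 * q' * zH D B r e q' y') (gH D Ds Dc B r e q' y' * (WH D Ds Dc B r e q y - WH D Ds Dc B r e q' y')))
  refine this.trans ((add_le_add dN t).trans ?_)
  have m1 : d * s' ≤ d * s := mul_le_mul_of_nonneg_left hs d0
  have m2 := mul_le_mul_of_nonneg_left b4 d0
  have m3 := mul_nonneg d0 s0
  linarith

theorem NF.H_lt (h : NF (-1) r D Ds Dc B) {q y : ℝ} (hq : |q| ≤ r / 2) (hy : |y| ≤ r / 2) (q0 : 0 < q) :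
    gH D Ds Dc B r (-1) q y < gH D Ds Dc B r 1 q y := by
  obtain ⟨b1, b2, b3, b4, b5⟩ := h.H_pt (e := 1) (by simp) hq hy
  obtain ⟨c1, c2, c3, c4, c5⟩ := h.H_pt (e := -1) (by simp) hq hy
  obtain ⟨i1, i2, i3⟩ := h.imp_c hq hy
  have s0 : 0 < imp D r q y := by have := abs_pos.2 q0.ne'; linarith
  have w1 : 0 < WH D Ds Dc B r 1 q y := by linarith
  have w2 : 0 < WH D Ds Dc B r (-1) q y := by linarith
  rw [gH, gH, div_lt_div_iff₀ w2 w1]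
  have : 2 * q * zH D B r 1 q y * WH D Ds Dc B r (-1) q y - 2 * q * zH D B r (-1) q y * WH D Ds Dc B r 1 q y
      = 4 * q * (q * Ds (imp D r q y, y)) := by simp only [WH, zH]; ring
  have k : 0 < 4 * q * (q * Ds (imp D r q y, y)) := by
    have : 0 < Ds (imp D r q y, y) := by linarith
    positivity
  linarith

theorem NF.D_deriv (h : NF (-1) r D Ds Dc B) {γ : ℝ → 𝕍} {v : 𝕍} {t : ℝ} (hp : ‖γ t‖ ≤ r) (hd : HasDerivAt γ v t) :
    HasDerivAt (fun t => D (γ t)) (Ds (γ t) * v.1 + Dc (γ t) * v.2) t := by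
  have := (h.hD (γ t) hp).comp_hasDerivAt t hd
  simp at this
  exact this

theorem HasDerivAt.fst' {γ : ℝ → 𝕍} {v : 𝕍} {t : ℝ} (hd : HasDerivAt γ v t) : HasDerivAt (fun t => (γ t).1) v.1 t :=
  (ContinuousLinearMap.fst ℝ ℝ ℝ).hasFDerivAt.comp_hasDerivAt t hd
theorem HasDerivAt.snd' {γ : ℝ → 𝕍} {v : 𝕍} {t : ℝ} (hd : HasDerivAt γ v t) : HasDerivAt (fun t => (γ t).2) v.2 t :=
  (ContinuousLinearMap.snd ℝ ℝ ℝ).hasFDerivAt.comp_hasDerivAt t hd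

def jH (P : 𝕍) : 𝕍 := ((P.2 - P.1) / 2 + |P.1 + P.2| / 2, (P.1 + P.2) / 2)
def jHi (P : 𝕍) : 𝕍 := (P.2 - (P.1 - |P.2|), P.2 + (P.1 - |P.2|))
theorem jH_left (P : 𝕍) : jHi (jH P) = P := by
  simp only [jH, jHi, abs_div, abs_two]; ext <;> simp <;> ring
theorem jH_right (P : 𝕍) : jH (jHi P) = P := by
  have : P.2 - (P.1 - |P.2|) + (P.2 + (P.1 - |P.2|)) = 2 * P.2 := by ring
  simp only [jH, jHi, this, abs_mul, abs_two]; ext <;> simp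
def JH (S : Set 𝕍) : Prop := ∃ S', Seg S' ∧ S = jH '' S'

theorem secH (h : NF (-1) r D Ds Dc B) : ∃ ψ, Sec JH (Curve (QH D B)) (r / 4) (bdf D r) id ψ := by
  have r0 := h.r0
  have Il : ∀ t ∈ Icc 0 (r / 3), |t| ≤ r / 2 := fun t ht => abs_le.2 ⟨by linarith [ht.1], by linarith [ht.2]⟩
  have Yl : ∀ t ∈ Icc (-(r / 3)) (r / 3), |t| ≤ r / 2 := fun t ht => abs_le.2 ⟨by linarith [ht.1], by linarith [ht.2]⟩
  have g00 : ∀ e, gH D Ds Dc B r e 0 0 = 0 := fun e => by simp [gH]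
  have z2 : |(0 : ℝ)| ≤ r / 2 := by rw [abs_zero]; linarith
  have bd : ∀ e : ℝ, |e| = 1 → ∀ t ∈ Icc 0 (r / 3), ∀ y ∈ Icc (-(r / 3)) (r / 3), |gH D Ds Dc B r e t y| ≤ 5 * r := by
    intro e he t ht y hy
    have := h.H_lip he (Il t ht) (Yl y hy) z2 z2
    rw [g00, sub_zero, sub_zero, sub_zero] at this
    linarith [Il t ht, Yl y hy]
  have lp : ∀ e : ℝ, |e| = 1 → ∀ t ∈ Icc 0 (r / 3), ∀ y ∈ Icc (-(r / 3)) (r / 3), ∀ y' ∈ Icc (-(r / 3)) (r / 3),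
      |gH D Ds Dc B r e t y - gH D Ds Dc B r e t y'| ≤ 5 * |y - y'| := by
    intro e he t ht y hy y' hy'
    have := h.H_lip he (Il t ht) (Yl y hy) (Il t ht) (Yl y' hy')
    rwa [sub_self, abs_zero, zero_add] at this
  have ct : ∀ e : ℝ, |e| = 1 → ContinuousOn (fun p : 𝕍 => gH D Ds Dc B r e p.1 p.2) (Icc 0 (r / 3) ×ˢ Icc (-(r / 3)) (r / 3)) := by
    intro e he
    refine (contOn_of_lip (C := 10) (r := r / 2) fun p p' hp hp' => ?_).mono fun p hp => pnorm_le (Il _ hp.1) (Yl _ hp.2)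
    have := h.H_lip he ((norm_fst_le p).trans hp) ((norm_snd_le p).trans hp) ((norm_fst_le p').trans hp') ((norm_snd_le p').trans hp')
    have h1 := norm_fst_le (p - p')
    have h2 := norm_snd_le (p - p')
    simp only [Prod.fst_sub, Prod.snd_sub, Real.norm_eq_abs] at h1 h2
    linarith
  have e1 : |(1 : ℝ)| = 1 := by simp
  have e2 : |(-1 : ℝ)| = 1 := by simp
  obtain ⟨GA, GB, M, net, hA, hB⟩ := Net.exists_cutoff (gA := gH D Ds Dc B r (-1)) (gB := gH D Ds Dc B r 1)
    (t1 := 0) (t2 := r / 3) (M := 5 * r) (K := 5) (Y := Icc (-(r / 3)) (r / 3)) (π := clp (-(r / 3)) (r / 3))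
    (by linarith) (clp_mem (by linarith)) (clp_lip _ _) (fun y hy => clp_of_mem hy)
    (ct _ e2) (ct _ e1) (bd _ e2) (bd _ e1) (lp _ e2) (lp _ e1)
    (fun t ht y hy => by
      rcases ht.1.eq_or_lt with k | k
      · rw [← k]; simp [gH]
      · exact (h.H_lt (Il t ht) (Yl y hy) k).le)
    (fun t ht _ y hy => h.H_lt (Il t (Ioo_subset_Icc_self ht)) (Yl y hy) ht.1) (by norm_num)
  set κ : 𝕍 → 𝕍 := fun p => (√(D p), p.2) with hκ
  set K : Set 𝕍 := {p | ‖p‖ ≤ r / 4 ∧ bdf D r p.2 ≤ p.1} with hK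
  have b2 : ∀ p : 𝕍, ‖p‖ ≤ r / 4 → |p.2| ≤ r / 4 ∧ |p.1| ≤ r / 4 ∧ |p.2| ≤ r / 2 ∧ ‖p‖ ≤ r := fun p hp =>
    ⟨(norm_snd_le p).trans hp, (norm_fst_le p).trans hp, ((norm_snd_le p).trans hp).trans (by linarith), by linarith⟩
  have x0 : ∀ p ∈ K, 0 ≤ p.1 ∧ 0 ≤ D p ∧ (bdf D r p.2 < p.1 → 0 < D p) ∧ p.1 ≤ r := by
    intro p hp
    obtain ⟨c1, c2, c3, c4⟩ := b2 p hp.1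
    have := (h.bdf_le c3).2.2.1
    have q := h.bdf_pos (s := p.1) c3 (this.trans hp.2) ((le_abs_self _).trans (by linarith))
    exact ⟨this.trans hp.2, q.2.2 hp.2, q.1.2, (le_abs_self _).trans (by linarith)⟩
  have kI : ∀ p ∈ K, √(D p) ∈ Icc 0 (r / 3) ∧ p.2 ∈ Icc (-(r / 3)) (r / 3) := by
    intro p hp
    obtain ⟨c1, c2, c3, c4⟩ := b2 p hp.1
    refine ⟨⟨Real.sqrt_nonneg _, ?_⟩, abs_le.1 (by linarith)⟩
    have := Real.sqrt_le_sqrt (h.D_le c4 (x0 p hp).2.1)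
    rw [Real.sqrt_sq (by positivity)] at this
    linarith
  have kimp : ∀ p ∈ K, imp D r (√(D p)) p.2 = p.1 := by
    intro p hp
    obtain ⟨c1, c2, c3, c4⟩ := b2 p hp.1
    obtain ⟨y1, y2, y3, y4⟩ := x0 p hp
    exact h.imp_eq y1 y4 (by linarith) (Real.sq_sqrt y2).symm
  have inj : InjOn κ K := by
    intro p hp p' hp' he
    have a1 := kimp p hp
    have a2 := kimp p' hp'
    have e1 := congrArg Prod.fst he
    have e2 := congrArg Prod.snd he
    simp only [hκ] at e1 e2
    rw [← e1, ← e2, a1] at a2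
    exact Prod.ext a2 e2
  have sym1 : ∀ P, 0 < P.1 → |(jH (net.Phi P)).2| < (jH (net.Phi P)).1 := by
    intro P hP
    have := (net.lt_time (net.Phi P) 0).1 (by rw [← net.Phi_symm_fst]; simpa using hP)
    simp only [Fld.phi_zero] at this
    simp only [jH, abs_div, abs_two]; linarith
  have jc : Continuous jH := by unfold jH; have := continuous_abs (G := ℝ); fun_prop
  have jic : Continuous jHi := by unfold jHi; have := continuous_abs (G := ℝ); fun_prop
  refine ⟨fun p => jH (net.Phi (κ p)), by linarith, h.bdf_cont.mono fun c hc => ?_, ?_, ?_, ?_, continuousOn_id, fun _ _ _ _ k => k, rfl, ?_, ?_, ?_, ?_, ?_, ?_⟩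
  · exact (show |c| ≤ r / 4 from hc).trans (by linarith)
  · intro c hc c0
    have := (h.bdf_le (hc.trans (by linarith) : |c| ≤ r / 2)).2.1
    have := abs_pos.2 c0; linarith
  · exact fun c hc => (h.bdf_le (hc.trans (by linarith) : |c| ≤ r / 2)).1
  · have := h.bdf_le (c := 0) z2
    exact le_antisymm (by simpa using this.1) this.2.2.1
  · refine jc.comp_continuousOn (net.Phi.continuous.comp_continuousOn ?_)
    exact ((h.cD.sqrt).mono fun p hp => (b2 p hp.1).2.2.2).prodMk continuousOn_snd
  · intro p hp p' hp' he
    refine inj hp hp' (net.Phi.injective ?_)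
    rw [← jH_left (net.Phi (κ p)), ← jH_left (net.Phi (κ p'))]; exact congrArg jHi he
  · intro c hc _
    have := (h.bdf_le (hc.trans (by linarith) : |c| ≤ r / 2)).2.2.2
    simp only [hκ, this, net.Phi_apply, Real.sqrt_zero, Fld.lab_zero, jH, id]
    ext <;> simp
    rw [← two_mul, abs_mul, abs_two]; ring
  · intro p hp hb
    exact sym1 _ (Real.sqrt_pos.2 ((x0 p ⟨hp, hb.le⟩).2.2.1 hb))
  · have cn : Continuous fun P => net.Phi.symm (jHi P) := net.Phi.symm.continuous.comp jic
    have c0 : net.Phi.symm (jHi 0) = 0 := by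
      rw [net.Phi.symm_apply_eq, net.Phi_apply]; simp [jHi, Fld.lab_zero]
    obtain ⟨δ, δ0, hδ⟩ := Metric.continuousAt_iff.1 (cn.continuousAt (x := 0)) (r / 8) (by linarith)
    refine ⟨δ, δ0, fun P hP hw => ?_⟩
    have k := hδ (x := P) (by simpa using hP)
    rw [c0, dist_zero_right] at k
    have q0 : 0 ≤ (net.Phi.symm (jHi P)).1 := by
      by_contra hcon
      push Not at hcon
      have := (net.time_lt (jHi P) 0).1 hcon
      simp only [Fld.phi_zero, jHi] at this
      linarith
    set w := net.Phi.symm (jHi P) with hw'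
    have w1 : |w.1| ≤ r / 8 := (norm_fst_le w).trans k.le
    have w2 : |w.2| ≤ r / 8 := (norm_snd_le w).trans k.le
    obtain ⟨i1, i2, i3⟩ := h.imp_spec (w1.trans (by linarith)) (w2.trans (by linarith) : |w.2| ≤ r / 2)
    have i4 : imp D r w.1 w.2 ≤ r / 4 := by have := max_le w1 w2; linarith
    refine ⟨(imp D r w.1 w.2, w.2), pnorm_le (by rw [abs_of_nonneg i1]; exact i4) (by linarith), ?_, ?_⟩
    · exact (h.bdf_pos (w2.trans (by linarith)) i1 (by linarith)).2.1 (by rw [i3]; positivity)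
    · simp only [hκ, i3, Real.sqrt_sq q0]
      show jH (net.Phi w) = P
      rw [hw', net.Phi.apply_symm_apply, jH_right]
  · intro S hS
    set R : Set 𝕍 := {p | ‖p‖ < r / 4 ∧ bdf D r p.2 < p.1} with hR
    have RK : ∀ p ∈ R, p ∈ K := fun p hp => ⟨hp.1.le, hp.2.le⟩
    have RD : ∀ p ∈ R, 0 < D p := fun p hp => (x0 p (RK p hp)).2.2.1 hp.2
    have Rr : ∀ p ∈ R, ‖p‖ ≤ r := fun p hp => by have := hp.1; linarith
    have Wp : ∀ e : ℝ, |e| = 1 → ∀ p ∈ R, 0 < WH D Ds Dc B r e (√(D p)) p.2 := by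
      intro e he p hp
      have kk := kI p (RK p hp)
      have := (h.H_pt he (Il _ kk.1) (Yl _ kk.2)).2.2.2.1
      obtain ⟨i1, i2, i3⟩ := h.imp_c (Il _ kk.1) (Yl _ kk.2)
      have q0 := Real.sqrt_pos.2 (RD p hp)
      rw [abs_of_pos q0] at i2
      linarith
    have hl : Curve (QH D B) S ↔ Seg ((fun p => net.Phi (κ p)) '' S) := by
      refine leaf net (R := R) (inj.mono RK) ⟨r / 3, fun p hp => ?_⟩ ?_ ?_ hS
      · have := (kI p (RK p hp)).1
        exact abs_le.2 ⟨by linarith [this.1], this.2⟩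
      · intro γ dγ a b ⟨hc, hγ⟩ hm
        have cγ : ContinuousOn γ (Ioo a b) := fun t ht => (hγ t ht).1.continuousAt.continuousWithinAt
        obtain ⟨s1, s2⟩ := sgn_lemma isPreconnected_Ioo (w1 := fun t => (dγ t).1) (w2 := fun t => (dγ t).2)
          (β := fun t => B (γ t)) (δ := fun t => D (γ t)) (by fun_prop) (by fun_prop)
          (h.cB.comp cγ fun t ht => Rr _ (hm t ht)) (h.cD.comp cγ fun t ht => Rr _ (hm t ht))
          (fun t ht => (hγ t ht).2.2) (fun t ht => RD _ (hm t ht)) (fun t ht => by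
            have := (hγ t ht).2.1
            by_contra hcon; push Not at hcon; exact this (Prod.ext hcon.1 hcon.2))
        have key : ∀ e : ℝ, |e| = 1 → (∀ t ∈ Ioo a b, (dγ t).2 = (e * √(D (γ t)) - B (γ t)) * (dγ t).1) → ∀ t ∈ Ioo a b,
            let τ := (Ds (γ t) * (dγ t).1 + Dc (γ t) * (dγ t).2) / (2 * √(D (γ t)))
            HasDerivAt (fun t => (κ (γ t)).1) τ t ∧ τ ≠ 0 ∧
              HasDerivAt (fun t => (κ (γ t)).2) (gH D Ds Dc B r e (κ (γ t)).1 (κ (γ t)).2 * τ) t := by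
          intro e he k t ht τ
          have pm := hm t ht
          have W0 := Wp e he _ pm
          have q0 := Real.sqrt_pos.2 (RD _ pm)
          have ez : zH D B r e (√(D (γ t))) (γ t).2 = e * √(D (γ t)) - B (γ t) := by
            simp only [zH, kimp _ (RK _ pm)]
          have eW : WH D Ds Dc B r e (√(D (γ t))) (γ t).2 = Ds (γ t) + Dc (γ t) * (e * √(D (γ t)) - B (γ t)) := by
            simp only [WH, ez, kimp _ (RK _ pm)]
          have eτ : τ = WH D Ds Dc B r e (√(D (γ t))) (γ t).2 * (dγ t).1 / (2 * √(D (γ t))) := by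
            simp only [τ, eW, k t ht]; ring
          refine ⟨(h.D_deriv (Rr _ pm) (hγ t ht).1).sqrt (RD _ pm).ne', ?_, ?_⟩
          · rw [eτ]; have := s1 t ht; positivity
          · have := (hγ t ht).1.snd'
            convert this using 1
            rw [eτ, k t ht, gH, ← ez]
            simp only [hκ]
            field_simp
        refine ⟨fun t => (Ds (γ t) * (dγ t).1 + Dc (γ t) * (dγ t).2) / (2 * √(D (γ t))), ?_, ?_⟩
        · rcases s2 with k | k
          · exact fun t ht => have l := key (-1) e2 (fun t ht => by rw [k t ht]; ring) t ht; ⟨l.1, l.2.1⟩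
          · exact fun t ht => have l := key 1 e1 (fun t ht => by rw [k t ht]; ring) t ht; ⟨l.1, l.2.1⟩
        · refine s2.imp (fun k t ht => ?_) (fun k t ht => ?_)
          · rw [hA _ (kI _ (RK _ (hm t ht))).1 _ (kI _ (RK _ (hm t ht))).2]
            exact (key (-1) e2 (fun t ht => by rw [k t ht]; ring) t ht).2.2
          · rw [hB _ (kI _ (RK _ (hm t ht))).1 _ (kI _ (RK _ (hm t ht))).2]
            exact (key 1 e1 (fun t ht => by rw [k t ht]; ring) t ht).2.2
      · intro Y a b hY hm
        have pt : ∀ t ∈ Ioo a b, 0 < t ∧ t ∈ Icc 0 (r / 3) ∧ Y t ∈ Icc (-(r / 3)) (r / 3) ∧ (imp D r t (Y t), Y t) ∈ R ∧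
            √(D (imp D r t (Y t), Y t)) = t ∧ D (imp D r t (Y t), Y t) = t ^ 2 := by
          intro t ht
          obtain ⟨p, hp, he⟩ := hm t ht
          have e1 : √(D p) = t := congrArg Prod.fst he
          have e2 : p.2 = Y t := congrArg Prod.snd he
          have k := kimp p (RK p hp)
          have k2 := kI p (RK p hp)
          have k3 := Real.sqrt_pos.2 (RD p hp)
          have k4 := Real.sq_sqrt (RD p hp).le
          rw [e1, e2] at k k2
          rw [e1] at k3 k4
          have ep : (imp D r t (Y t), Y t) = p := Prod.ext k e2.symm
          rw [ep]
          exact ⟨k3, k2.1, k2.2, hp, e1, k4.symm⟩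
        have cY : ContinuousOn Y (Ioo a b) := by
          rcases hY with k | k <;> exact fun t ht => (k t ht).continuousAt.continuousWithinAt
        have main : ∀ e : ℝ, |e| = 1 → (∀ t ∈ Ioo a b, HasDerivAt Y (gH D Ds Dc B r e t (Y t)) t) →
            ∃ γ dγ, CurveOn (QH D B) γ dγ a b ∧ ∀ t ∈ Ioo a b, γ t ∈ R ∧ κ (γ t) = (t, Y t) := by
          intro e he hY
          have cp : ContinuousOn (fun t => ((imp D r t (Y t), Y t) : 𝕍)) (Ioo a b) :=
            (h.imp_contOn.comp (continuousOn_id.prodMk cY) fun t ht =>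
              pnorm_le (Il _ (pt t ht).2.1) (Yl _ (pt t ht).2.2.1)).prodMk cY
          have mr : MapsTo (fun t => ((imp D r t (Y t), Y t) : 𝕍)) (Ioo a b) {p | ‖p‖ ≤ r} := fun t ht => Rr _ (pt t ht).2.2.2.1
          have cz : ContinuousOn (fun t => zH D B r e t (Y t)) (Ioo a b) :=
            (continuousOn_const.mul continuousOn_id).sub (h.cB.comp cp mr)
          have cW : ContinuousOn (fun t => WH D Ds Dc B r e t (Y t)) (Ioo a b) :=
            (h.cDs.comp cp mr).add ((h.cDc.comp cp mr).mul cz)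
          have W0 : ∀ t ∈ Ioo a b, 0 < WH D Ds Dc B r e t (Y t) := fun t ht => by
            have := Wp e he _ (pt t ht).2.2.2.1
            rwa [(pt t ht).2.2.2.2.1] at this
          have cq : ContinuousOn (fun t => 2 * t / WH D Ds Dc B r e t (Y t)) (Ioo a b) :=
            (continuousOn_const.mul continuousOn_id).div cW fun t ht => (W0 t ht).ne'
          refine ⟨fun t => (imp D r t (Y t), Y t), fun t => (2 * t / WH D Ds Dc B r e t (Y t), 2 * t / WH D Ds Dc B r e t (Y t) * zH D B r e t (Y t)),
            ⟨cq.prodMk (cq.mul cz), fun t ht => ?_⟩, fun t ht => ⟨(pt t ht).2.2.2.1, by simp only [hκ, (pt t ht).2.2.2.2.1]⟩⟩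
          obtain ⟨t0, t1, t2, t3, t4, t5⟩ := pt t ht
          have W0 := W0 t ht
          have tl : |t| < r / 2 := by have := t1.2; rw [abs_of_pos t0]; linarith
          have yl : |Y t| < r / 2 := abs_lt.2 ⟨by linarith [t2.1], by linarith [t2.2]⟩
          have s0 : 0 < imp D r t (Y t) := by
            have := (h.imp_c tl.le yl.le).2.1
            rw [abs_of_pos t0] at this; linarith
          have D0 : 0 < Ds (imp D r t (Y t), Y t) := by have := (h.H_pt he tl.le yl.le).1; linarith
          refine ⟨?_, ?_, ?_⟩
          · have d2 := hY t ht
            have d1 := h.imp_deriv (q := fun t => t) (c := Y) tl yl (hasDerivAt_id t) d2 D0.ne'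
            convert d1.prodMk d2 using 2
            · rw [div_eq_div_iff W0.ne' D0.ne', gH]
              have : WH D Ds Dc B r e t (Y t) = Ds (imp D r t (Y t), Y t) + Dc (imp D r t (Y t), Y t) * zH D B r e t (Y t) := rfl
              field_simp
              linear_combination (-1) * this
            · rw [gH]; ring
          · intro k
            have := congrArg Prod.fst k
            have h2 : 0 < 2 * t / WH D Ds Dc B r e t (Y t) := by positivity
            exact h2.ne' this
          · have ee : e ^ 2 = 1 := by rw [← sq_abs, he]; norm_num
            simp only [QH, t5, zH]
            linear_combination (2 * t / WH D Ds Dc B r e t (Y t)) ^ 2 * t ^ 2 * ee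
        rcases hY with k | k
        · exact main (-1) e2 fun t ht => by rw [← hA t (pt t ht).2.1 _ (pt t ht).2.2.1]; exact k t ht
        · exact main 1 e1 fun t ht => by rw [← hB t (pt t ht).2.1 _ (pt t ht).2.2.1]; exact k t ht
    rw [hl]
    have ei : (fun p => jH (net.Phi (κ p))) '' S = jH '' ((fun p => net.Phi (κ p)) '' S) := by rw [image_image]
    rw [ei]
    constructor
    · exact fun k => ⟨_, k, rfl⟩
    · rintro ⟨S', k1, k2⟩
      have : Function.Injective jH := Function.LeftInverse.injective jH_left
      rwa [this.image_injective k2]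
end

theorem abel (P : ℝ ≃o ℝ) (hP : ∀ u, u < P u) : ∃ E : ℝ ≃o ℝ, ∀ u, E (P u) = E u + Real.log 2 := by
  set a : ℤ → ℝ := fun n => (P ^ n) 0 with ha
  have P0 : 0 < P 0 := hP 0
  have zs : ∀ (n : ℤ) (u : ℝ), (P ^ (n + 1)) u = (P ^ n) (P u) := fun n u => by rw [zpow_add_one]; rfl
  have zs' : ∀ (n : ℤ) (u : ℝ), (P ^ (n + 1)) u = P ((P ^ n) u) := fun n u => by rw [add_comm, zpow_one_add]; rfl
  have am : StrictMono a := strictMono_int_of_lt_succ fun n => by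
    simp only [ha, zs]; exact (P ^ n).lt_iff_lt.2 P0
  have nofix : ∀ L, P L ≠ L := fun L => (hP L).ne'
  have ub : ∀ u, ∃ n, u < a n := by
    intro u
    by_contra hcon; push Not at hcon
    have hb : BddAbove (range a) := ⟨u, by rintro _ ⟨n, rfl⟩; exact hcon n⟩
    refine nofix (sSup (range a)) (le_antisymm ?_ (hP _).le)
    change P (sSup (range a)) ≤ _
    rw [← P.le_symm_apply]
    refine csSup_le (range_nonempty a) ?_
    rintro _ ⟨n, rfl⟩
    rw [P.le_symm_apply]
    refine le_csSup hb ⟨n + 1, zs' n 0⟩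
  have lb : ∀ u, ∃ n, a n ≤ u := by
    intro u
    by_contra hcon; push Not at hcon
    have hb : BddBelow (range a) := ⟨u, by rintro _ ⟨n, rfl⟩; exact (hcon n).le⟩
    refine absurd (hP (sInf (range a))) (not_lt.2 ?_)
    refine le_csInf (range_nonempty a) ?_
    rintro _ ⟨n, rfl⟩
    have k : sInf (range a) ≤ a (n - 1) := csInf_le hb ⟨_, rfl⟩
    have := P.le_iff_le.2 k
    have e := zs' (n - 1) 0
    rw [sub_add_cancel] at e
    simp only [ha, e]; exact this
  have ex : ∀ u, ∃ n : ℤ, ∃ w : ℝ, 0 ≤ w ∧ w < P 0 ∧ u = (P ^ n) w := by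
    intro u
    obtain ⟨m, hm⟩ := ub u
    obtain ⟨l, hl⟩ := lb u
    obtain ⟨n, hn, hmax⟩ := Int.exists_greatest_of_bdd (P := fun n => a n ≤ u)
      ⟨m, fun z hz => (am.lt_iff_lt.1 (hz.trans_lt hm)).le⟩ ⟨l, hl⟩
    refine ⟨n, (P ^ n).symm u, ?_, ?_, by simp⟩
    · rw [(P ^ n).le_symm_apply]; exact hn
    · rw [(P ^ n).symm_apply_lt, ← zs]
      by_contra hc; push Not at hc
      have := hmax (n + 1) hc; omega
  choose n w w0 w1 hw using ex
  have lt_of : ∀ (k m : ℤ) (x y : ℝ), 0 ≤ y → x < P 0 → k < m → (P ^ k) x < (P ^ m) y := by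
    intro k m x y hy hx hkm
    calc (P ^ k) x < (P ^ k) (P 0) := (P ^ k).lt_iff_lt.2 hx
      _ = a (k + 1) := (zs k 0).symm
      _ ≤ a m := am.le_iff_le.2 (by omega)
      _ ≤ _ := (P ^ m).le_iff_le.2 hy
  have uq : ∀ (k : ℤ) (x : ℝ), 0 ≤ x → x < P 0 → n ((P ^ k) x) = k ∧ w ((P ^ k) x) = x := by
    intro k x hx hx'
    have e := hw ((P ^ k) x)
    have hn : n ((P ^ k) x) = k := by
      rcases lt_trichotomy (n ((P ^ k) x)) k with l | l | l
      · have := lt_of _ _ _ _ hx (w1 ((P ^ k) x)) l; rw [← e] at this; exact (lt_irrefl _ this).elim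
      · exact l
      · have := lt_of _ _ _ _ (w0 ((P ^ k) x)) hx' l; rw [← e] at this; exact (lt_irrefl _ this).elim
    refine ⟨hn, ?_⟩
    rw [hn] at e
    exact ((P ^ k).injective e).symm
  set E0 : ℝ → ℝ := fun u => Real.log 2 * (n u + w u / P 0) with hE
  have l2 : 0 < Real.log 2 := Real.log_pos (by norm_num)
  have sm : StrictMono E0 := by
    intro u v huv
    refine mul_lt_mul_of_pos_left ?_ l2
    have f0 : w u / P 0 < 1 := (div_lt_one P0).2 (w1 u)
    have f1 : 0 ≤ w v / P 0 := div_nonneg (w0 v) P0.le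
    rcases lt_trichotomy (n u) (n v) with l | l | l
    · have : (n u : ℝ) + 1 ≤ n v := by exact_mod_cast l
      linarith
    · rw [hw u, hw v, l, (P ^ n v).lt_iff_lt] at huv
      rw [l]
      have : w u / P 0 < w v / P 0 := by gcongr
      linarith
    · have := lt_of _ _ _ _ (w0 u) (w1 v) l
      rw [← hw, ← hw] at this
      exact absurd huv this.not_gt
  have sj : Function.Surjective E0 := by
    intro y
    obtain ⟨q1, q2⟩ := uq ⌊y / Real.log 2⌋ (Int.fract (y / Real.log 2) * P 0) (mul_nonneg (Int.fract_nonneg _) P0.le)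
      (mul_lt_of_lt_one_left P0 (Int.fract_lt_one _))
    refine ⟨(P ^ ⌊y / Real.log 2⌋) (Int.fract (y / Real.log 2) * P 0), ?_⟩
    · simp only [hE]
      rw [q1, q2, mul_div_cancel_right₀ _ P0.ne', Int.floor_add_fract, mul_div_cancel₀ _ l2.ne']
  refine ⟨sm.orderIsoOfSurjective _ sj, fun u => ?_⟩
  simp only [StrictMono.coe_orderIsoOfSurjective, hE]
  have e : P u = (P ^ (n u + 1)) (w u) := by rw [zs', ← hw]
  obtain ⟨q1, q2⟩ := uq (n u + 1) (w u) (w0 u) (w1 u)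
  rw [e, q1, q2]; push_cast; ring

theorem seg_F {F : ℝ → ℝ} (hF : Topology.IsOpenEmbedding F) (hm : StrictMono F) (T : Set 𝕍) :
    Seg T ↔ Seg ((fun p : 𝕍 => (F p.1, F p.2)) '' T) := by
  have pre : ∀ J, IsOpen J → IsPreconnected J → IsOpen (F ⁻¹' J) ∧ IsPreconnected (F ⁻¹' J) := fun J h1 h2 =>
    ⟨h1.preimage hF.continuous, (h2.ordConnected.preimage_mono hm.monotone).isPreconnected⟩
  have img : ∀ J, IsOpen J → IsPreconnected J → IsOpen (F '' J) ∧ IsPreconnected (F '' J) := fun J h1 h2 =>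
    ⟨hF.isOpenMap _ h1, h2.image _ hF.continuous.continuousOn⟩
  constructor
  · rintro (⟨u, J, h1, h2, rfl⟩ | ⟨v, J, h1, h2, rfl⟩)
    · exact Or.inl ⟨F u, F '' J, (img J h1 h2).1, (img J h1 h2).2, by rw [image_image, image_image]⟩
    · exact Or.inr ⟨F v, F '' J, (img J h1 h2).1, (img J h1 h2).2, by rw [image_image, image_image]⟩
  · intro h
    rcases T.eq_empty_or_nonempty with rfl | ⟨⟨u0, v0⟩, h0⟩
    · exact Or.inl ⟨0, ∅, isOpen_empty, isPreconnected_empty, by simp⟩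
    have m0 : (F u0, F v0) ∈ (fun p : 𝕍 => (F p.1, F p.2)) '' T := ⟨_, h0, rfl⟩
    have iff : ∀ p : 𝕍, p ∈ T ↔ (F p.1, F p.2) ∈ (fun p : 𝕍 => (F p.1, F p.2)) '' T := by
      intro p
      refine ⟨fun k => ⟨p, k, rfl⟩, ?_⟩
      rintro ⟨q, hq, e⟩
      have e1 := hm.injective (congrArg Prod.fst e)
      have e2 := hm.injective (congrArg Prod.snd e)
      have : q = p := Prod.ext e1 e2
      rwa [← this]
    rcases h with ⟨u, J, h1, h2, hs⟩ | ⟨v, J, h1, h2, hs⟩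
    · refine Or.inl ⟨u0, F ⁻¹' J, (pre J h1 h2).1, (pre J h1 h2).2, ?_⟩
      rw [hs] at m0
      obtain ⟨j, hj, e⟩ := m0
      have eu : u = F u0 := congrArg Prod.fst e
      ext p
      rw [iff p, hs]
      constructor
      · rintro ⟨j, hj, e⟩
        have e1 : u = F p.1 := congrArg Prod.fst e
        have e2 : j = F p.2 := congrArg Prod.snd e
        refine ⟨p.2, show F p.2 ∈ J from e2 ▸ hj, Prod.ext (hm.injective ?_) rfl⟩
        exact eu.symm.trans e1
      · rintro ⟨j, hj, e⟩
        exact ⟨F j, hj, by rw [← e, eu]⟩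
    · refine Or.inr ⟨v0, F ⁻¹' J, (pre J h1 h2).1, (pre J h1 h2).2, ?_⟩
      rw [hs] at m0
      obtain ⟨j, hj, e⟩ := m0
      have eu : v = F v0 := congrArg Prod.snd e
      ext p
      rw [iff p, hs]
      constructor
      · rintro ⟨j, hj, e⟩
        have e1 : v = F p.2 := congrArg Prod.snd e
        have e2 : j = F p.1 := congrArg Prod.fst e
        refine ⟨p.1, show F p.1 ∈ J from e2 ▸ hj, Prod.ext rfl (hm.injective ?_)⟩
        exact eu.symm.trans e1
      · rintro ⟨j, hj, e⟩
        exact ⟨F j, hj, by rw [← e, eu]⟩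

theorem netF {GA GB M K} (net : Net GA GB M K) : ∃ F : ℝ → ℝ, Topology.IsOpenEmbedding F ∧ StrictMono F ∧
    (∀ u, 0 < F u) ∧ (∀ y, 0 < y → ∃ u, F u = y) ∧ ∀ u, F (net.A.lab 2 (net.B.phi 2 u)) = 2 * F u := by
  have sm : StrictMono fun u => net.A.lab 2 (net.B.phi 2 u) := fun u v k => net.A.lab_mono 2 (net.B.phi_mono 2 k)
  have sj : Function.Surjective fun u => net.A.lab 2 (net.B.phi 2 u) := fun v =>
    ⟨net.B.lab 2 (net.A.phi 2 v), by simp only [Fld.phi_lab, Fld.lab_phi]⟩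
  obtain ⟨E, hE⟩ := abel (sm.orderIsoOfSurjective _ sj) fun u => by
    simp only [StrictMono.coe_orderIsoOfSurjective]
    have := net.cmp (net.A.phi_deriv u) (net.B.phi_deriv u) (t1 := 0) (t2 := 2) (by simp [Fld.phi_zero]) (by norm_num)
    have := net.A.lab_mono 2 this
    rwa [Fld.lab_phi] at this
  refine ⟨fun u => Real.exp (E u), Real.isOpenEmbedding_exp.comp E.toHomeomorph.isOpenEmbedding,
    fun u v k => Real.exp_lt_exp.2 (E.lt_iff_lt.2 k), fun u => Real.exp_pos _,
    fun y hy => ⟨E.symm (Real.log y), by simp [Real.exp_log hy]⟩, fun u => ?_⟩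
  have := hE u
  simp only [StrictMono.coe_orderIsoOfSurjective] at this
  show Real.exp (E _) = 2 * Real.exp (E u)
  rw [this, Real.exp_add, Real.exp_log (by norm_num)]; ring

section
variable {r : ℝ} {D Ds Dc B : 𝕍 → ℝ}

def cV (t l : ℝ) : ℝ := Real.exp l * (t - 1)
def qV (t l : ℝ) : ℝ := Real.exp l * √(1 - (t - 1) ^ 2)
def NV (D Ds Dc B : 𝕍 → ℝ) (r e q c : ℝ) : ℝ :=
  2 * c + Dc (imp D r q c, c) + Ds (imp D r q c, c) * zH D B r e q c
def zV (D Ds Dc B : 𝕍 → ℝ) (r e t l : ℝ) : ℝ := NV D Ds Dc B r e (qV t l) (cV t l) / Real.exp l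
def gV (D Ds Dc B : 𝕍 → ℝ) (r e t l : ℝ) : ℝ := zV D Ds Dc B r e t l / (2 - (t - 1) * zV D Ds Dc B r e t l)

theorem tV {t : ℝ} (ht : t ∈ Icc (0:ℝ) 2) : |t - 1| ≤ 1 ∧ (t - 1) ^ 2 ≤ 1 ∧ √(1 - (t - 1) ^ 2) ≤ 1 := by
  have a : |t - 1| ≤ 1 := abs_le.2 ⟨by linarith [ht.1], by linarith [ht.2]⟩
  have b : (t - 1) ^ 2 ≤ 1 := by nlinarith [ht.1, ht.2]
  exact ⟨a, b, Real.sqrt_le_one.2 (by nlinarith [sq_nonneg (t - 1)])⟩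

theorem qcV {t l : ℝ} (ht : t ∈ Icc (0:ℝ) 2) : 0 ≤ qV t l ∧ qV t l ≤ Real.exp l ∧ |cV t l| ≤ Real.exp l ∧
    qV t l ^ 2 + cV t l ^ 2 = Real.exp l ^ 2 := by
  obtain ⟨a, b, c⟩ := tV ht
  have e := Real.exp_pos l
  refine ⟨mul_nonneg e.le (Real.sqrt_nonneg _), mul_le_of_le_one_right e.le c, ?_, ?_⟩
  · rw [cV, abs_mul, abs_of_pos e]; exact mul_le_of_le_one_right e.le a
  · rw [qV, cV, mul_pow, mul_pow, Real.sq_sqrt (by linarith)]; ring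

theorem NF.rho (h : NF (-1) r D Ds Dc B) {p : 𝕍} (hp : ‖p‖ ≤ r) (hD : 0 ≤ D p) (h0 : 0 ≤ p.1) {ρ : ℝ} (hρ : 0 ≤ ρ)
    (e : p.2 ^ 2 + D p = ρ ^ 2) : 98 / 100 * p.1 ≤ ρ ∧ ρ ≤ 102 / 100 * p.1 := by
  have a := abs_le.1 (h.E0 hp)
  have b := h.cone_norm hp hD
  rw [abs_of_nonneg h0] at b
  have c : ‖p‖ ^ 2 ≤ (103 / 100 * p.1) ^ 2 := pow_le_pow_left₀ (norm_nonneg _) b 2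
  constructor
  · refine abs_le_of_sq_le_sq' ?_ hρ |>.2
    nlinarith [a.1, a.2, sq_nonneg p.1]
  · refine abs_le_of_sq_le_sq' ?_ (by positivity) |>.2
    nlinarith [a.1, a.2, sq_nonneg p.1]

theorem NF.V_bd (h : NF (-1) r D Ds Dc B) {l : ℝ} (hl : Real.exp l ≤ r / 3) {t : ℝ} (ht : t ∈ Icc (0:ℝ) 2) :
    |qV t l| ≤ r / 2 ∧ |cV t l| ≤ r / 2 ∧ imp D r (qV t l) (cV t l) ≤ Real.exp l * (100 / 98) ∧
    0 < imp D r (qV t l) (cV t l) := by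
  obtain ⟨a1, a2, a3, a4⟩ := qcV (l := l) ht
  have r0 := h.r0
  have q2 : |qV t l| ≤ r / 2 := by rw [abs_of_nonneg a1]; linarith
  have c2 : |cV t l| ≤ r / 2 := by linarith
  have s := h.imp_spec q2 c2
  have e0 := Real.exp_pos l
  have := h.rho (h.imp_r q2 c2) (by rw [s.2.2]; positivity) s.1 e0.le (by rw [s.2.2]; linarith)
  simp only at this
  exact ⟨q2, c2, by linarith, by linarith⟩

theorem NF.V_z (h : NF (-1) r D Ds Dc B) {e : ℝ} (he : |e| = 1) {l : ℝ} (hl : Real.exp l ≤ r / 3) {t : ℝ} (ht : t ∈ Icc (0:ℝ) 2) :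
    |zV D Ds Dc B r e t l| ≤ 23 / 100 ∧ |(t - 1) * zV D Ds Dc B r e t l| ≤ 23 / 100 := by
  obtain ⟨q2, c2, b1, b2⟩ := h.V_bd hl ht
  obtain ⟨k1, k2, k3, -, -⟩ := h.H_pt he q2 c2
  obtain ⟨s0, s1⟩ := h.imp_s1 q2 c2
  have m := h.imp_r q2 c2
  obtain ⟨-, -, i3⟩ := h.imp_c q2 c2
  have d1 := abs_le.1 (h.ds m)
  have d2 := abs_le.1 (h.dc m)
  simp only at d1 d2
  set s := imp D r (qV t l) (cV t l)
  have e0 := Real.exp_pos l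
  have k4 : |Ds (s, cV t l)| ≤ 202 / 100 * s := abs_le.2 ⟨by linarith, by linarith [d1.2]⟩
  have k5 : |Ds (s, cV t l) * zH D B r e (qV t l) (cV t l)| ≤ 202 / 100 * s * (1031 / 10000) := by
    rw [abs_mul]; exact mul_le_mul k4 (k3.trans (by linarith)) (abs_nonneg _) (by positivity)
  have k5 := abs_le.1 k5
  have kN : |NV D Ds Dc B r e (qV t l) (cV t l)| ≤ 22 / 100 * s := by
    rw [abs_le, NV]; constructor <;> linarith [d2.1, d2.2, k5.1, k5.2]
  have a : |zV D Ds Dc B r e t l| ≤ 23 / 100 := by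
    rw [zV, abs_div, abs_of_pos e0, div_le_iff₀ e0]; linarith
  refine ⟨a, ?_⟩
  rw [abs_mul]
  have := mul_le_mul (tV ht).1 a (abs_nonneg _) zero_le_one
  linarith

theorem fracV {w z z' : ℝ} (h1 : |w * z| ≤ 23 / 100) (h2 : |w * z'| ≤ 23 / 100) :
    |z / (2 - w * z) - z' / (2 - w * z')| ≤ |z - z'| := by
  have h1 := (abs_le.1 h1).2
  have h2 := (abs_le.1 h2).2
  have p1 : 0 < 2 - w * z := by linarith
  have p2 : 0 < 2 - w * z' := by linarith
  have : z / (2 - w * z) - z' / (2 - w * z') = 2 * (z - z') / ((2 - w * z) * (2 - w * z')) := by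
    rw [div_sub_div _ _ p1.ne' p2.ne']; congr 1; ring
  rw [this, abs_div, abs_mul, abs_two, abs_of_pos (mul_pos p1 p2), div_le_iff₀ (mul_pos p1 p2)]
  have k : 2 ≤ (2 - w * z) * (2 - w * z') := by nlinarith
  have := mul_le_mul_of_nonneg_left k (abs_nonneg (z - z'))
  linarith

theorem NF.V_lip (h : NF (-1) r D Ds Dc B) {e : ℝ} (he : |e| = 1) {t : ℝ} (ht : t ∈ Icc (0:ℝ) 2) {l l' : ℝ}
    (hl : Real.exp l ≤ r / 3) (hl' : Real.exp l' ≤ r / 3) :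
    |gV D Ds Dc B r e t l - gV D Ds Dc B r e t l'| ≤ 11 * |l - l'| := by
  wlog hle : l' ≤ l generalizing l l'
  · rw [abs_sub_comm, abs_sub_comm l]; exact this hl' hl (le_of_not_ge hle)
  obtain ⟨q2, c2, b1, b2⟩ := h.V_bd hl ht
  obtain ⟨q2', c2', b1', b2'⟩ := h.V_bd hl' ht
  obtain ⟨d1, d2, d3⟩ := h.imp_dp q2 c2 q2' c2'
  obtain ⟨k1, k2, k3, -, -⟩ := h.H_pt he q2 c2
  obtain ⟨s0, s1⟩ := h.imp_s1 q2 c2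
  obtain ⟨s0', s1'⟩ := h.imp_s1 q2' c2'
  obtain ⟨-, -, i3⟩ := h.imp_c q2' c2'
  have D1 := abs_le.1 (h.ds (h.imp_r q2' c2'))
  simp only at D1
  obtain ⟨z1, z2⟩ := h.V_z he hl ht
  obtain ⟨z1', z2'⟩ := h.V_z he hl' ht
  have e0 := Real.exp_pos l
  have e0' := Real.exp_pos l'
  have ll : |l - l'| = l - l' := abs_of_nonneg (by linarith)
  have hx : Real.exp l - Real.exp l' ≤ Real.exp l * (l - l') := by
    have := mul_le_mul_of_nonneg_left (Real.add_one_le_exp (l' - l)) e0.le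
    rw [← Real.exp_add, add_sub_cancel] at this
    linarith
  have hx0 : 0 ≤ Real.exp l - Real.exp l' := by linarith [Real.exp_le_exp.2 hle]
  obtain ⟨t1, t2, t3⟩ := tV ht
  have dc : |cV t l - cV t l'| ≤ Real.exp l - Real.exp l' := by
    have : cV t l - cV t l' = (Real.exp l - Real.exp l') * (t - 1) := by simp only [cV]; ring
    rw [this, abs_mul, abs_of_nonneg hx0]; exact mul_le_of_le_one_right hx0 t1
  have dq : |qV t l - qV t l'| ≤ Real.exp l - Real.exp l' := by
    have : qV t l - qV t l' = (Real.exp l - Real.exp l') * √(1 - (t - 1) ^ 2) := by simp only [qV]; ring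
    rw [this, abs_mul, abs_of_nonneg hx0, abs_of_nonneg (Real.sqrt_nonneg _)]; exact mul_le_of_le_one_right hx0 t3
  set x := Real.exp l - Real.exp l' with hxd
  have dd : |qV t l - qV t l'| + |cV t l - cV t l'| ≤ 2 * x := by linarith
  set d := |qV t l - qV t l'| + |cV t l - cV t l'|
  have dz : |zH D B r e (qV t l) (cV t l) - zH D B r e (qV t l') (cV t l')| ≤ 11 / 10 * (2 * x) := by
    have : zH D B r e (qV t l) (cV t l) - zH D B r e (qV t l') (cV t l') = e * (qV t l - qV t l') -
      (B (imp D r (qV t l) (cV t l), cV t l) - B (imp D r (qV t l') (cV t l'), cV t l')) := by simp only [zH]; ring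
    rw [this]
    refine (abs_sub _ _).trans ?_
    rw [abs_mul, he, one_mul]; linarith
  have k4 : |Ds (imp D r (qV t l') (cV t l'), cV t l')| ≤ 21 / 100 := abs_le.2 ⟨by linarith, by linarith [D1.2]⟩
  have dp := abs_mul_sub_le d2 dz (k3.trans (by linarith : _ ≤ (1031 / 10000 : ℝ))) k4
  have dN : |NV D Ds Dc B r e (qV t l) (cV t l) - NV D Ds Dc B r e (qV t l') (cV t l')| ≤ 10 * x := by
    rw [abs_le] at dp d3 dc ⊢
    simp only [NV]
    constructor <;> linarith [dp.1, dp.2, d3.1, d3.2, dc.1, dc.2]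
  have zN : NV D Ds Dc B r e (qV t l) (cV t l) = zV D Ds Dc B r e t l * Real.exp l := by rw [zV, div_mul_cancel₀ _ e0.ne']
  have zN' : NV D Ds Dc B r e (qV t l') (cV t l') = zV D Ds Dc B r e t l' * Real.exp l' := by rw [zV, div_mul_cancel₀ _ e0'.ne']
  rw [zN, zN'] at dN
  simp only [gV]
  set z := zV D Ds Dc B r e t l
  set z' := zV D Ds Dc B r e t l'
  have dzz : |z - z'| ≤ 11 * (l - l') := by
    have : (z - z') * Real.exp l = (z * Real.exp l - z' * Real.exp l') - z' * x := by rw [hxd]; ring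
    have k : |z - z'| * Real.exp l ≤ 11 * x := by
      have e1 : |z - z'| * Real.exp l = |(z - z') * Real.exp l| := by rw [abs_mul, abs_of_pos e0]
      rw [e1, this]
      refine (abs_sub _ _).trans ?_
      rw [abs_mul z', abs_of_nonneg hx0]
      have := mul_le_mul_of_nonneg_right z1' hx0
      linarith
    refine le_of_mul_le_mul_right (k.trans ?_) e0
    linarith
  rw [ll]; exact (fracV z2 z2').trans dzz

theorem NF.V_le (h : NF (-1) r D Ds Dc B) {t l : ℝ} (ht : t ∈ Icc (0:ℝ) 2) (hl : Real.exp l ≤ r / 3) :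
    gV D Ds Dc B r (-1) t l ≤ gV D Ds Dc B r 1 t l ∧ (t ∈ Ioo (0:ℝ) 2 → gV D Ds Dc B r (-1) t l < gV D Ds Dc B r 1 t l) := by
  obtain ⟨q2, c2, b1, b2⟩ := h.V_bd hl ht
  have z1 := (abs_le.1 (h.V_z (e := 1) (by simp) hl ht).2).2
  have z2 := (abs_le.1 (h.V_z (e := -1) (by simp) hl ht).2).2
  have k := (h.H_pt (e := 1) (by simp) q2 c2).1
  have e0 := Real.exp_pos l
  have e : zV D Ds Dc B r 1 t l - zV D Ds Dc B r (-1) t l = 2 * Ds (imp D r (qV t l) (cV t l), cV t l) * qV t l / Real.exp l := by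
    simp only [zV, NV, zH]; field_simp; ring
  have D0 : 0 < Ds (imp D r (qV t l) (cV t l), cV t l) := by linarith
  have q0 := (qcV (l := l) ht).1
  simp only [gV]
  rw [div_le_div_iff₀ (by linarith) (by linarith), div_lt_div_iff₀ (by linarith) (by linarith)]
  have : 0 ≤ zV D Ds Dc B r 1 t l - zV D Ds Dc B r (-1) t l := by rw [e]; positivity
  refine ⟨by linarith, fun hI => ?_⟩
  have q0 : 0 < qV t l := mul_pos e0 (Real.sqrt_pos.2 (by nlinarith [hI.1, hI.2]))
  have : 0 < zV D Ds Dc B r 1 t l - zV D Ds Dc B r (-1) t l := by rw [e]; positivity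
  linarith

theorem NF.V_bdd (h : NF (-1) r D Ds Dc B) {e : ℝ} (he : |e| = 1) {t l : ℝ} (ht : t ∈ Icc (0:ℝ) 2) (hl : Real.exp l ≤ r / 3) :
    |gV D Ds Dc B r e t l| ≤ 1 := by
  obtain ⟨z1, z2⟩ := h.V_z he hl ht
  have := (abs_le.1 z2).2
  rw [gV, abs_div, abs_of_pos (a := 2 - _) (by linarith), div_le_one (by linarith)]
  linarith

theorem NF.V_contZ (h : NF (-1) r D Ds Dc B) (e : ℝ) :
    ContinuousOn (fun p : 𝕍 => zH D B r e (qV p.1 p.2) (cV p.1 p.2)) (Icc 0 2 ×ˢ Iic (Real.log (r / 3))) ∧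
    ContinuousOn (fun p : 𝕍 => zV D Ds Dc B r e p.1 p.2) (Icc 0 2 ×ˢ Iic (Real.log (r / 3))) := by
  have r0 := h.r0
  have cc : Continuous fun p : 𝕍 => cV p.1 p.2 := by unfold cV; fun_prop
  have cq : Continuous fun p : 𝕍 => qV p.1 p.2 := by unfold qV; fun_prop
  have el : ∀ p ∈ (Icc (0:ℝ) 2 ×ˢ Iic (Real.log (r / 3))), Real.exp p.2 ≤ r / 3 := fun p hp =>
    (Real.le_log_iff_exp_le (by positivity)).1 hp.2
  have ci : ContinuousOn (fun p : 𝕍 => ((imp D r (qV p.1 p.2) (cV p.1 p.2), cV p.1 p.2) : 𝕍)) (Icc 0 2 ×ˢ Iic (Real.log (r / 3))) :=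
    (h.imp_contOn.comp (cq.prodMk cc).continuousOn fun p hp =>
      have k := h.V_bd (el p hp) hp.1; pnorm_le k.1 k.2.1).prodMk cc.continuousOn
  have mr : MapsTo (fun p : 𝕍 => ((imp D r (qV p.1 p.2) (cV p.1 p.2), cV p.1 p.2) : 𝕍)) (Icc 0 2 ×ˢ Iic (Real.log (r / 3))) {p | ‖p‖ ≤ r} :=
    fun p hp => have k := h.V_bd (el p hp) hp.1; h.imp_r k.1 k.2.1
  have cz : ContinuousOn (fun p : 𝕍 => zH D B r e (qV p.1 p.2) (cV p.1 p.2)) (Icc 0 2 ×ˢ Iic (Real.log (r / 3))) :=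
    (continuousOn_const.mul cq.continuousOn).sub (h.cB.comp ci mr)
  refine ⟨cz, ContinuousOn.div (((continuousOn_const.mul cc.continuousOn).add (h.cDc.comp ci mr)).add ((h.cDs.comp ci mr).mul cz))
    (by fun_prop) fun p _ => (Real.exp_pos _).ne'⟩
end

section
variable {r : ℝ} {D Ds Dc B : 𝕍 → ℝ}

def rV (D : 𝕍 → ℝ) (p : 𝕍) : ℝ := √(p.2 ^ 2 + D p)
def kV (D : 𝕍 → ℝ) (p : 𝕍) : 𝕍 := (p.2 / rV D p + 1, Real.log (rV D p))
def jV (P : 𝕍) : 𝕍 := (P.1, 2 * P.2 - 3 * P.1)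
def JV (S : Set 𝕍) : Prop := ∃ S', Seg S' ∧ S = jV '' S'
def KV (D : 𝕍 → ℝ) (r : ℝ) : Set 𝕍 := {p | ‖p‖ ≤ r / 4 ∧ bdf D r p.2 ≤ p.1}

theorem jV_inj : Function.Injective jV := by
  intro p p' e
  have e1 : (jV p).1 = (jV p').1 := by rw [e]
  have e2 : (jV p).2 = (jV p').2 := by rw [e]
  simp only [jV] at e1 e2
  exact Prod.ext e1 (by linarith)

theorem NF.kV_prop (h : NF (-1) r D Ds Dc B) {p : 𝕍} (hp : p ∈ KV D r) (h0 : p ≠ 0) :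
    0 < p.1 ∧ ‖p‖ ≤ r ∧ 0 ≤ D p ∧ (bdf D r p.2 < p.1 → 0 < D p) ∧ 0 < rV D p ∧ rV D p ^ 2 = p.2 ^ 2 + D p ∧
    rV D p ≤ 102 / 100 * p.1 ∧ Real.exp (kV D p).2 = rV D p ∧ Real.exp (kV D p).2 ≤ r / 3 ∧ (kV D p).1 ∈ Icc (0:ℝ) 2 ∧
    cV (kV D p).1 (kV D p).2 = p.2 ∧ qV (kV D p).1 (kV D p).2 = √(D p) ∧ imp D r (√(D p)) p.2 = p.1 := by
  have r0 := h.r0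
  have c1 : |p.2| ≤ r / 4 := (norm_snd_le p).trans hp.1
  have c2 : |p.1| ≤ r / 4 := (norm_fst_le p).trans hp.1
  have c3 : |p.2| ≤ r / 2 := by linarith
  have hr : ‖p‖ ≤ r := by linarith [hp.1]
  obtain ⟨b1, b2, b3, b4⟩ := h.bdf_le c3
  have s0 : 0 ≤ p.1 := b3.trans hp.2
  have sr : p.1 ≤ r := (le_abs_self _).trans (by linarith)
  have q := h.bdf_pos (s := p.1) c3 s0 sr
  have D0 : 0 ≤ D p := q.2.2 hp.2
  have sp : 0 < p.1 := by
    rcases s0.eq_or_lt with k | k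
    · have := h.cone hr D0
      rw [← k, abs_zero, mul_zero] at this
      exact (h0 (Prod.ext k.symm (abs_nonpos_iff.1 this))).elim
    · exact k
  have e : rV D p ^ 2 = p.2 ^ 2 + D p := Real.sq_sqrt (by positivity)
  have rn : 0 ≤ rV D p := Real.sqrt_nonneg _
  obtain ⟨m1, m2⟩ := h.rho hr D0 s0 rn e.symm
  have rp : 0 < rV D p := by linarith
  have ee : Real.exp (kV D p).2 = rV D p := Real.exp_log rp
  have e3 : |p.2| ≤ rV D p := abs_le_of_sq_le_sq (by linarith) rn
  have e4 := abs_le.1 e3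
  refine ⟨sp, hr, D0, q.1.2, rp, e, m2, ee, ?_, ⟨?_, ?_⟩, ?_, ?_, h.imp_eq s0 sr (by linarith) (Real.sq_sqrt D0).symm⟩
  · rw [ee]; linarith [le_abs_self p.1]
  · have : -1 ≤ p.2 / rV D p := by rw [le_div_iff₀ rp]; linarith
    simp only [kV]; linarith
  · have : p.2 / rV D p ≤ 1 := by rw [div_le_iff₀ rp]; linarith
    simp only [kV]; linarith
  · rw [cV, ee]; simp only [kV]; field_simp; ring
  · rw [qV, ee]
    nth_rewrite 1 [← Real.sqrt_sq rn]
    rw [← Real.sqrt_mul (by positivity)]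
    congr 1
    simp only [kV, add_sub_cancel_right]
    field_simp; linarith

theorem algV {E sq z dd dc zz w g : ℝ} (hs : 0 < sq) (ss : sq ^ 2 = 1 - w ^ 2) (hW : 0 < 2 - w * z)
    (e3 : g * (2 - w * z) = z) (en : z * E = 2 * (E * w) + dc + dd * zz) :
    zz * (2 * E / (2 - w * z)) * dd = 2 * (E * sq) * (E * g * sq + E * (-(2 * w) / (2 * sq))) - dc * (2 * E / (2 - w * z)) := by
  have e1 : 2 * (E * sq) * (E * g * sq + E * (-(2 * w) / (2 * sq))) = 2 * E ^ 2 * (g * sq ^ 2 - w) := by field_simp; ring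
  have e2 : (zz * dd + dc) * (2 * E / (2 - w * z)) = 2 * E ^ 2 * (g * sq ^ 2 - w) := by
    rw [ss, mul_div_assoc', div_eq_iff hW.ne']
    linear_combination (-2 * E) * en - 2 * E ^ 2 * (1 - w ^ 2) * e3
  rw [e1, ← e2]; ring

theorem NF.leafV (h : NF (-1) r D Ds Dc B) {GA GB M K} (net : Net GA GB M K)
    (hA : ∀ t ∈ Icc (0:ℝ) 2, ∀ y ∈ Iic (Real.log (r / 3)), GA t y = gV D Ds Dc B r (-1) t y)
    (hB : ∀ t ∈ Icc (0:ℝ) 2, ∀ y ∈ Iic (Real.log (r / 3)), GB t y = gV D Ds Dc B r 1 t y)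
    {S : Set 𝕍} (hS : ∀ p ∈ S, ‖p‖ < r / 4 ∧ bdf D r p.2 < p.1) :
    Curve (QV D B) S ↔ Seg ((fun p => net.Phi (kV D p)) '' S) := by
  have r0 := h.r0
  have e1 : |(1 : ℝ)| = 1 := by simp
  have e2 : |(-1 : ℝ)| = 1 := by simp
  set R : Set 𝕍 := {p | ‖p‖ < r / 4 ∧ bdf D r p.2 < p.1} with hR
  have RK : ∀ p ∈ R, p ∈ KV D r := fun p hp => ⟨hp.1.le, hp.2.le⟩
  have R0 : ∀ p ∈ R, p ≠ 0 := by
    rintro p hp rfl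
    have := (h.bdf_le (c := 0) (by rw [abs_zero]; positivity)).2.2.1
    exact absurd hp.2 (not_lt.2 this)
  have kp := fun p (hp : p ∈ R) => h.kV_prop (RK p hp) (R0 p hp)
  have RD : ∀ p ∈ R, 0 < D p := fun p hp => (kp p hp).2.2.2.1 hp.2
  have Rr : ∀ p ∈ R, ‖p‖ ≤ r := fun p hp => (kp p hp).2.1
  have kI : ∀ p ∈ R, (kV D p).1 ∈ Icc (0:ℝ) 2 ∧ (kV D p).2 ∈ Iic (Real.log (r / 3)) := by
    intro p hp
    obtain ⟨a1, a2, a3, a4, a5, a6, a7, a8, a9, a10, a11, a12, a13⟩ := kp p hp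
    exact ⟨a10, mem_Iic.2 ((Real.le_log_iff_exp_le (by positivity)).2 a9)⟩
  refine leaf net (R := R) ?_ ⟨2, fun p hp => ?_⟩ ?_ ?_ hS
  · intro p hp p' hp' he
    obtain ⟨a1, a2, a3, a4, a5, a6, a7, a8, a9, a10, a11, a12, a13⟩ := kp p hp
    obtain ⟨b1, b2, b3, b4, b5, b6, b7, b8, b9, b10, b11, b12, b13⟩ := kp p' hp'
    rw [he] at a11 a12
    rw [← a11, ← a12, b11, b12, b13] at a13
    exact Prod.ext a13.symm (a11.symm.trans b11)
  · have := (kI p hp).1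
    exact abs_le.2 ⟨by linarith [this.1], this.2⟩
  · intro γ dγ a b ⟨hc, hγ⟩ hm
    have cγ : ContinuousOn γ (Ioo a b) := fun t ht => (hγ t ht).1.continuousAt.continuousWithinAt
    obtain ⟨s1, s2⟩ := sgn_lemma isPreconnected_Ioo (w1 := fun t => (dγ t).2) (w2 := fun t => (dγ t).1)
      (β := fun t => B (γ t)) (δ := fun t => D (γ t)) (by fun_prop) (by fun_prop)
      (h.cB.comp cγ fun t ht => Rr _ (hm t ht)) (h.cD.comp cγ fun t ht => Rr _ (hm t ht))
      (fun t ht => (hγ t ht).2.2) (fun t ht => RD _ (hm t ht)) (fun t ht => by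
        have := (hγ t ht).2.1
        by_contra hcon; push Not at hcon; exact this (Prod.ext hcon.2 hcon.1))
    have key : ∀ e : ℝ, |e| = 1 → (∀ t ∈ Ioo a b, (dγ t).1 = (e * √(D (γ t)) - B (γ t)) * (dγ t).2) → ∀ t ∈ Ioo a b,
        let ρ' := (2 * (γ t).2 * (dγ t).2 + (Ds (γ t) * (dγ t).1 + Dc (γ t) * (dγ t).2)) / (2 * rV D (γ t))
        let τ := ((dγ t).2 * rV D (γ t) - (γ t).2 * ρ') / rV D (γ t) ^ 2
        HasDerivAt (fun t => (kV D (γ t)).1) τ t ∧ τ ≠ 0 ∧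
          HasDerivAt (fun t => (kV D (γ t)).2) (gV D Ds Dc B r e (kV D (γ t)).1 (kV D (γ t)).2 * τ) t := by
      intro e he k t ht ρ' τ
      have pm := hm t ht
      obtain ⟨a1, a2, a3, a4, a5, a6, a7, a8, a9, a10, a11, a12, a13⟩ := kp _ pm
      have sp : ((γ t).2 ^ 2 + D (γ t)) ≠ 0 := by rw [← a6]; positivity
      have dρ : HasDerivAt (fun t => rV D (γ t)) ρ' t := by
        have d1 := ((hγ t ht).1.snd'.fun_pow 2).fun_add (h.D_deriv a2 (hγ t ht).1)
        have := d1.sqrt sp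
        refine this.congr_deriv ?_
        simp [ρ', rV]
      have ez : zV D Ds Dc B r e (kV D (γ t)).1 (kV D (γ t)).2 =
          (2 * (γ t).2 + Dc (γ t) + Ds (γ t) * (e * √(D (γ t)) - B (γ t))) / rV D (γ t) := by
        rw [zV, a8, NV, zH, a11, a12, a13]
      have zb := (abs_le.1 (h.V_z he a9 a10).2).2
      have rp' : ρ' = zV D Ds Dc B r e (kV D (γ t)).1 (kV D (γ t)).2 * (dγ t).2 / 2 := by
        simp only [ρ']; rw [ez, k t ht]; field_simp; ring
      have ce : (γ t).2 = rV D (γ t) * ((kV D (γ t)).1 - 1) := by rw [← a8]; exact a11.symm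
      have eτ : τ = (dγ t).2 / rV D (γ t) * (2 - ((kV D (γ t)).1 - 1) * zV D Ds Dc B r e (kV D (γ t)).1 (kV D (γ t)).2) / 2 := by
        simp only [τ]; rw [rp', ce]; field_simp
      have ne : 2 - ((kV D (γ t)).1 - 1) * zV D Ds Dc B r e (kV D (γ t)).1 (kV D (γ t)).2 ≠ 0 := by
        have : 0 < 2 - ((kV D (γ t)).1 - 1) * zV D Ds Dc B r e (kV D (γ t)).1 (kV D (γ t)).2 := by linarith
        exact this.ne'
      refine ⟨((hγ t ht).1.snd'.fun_div dρ a5.ne').add_const 1, ?_, ?_⟩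
      · rw [eτ]; have := s1 t ht; positivity
      · have := dρ.log a5.ne'
        refine this.congr_deriv ?_
        rw [eτ, rp', gV]
        generalize zV D Ds Dc B r e (kV D (γ t)).1 (kV D (γ t)).2 = z at ne ⊢
        generalize 2 - ((kV D (γ t)).1 - 1) * z = y at ne ⊢
        field_simp
    refine ⟨fun t => ((dγ t).2 * rV D (γ t) - (γ t).2 * ((2 * (γ t).2 * (dγ t).2 + (Ds (γ t) * (dγ t).1 + Dc (γ t) * (dγ t).2)) / (2 * rV D (γ t)))) / rV D (γ t) ^ 2, fun t ht => ?_, ?_⟩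
    · rcases s2 with k | k
      · have l := key (-1) e2 (fun t ht => by rw [k t ht]; ring) t ht; exact ⟨l.1, l.2.1⟩
      · have l := key 1 e1 (fun t ht => by rw [k t ht]; ring) t ht; exact ⟨l.1, l.2.1⟩
    · refine s2.imp (fun k t ht => ?_) (fun k t ht => ?_)
      · rw [hA _ (kI _ (hm t ht)).1 _ (kI _ (hm t ht)).2]
        exact (key (-1) e2 (fun t ht => by rw [k t ht]; ring) t ht).2.2
      · rw [hB _ (kI _ (hm t ht)).1 _ (kI _ (hm t ht)).2]
        exact (key 1 e1 (fun t ht => by rw [k t ht]; ring) t ht).2.2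
  · intro Y a b hY hm
    have pt : ∀ t ∈ Ioo a b, t ∈ Icc (0:ℝ) 2 ∧ Y t ∈ Iic (Real.log (r / 3)) ∧ Real.exp (Y t) ≤ r / 3 ∧ 0 < qV t (Y t) ∧
        (imp D r (qV t (Y t)) (cV t (Y t)), cV t (Y t)) ∈ R ∧ kV D (imp D r (qV t (Y t)) (cV t (Y t)), cV t (Y t)) = (t, Y t) ∧
        D (imp D r (qV t (Y t)) (cV t (Y t)), cV t (Y t)) = qV t (Y t) ^ 2 := by
      intro t ht
      obtain ⟨p, hp, he⟩ := hm t ht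
      obtain ⟨a1, a2, a3, a4, a5, a6, a7, a8, a9, a10, a11, a12, a13⟩ := kp _ hp
      have k2 := kI p hp
      have d0 := Real.sqrt_pos.2 (RD p hp)
      rw [he] at a9 a10 a11 a12 k2
      simp only at a9 a10 a11 a12 k2
      have ep : (imp D r (qV t (Y t)) (cV t (Y t)), cV t (Y t)) = p := by
        rw [a11, a12, a13]
      rw [ep]
      exact ⟨a10, k2.2, a9, by rw [a12]; exact d0, hp, he, by rw [a12, Real.sq_sqrt a3]⟩
    have cY : ContinuousOn Y (Ioo a b) := by
      rcases hY with k | k <;> exact fun t ht => (k t ht).continuousAt.continuousWithinAt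
    have main : ∀ e : ℝ, |e| = 1 → (∀ t ∈ Ioo a b, HasDerivAt Y (gV D Ds Dc B r e t (Y t)) t) →
        ∃ γ dγ, CurveOn (QV D B) γ dγ a b ∧ ∀ t ∈ Ioo a b, γ t ∈ R ∧ kV D (γ t) = (t, Y t) := by
      intro e he hY
      have mI : MapsTo (fun t => ((t, Y t) : 𝕍)) (Ioo a b) (Icc 0 2 ×ˢ Iic (Real.log (r / 3))) := fun t ht =>
        ⟨(pt t ht).1, (pt t ht).2.1⟩
      have cz : ContinuousOn (fun t => zH D B r e (qV t (Y t)) (cV t (Y t))) (Ioo a b) :=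
        (h.V_contZ e).1.comp (continuousOn_id.prodMk cY) mI
      have cZ : ContinuousOn (fun t => zV D Ds Dc B r e t (Y t)) (Ioo a b) :=
        (h.V_contZ e).2.comp (continuousOn_id.prodMk cY) mI
      have W0 : ∀ t ∈ Ioo a b, 0 < 2 - (t - 1) * zV D Ds Dc B r e t (Y t) := fun t ht => by
        have := (abs_le.1 (h.V_z he (pt t ht).2.2.1 (pt t ht).1).2).2
        linarith
      have cq : ContinuousOn (fun t => 2 * Real.exp (Y t) / (2 - (t - 1) * zV D Ds Dc B r e t (Y t))) (Ioo a b) :=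
        (continuousOn_const.mul (Real.continuous_exp.comp_continuousOn cY)).div
          (continuousOn_const.sub ((continuousOn_id.sub continuousOn_const).mul cZ)) fun t ht => (W0 t ht).ne'
      refine ⟨fun t => (imp D r (qV t (Y t)) (cV t (Y t)), cV t (Y t)),
        fun t => (zH D B r e (qV t (Y t)) (cV t (Y t)) * (2 * Real.exp (Y t) / (2 - (t - 1) * zV D Ds Dc B r e t (Y t))),
          2 * Real.exp (Y t) / (2 - (t - 1) * zV D Ds Dc B r e t (Y t))),
        ⟨(cz.mul cq).prodMk cq, fun t ht => ?_⟩, fun t ht => ⟨(pt t ht).2.2.2.2.1, (pt t ht).2.2.2.2.2.1⟩⟩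
      obtain ⟨t1, t2, t3, t4, t5, t6, t7⟩ := pt t ht
      have W0 := W0 t ht
      have E0 := Real.exp_pos (Y t)
      obtain ⟨u1, u2, u3, u4⟩ := qcV (l := Y t) t1
      have ql : |qV t (Y t)| < r / 2 := by rw [abs_of_nonneg u1]; linarith
      have cl : |cV t (Y t)| < r / 2 := by linarith
      have s0 := (h.V_bd t3 t1).2.2.2
      have D0 : 0 < Ds (imp D r (qV t (Y t)) (cV t (Y t)), cV t (Y t)) := by have := (h.H_pt he ql.le cl.le).1; linarith
      refine ⟨?_, ?_, ?_⟩
      · have dE := (hY t ht).exp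
        have d2 : HasDerivAt (fun t => cV t (Y t)) (2 * Real.exp (Y t) / (2 - (t - 1) * zV D Ds Dc B r e t (Y t))) t := by
          have := dE.fun_mul ((hasDerivAt_id t).sub_const 1)
          refine this.congr_deriv ?_
          rw [gV]
          generalize zV D Ds Dc B r e t (Y t) = z at W0 ⊢
          have W1 := W0.ne'
          simp only [id]
          rw [eq_div_iff W1, add_mul, mul_right_comm, mul_div_assoc', div_mul_cancel₀ _ W1]; ring
        have sq0 : 0 < √(1 - (t - 1) ^ 2) := by
          by_contra hcon
          have : √(1 - (t - 1) ^ 2) = 0 := le_antisymm (not_lt.1 hcon) (Real.sqrt_nonneg _)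
          rw [qV, this, mul_zero] at t4
          exact lt_irrefl _ t4
        have sq1 := Real.sqrt_pos.1 sq0
        have dq : HasDerivAt (fun t => qV t (Y t)) _ t :=
          dE.fun_mul ((((hasDerivAt_id t).sub_const 1).fun_pow 2).const_sub 1 |>.sqrt sq1.ne')
        have d1 := h.imp_deriv (q := fun t => qV t (Y t)) (c := fun t => cV t (Y t)) ql cl dq d2 D0.ne'
        convert d1.prodMk d2 using 2
        rw [eq_div_iff D0.ne']
        have en : zV D Ds Dc B r e t (Y t) * Real.exp (Y t) = 2 * cV t (Y t) + Dc (imp D r (qV t (Y t)) (cV t (Y t)), cV t (Y t)) +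
            Ds (imp D r (qV t (Y t)) (cV t (Y t)), cV t (Y t)) * zH D B r e (qV t (Y t)) (cV t (Y t)) := by
          rw [zV, div_mul_cancel₀ _ E0.ne']; rfl
        have ss := Real.sq_sqrt sq1.le
        have e3 : gV D Ds Dc B r e t (Y t) * (2 - (t - 1) * zV D Ds Dc B r e t (Y t)) = zV D Ds Dc B r e t (Y t) := by
          rw [gV, div_mul_cancel₀ _ W0.ne']
        have := algV sq0 ss W0 e3 en
        convert this using 1
        simp [qV]
      · intro k
        have := congrArg Prod.snd k
        have h2 : 0 < 2 * Real.exp (Y t) / (2 - (t - 1) * zV D Ds Dc B r e t (Y t)) := by positivity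
        exact h2.ne' this
      · have ee : e ^ 2 = 1 := by rw [← sq_abs, he]; norm_num
        simp only [QV, t7]
        generalize 2 * Real.exp (Y t) / (2 - (t - 1) * zV D Ds Dc B r e t (Y t)) = w
        simp only [zH]
        linear_combination w ^ 2 * qV t (Y t) ^ 2 * ee
    rcases hY with k | k
    · exact main (-1) e2 fun t ht => by rw [← hA t (pt t ht).1 _ (pt t ht).2.1]; exact k t ht
    · exact main 1 e1 fun t ht => by rw [← hB t (pt t ht).1 _ (pt t ht).2.1]; exact k t ht
end

def gfn (F L : ℝ → ℝ) (c : ℝ) : ℝ := if c < 0 then - F (Real.log (-c)) else if c = 0 then 0 else F (L (Real.log c))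

theorem gfn_pos {F L : ℝ → ℝ} {c : ℝ} (hc : 0 < c) : gfn F L c = F (L (Real.log c)) := by
  rw [gfn, if_neg (not_lt.2 hc.le), if_neg hc.ne']
theorem gfn_neg {F L : ℝ → ℝ} {c : ℝ} (hc : c < 0) : gfn F L c = - F (Real.log (-c)) := by rw [gfn, if_pos hc]
theorem gfn_zero {F L : ℝ → ℝ} : gfn F L 0 = 0 := by simp [gfn]

theorem gfn_prop {F L : ℝ → ℝ} (hm : StrictMono F) (h0 : ∀ u, 0 < F u) (hs : ∀ y, 0 < y → ∃ u, F u = y) (lm : StrictMono L)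
    (ls : Function.Surjective L) : StrictMono (gfn F L) ∧ Continuous (gfn F L) := by
  have sm : StrictMono (gfn F L) := by
    intro c d hcd
    rcases lt_trichotomy d 0 with k | rfl | k
    · rw [gfn_neg k, gfn_neg (hcd.trans k)]
      exact neg_lt_neg (hm (Real.log_lt_log (by linarith) (by linarith)))
    · rw [gfn_neg hcd, gfn_zero]; linarith [h0 (Real.log (-c))]
    · rw [gfn_pos k]
      rcases lt_trichotomy c 0 with k' | rfl | k'
      · rw [gfn_neg k']; linarith [h0 (Real.log (-c)), h0 (L (Real.log d))]
      · rw [gfn_zero]; exact h0 _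
      · rw [gfn_pos k']; exact hm (lm (Real.log_lt_log k' hcd))
  refine ⟨sm, sm.monotone.continuous_of_surjective fun y => ?_⟩
  rcases lt_trichotomy y 0 with k | rfl | k
  · obtain ⟨u, hu⟩ := hs (-y) (by linarith)
    refine ⟨- Real.exp u, ?_⟩
    rw [gfn_neg (by linarith [Real.exp_pos u])]; simp [hu]
  · exact ⟨0, gfn_zero⟩
  · obtain ⟨u, hu⟩ := hs y k
    obtain ⟨v, hv⟩ := ls u
    refine ⟨Real.exp v, ?_⟩
    rw [gfn_pos (Real.exp_pos v)]; simp [hu, hv]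

theorem Fld.lab_dist {G M K} (h : Fld G M K) {t : ℝ} (ht : t ∈ Icc (0:ℝ) 2) (y : ℝ) : |h.lab t y - y| ≤ 2 * M := by
  have := h.sol_dist t y 0 t
  rw [h.sol_self, zero_sub, abs_neg, abs_of_nonneg ht.1] at this
  refine this.trans ?_
  have m : 0 ≤ M := (abs_nonneg _).trans (h.bd 0 0)
  nlinarith [ht.2]

section
variable {r : ℝ} {D Ds Dc B : 𝕍 → ℝ}

theorem secV (h : NF (-1) r D Ds Dc B) : ∃ g ψ, Sec JV (Curve (QV D B)) (r / 4) (bdf D r) g ψ := by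
  have r0 := h.r0
  have e1 : |(1 : ℝ)| = 1 := by simp
  have e2 : |(-1 : ℝ)| = 1 := by simp
  have el : ∀ y ∈ Iic (Real.log (r / 3)), Real.exp y ≤ r / 3 := fun p hp => (Real.le_log_iff_exp_le (by positivity)).1 hp
  have ct : ∀ e : ℝ, |e| = 1 → ContinuousOn (fun p : 𝕍 => gV D Ds Dc B r e p.1 p.2) (Icc 0 2 ×ˢ Iic (Real.log (r / 3))) := by
    intro e he
    refine (h.V_contZ e).2.div (continuousOn_const.sub (ContinuousOn.mul (by fun_prop) (h.V_contZ e).2)) fun p hp => ?_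
    have := (abs_le.1 (h.V_z he (el _ hp.2) hp.1).2).2
    have : 0 < 2 - (p.1 - 1) * zV D Ds Dc B r e p.1 p.2 := by linarith
    exact this.ne'
  obtain ⟨GA, GB, M, net, hA, hB⟩ := Net.exists_cutoff (gA := gV D Ds Dc B r (-1)) (gB := gV D Ds Dc B r 1)
    (t1 := 0) (t2 := 2) (M := 1) (K := 11) (Y := Iic (Real.log (r / 3))) (π := fun y => min y (Real.log (r / 3)))
    (by norm_num) (fun y => mem_Iic.2 (min_le_right _ _)) (fun y y' => abs_inf_sub_inf_le_abs _ _ _) (fun y hy => min_eq_left hy)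
    (ct _ e2) (ct _ e1) (fun t ht y hy => h.V_bdd e2 ht (el y hy)) (fun t ht y hy => h.V_bdd e1 ht (el y hy))
    (fun t ht y hy y' hy' => h.V_lip e2 ht (el y hy) (el y' hy')) (fun t ht y hy y' hy' => h.V_lip e1 ht (el y hy) (el y' hy'))
    (fun t ht y hy => (h.V_le ht (el y hy)).1) (fun t ht _ y hy => (h.V_le (Ioo_subset_Icc_self ht) (el y hy)).2 ht) (by norm_num)
  obtain ⟨F, Fo, Fm, F0, Fs, F2⟩ := netF net
  set pr : 𝕍 → 𝕍 := fun P => (F P.1, F P.2) with hpr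
  set ψ : 𝕍 → 𝕍 := fun p => if p = 0 then 0 else jV (pr (net.Phi (kV D p))) with hψ
  have ψ1 : ∀ p, p ≠ 0 → ψ p = jV (pr (net.Phi (kV D p))) := fun p hp => if_neg hp
  have ψ0 : ψ 0 = 0 := if_pos rfl
  obtain ⟨gm, gc⟩ := gfn_prop (L := net.B.lab 2) Fm F0 Fs (net.B.lab_mono 2) fun y => ⟨_, net.B.lab_phi 2 y⟩
  have z2 : |(0 : ℝ)| ≤ r / 2 := by rw [abs_zero]; linarith
  have bd2 : ∀ c : ℝ, |c| ≤ r / 4 → |c| ≤ r / 2 := fun c hc => by linarith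
  have rng : ∀ P : 𝕍, (0 ≤ P.1 ↔ (net.Phi P).1 ≤ (net.Phi P).2) ∧ (P.1 ≤ 2 ↔ F (net.Phi P).2 ≤ 2 * F (net.Phi P).1) := by
    intro P
    have a1 := net.time_lt (net.Phi P) 0
    have a2 := net.lt_time (net.Phi P) 2
    rw [← net.Phi_symm_fst, Homeomorph.symm_apply_apply] at a1 a2
    simp only [Fld.phi_zero] at a1
    refine ⟨by rw [← not_lt, a1, not_lt], ?_⟩
    rw [← F2, Fm.le_iff_le, ← (net.A.phi_mono 2).le_iff_le (a := (net.Phi P).2), Fld.phi_lab, ← not_lt, a2, not_lt]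
  have nrm : ∀ p ∈ KV D r, p ≠ 0 → |(ψ p).2| ≤ (ψ p).1 := by
    intro p hp hp0
    obtain ⟨a1, a2, a3, a4, a5, a6, a7, a8, a9, a10, a11, a12, a13⟩ := h.kV_prop hp hp0
    have k1 := Fm.monotone ((rng (kV D p)).1.1 a10.1)
    have k2 := (rng (kV D p)).2.1 a10.2
    rw [ψ1 p hp0]
    simp only [jV, hpr]
    rw [abs_le]; constructor <;> linarith
  have jc : Continuous jV := by unfold jV; fun_prop
  have prc : Continuous pr := (Fo.continuous.comp continuous_fst).prodMk (Fo.continuous.comp continuous_snd)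
  have bz : bdf D r 0 = 0 := by
    have := h.bdf_le (c := 0) z2
    exact le_antisymm (by simpa using this.1) this.2.2.1
  refine ⟨gfn F (net.B.lab 2), ψ, by linarith, h.bdf_cont.mono fun c hc => bd2 c hc, ?_, ?_, bz, gc.continuousOn, gm.strictMonoOn _,
    gfn_zero, ?_, ?_, ?_, ?_, ?_, ?_⟩
  · intro c hc c0
    have := (h.bdf_le (bd2 c hc)).2.1
    have := abs_pos.2 c0; linarith
  · exact fun c hc => (h.bdf_le (bd2 c hc)).1
  · intro p hp
    rcases eq_or_ne p 0 with rfl | hp0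
    · rw [ContinuousWithinAt, ψ0, Metric.tendsto_nhdsWithin_nhds]
      intro ε ε0
      obtain ⟨le, hle⟩ := Fs ε ε0
      refine ⟨Real.exp (le - 2 * M) / 2, by positivity, fun p hp hd => ?_⟩
      rw [dist_zero_right] at hd ⊢
      rcases eq_or_ne p 0 with rfl | hp0
      · rw [ψ0, norm_zero]; exact ε0
      obtain ⟨a1, a2, a3, a4, a5, a6, a7, a8, a9, a10, a11, a12, a13⟩ := h.kV_prop hp hp0
      have b1 := nrm p hp hp0
      have b2 : ‖ψ p‖ = (ψ p).1 := by
        rw [Prod.norm_def, Real.norm_eq_abs, Real.norm_eq_abs, abs_of_nonneg ((abs_nonneg _).trans b1)]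
        exact max_eq_left b1
      rw [b2, ψ1 p hp0, ← hle]
      refine Fm ?_
      have b3 := (abs_le.1 (net.B.lab_dist a10 (kV D p).2)).2
      have b4 : (kV D p).2 < le - 2 * M := by
        rw [← Real.exp_lt_exp, a8]
        have := (le_abs_self _).trans (norm_fst_le p)
        linarith [Real.exp_pos (le - 2 * M)]
      show net.B.lab (kV D p).1 (kV D p).2 < le
      linarith
    · obtain ⟨a1, a2, a3, a4, a5, a6, a7, a8, a9, a10, a11, a12, a13⟩ := h.kV_prop hp hp0
      have cr : ContinuousWithinAt (rV D) {p | ‖p‖ ≤ r / 4 ∧ bdf D r p.2 ≤ p.1} p := by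
        have : ContinuousWithinAt D {p | ‖p‖ ≤ r / 4 ∧ bdf D r p.2 ≤ p.1} p :=
          (h.cD p a2).mono fun q hq => by have := hq.1; show ‖q‖ ≤ r; linarith
        exact ((ContinuousWithinAt.pow continuousWithinAt_snd 2).add this).sqrt
      have ck : ContinuousWithinAt (kV D) {p | ‖p‖ ≤ r / 4 ∧ bdf D r p.2 ≤ p.1} p :=
        ((continuousWithinAt_snd.div cr a5.ne').add continuousWithinAt_const).prodMk (cr.log a5.ne')
      have : ContinuousWithinAt (fun p => jV (pr (net.Phi (kV D p)))) {p | ‖p‖ ≤ r / 4 ∧ bdf D r p.2 ≤ p.1} p :=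
        (jc.comp (prc.comp net.Phi.continuous)).continuousAt.comp_continuousWithinAt ck
      refine this.congr_of_eventuallyEq ?_ (ψ1 p hp0)
      filter_upwards [nhdsWithin_le_nhds (isOpen_ne.mem_nhds hp0)] with q hq using ψ1 q hq
  · intro p hp p' hp' he
    rcases eq_or_ne p 0 with rfl | hp0 <;> rcases eq_or_ne p' 0 with rfl | hp0'
    · rfl
    · rw [ψ0, ψ1 p' hp0'] at he
      exact absurd (congrArg Prod.fst he) (F0 _).ne
    · rw [ψ0, ψ1 p hp0] at he
      exact absurd (congrArg Prod.fst he) (F0 _).ne'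
    · rw [ψ1 p hp0, ψ1 p' hp0'] at he
      have he := jV_inj he
      have ek : kV D p = kV D p' := net.Phi.injective
        (Prod.ext (Fm.injective (congrArg Prod.fst he)) (Fm.injective (congrArg Prod.snd he)))
      obtain ⟨a1, a2, a3, a4, a5, a6, a7, a8, a9, a10, a11, a12, a13⟩ := h.kV_prop hp hp0
      obtain ⟨b1, b2, b3, b4, b5, b6, b7, b8, b9, b10, b11, b12, b13⟩ := h.kV_prop hp' hp0'
      rw [ek] at a11 a12
      rw [← a11, ← a12, b11, b12, b13] at a13
      exact Prod.ext a13.symm (a11.symm.trans b11)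
  · intro c hc hb
    obtain ⟨i1, i2, i3, i4⟩ := h.bdf_le (bd2 c hc)
    have er : rV D (bdf D r c, c) = |c| := by rw [rV, i4, add_zero, Real.sqrt_sq_eq_abs]
    rcases lt_trichotomy c 0 with k | rfl | k
    · rw [ψ1 _ (fun e => k.ne (congrArg Prod.snd e)), gfn_neg k, abs_neg, abs_of_pos (F0 _)]
      have : kV D (bdf D r c, c) = (0, Real.log (-c)) := by
        rw [kV, er, abs_of_neg k]
        simp only [div_neg, div_self k.ne, neg_add_cancel]
      rw [this, net.Phi_apply]
      simp only [Fld.lab_zero, hpr, jV]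
      ext <;> simp; ring
    · rw [bz, gfn_zero, abs_zero]; exact ψ0
    · rw [ψ1 _ (fun e => k.ne' (congrArg Prod.snd e)), gfn_pos k, abs_of_pos (F0 _)]
      have : kV D (bdf D r c, c) = (2, Real.log c) := by
        rw [kV, er, abs_of_pos k]
        simp only [div_self k.ne']; norm_num
      rw [this, net.Phi_apply]
      have e3 := F2 (net.B.lab 2 (Real.log c))
      rw [Fld.phi_lab] at e3
      simp only [hpr, jV, e3]
      ext <;> simp; ring
  · intro p hp hb
    have hp0 : p ≠ 0 := by
      rintro rfl
      have : bdf D r 0 < 0 := hb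
      rw [bz] at this; exact lt_irrefl _ this
    have hK : p ∈ KV D r := ⟨hp, hb.le⟩
    obtain ⟨a1, a2, a3, a4, a5, a6, a7, a8, a9, a10, a11, a12, a13⟩ := h.kV_prop hK hp0
    have d0 := a4 hb
    have e3 : |p.2| < rV D p := abs_lt_of_sq_lt_sq (by linarith) a5.le
    have e4 := abs_lt.1 e3
    have t0 : 0 < (kV D p).1 := by
      have : -1 < p.2 / rV D p := by rw [lt_div_iff₀ a5]; linarith
      simp only [kV]; linarith
    have t1 : (kV D p).1 < 2 := by
      have : p.2 / rV D p < 1 := by rw [div_lt_iff₀ a5]; linarith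
      simp only [kV]; linarith
    have a1 := net.lt_time (net.Phi (kV D p)) 0
    have a2 := net.time_lt (net.Phi (kV D p)) 2
    rw [← net.Phi_symm_fst, Homeomorph.symm_apply_apply] at a1 a2
    simp only [Fld.phi_zero] at a1
    have k1 := Fm (a1.1 t0)
    have k2 := a2.1 t1
    rw [← net.A.phi_lab 2 (net.B.phi 2 _), (net.A.phi_mono 2).lt_iff_lt] at k2
    have k2 := Fm k2
    rw [F2] at k2
    rw [ψ1 p hp0]
    simp only [jV, hpr]
    rw [abs_lt]; constructor <;> linarith
  · refine ⟨F (Real.log (r / 8) - 2 * M), F0 _, fun P hP hw => ?_⟩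
    have P0 : 0 ≤ P.1 := (abs_nonneg _).trans hw
    rcases P0.eq_or_lt with k | k
    · rw [← k] at hw
      exact ⟨0, by rw [norm_zero]; positivity, bz.le, by rw [ψ0]; exact Prod.ext k (abs_nonpos_iff.1 hw).symm⟩
    obtain ⟨u, hu⟩ := Fs P.1 k
    have w2 := abs_le.1 hw
    obtain ⟨v, hv⟩ := Fs ((P.2 + 3 * P.1) / 2) (by linarith)
    set w := net.Phi.symm (u, v) with hwd
    have hΦ : net.Phi w = (u, v) := by rw [hwd, net.Phi.apply_symm_apply]
    have rg := rng w
    rw [hΦ] at rg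
    simp only at rg
    have wI : w.1 ∈ Icc (0:ℝ) 2 := ⟨rg.1.2 (by rw [← Fm.le_iff_le, hu, hv]; linarith), rg.2.2 (by rw [hu, hv]; linarith)⟩
    have uu : u < Real.log (r / 8) - 2 * M := by
      rw [← Fm.lt_iff_lt, hu]
      exact ((le_abs_self _).trans (norm_fst_le P)).trans_lt hP
    have wl := (abs_le.1 (net.B.lab_dist wI w.2)).1
    have : net.B.lab w.1 w.2 = u := congrArg Prod.fst hΦ
    rw [this] at wl
    have we : Real.exp w.2 ≤ r / 8 := by
      rw [← Real.le_log_iff_exp_le (by positivity)]; linarith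
    obtain ⟨q1, q2, q3, q4⟩ := qcV (l := w.2) wI
    have ql : |qV w.1 w.2| ≤ r / 8 := by rw [abs_of_nonneg q1]; linarith
    have cl : |cV w.1 w.2| ≤ r / 8 := by linarith
    obtain ⟨i1, i2, i3⟩ := h.imp_spec (ql.trans (by linarith)) (cl.trans (by linarith) : |cV w.1 w.2| ≤ r / 2)
    have i4 : imp D r (qV w.1 w.2) (cV w.1 w.2) ≤ r / 4 := by have := max_le ql cl; linarith
    have sp := (h.V_bd (we.trans (by linarith)) wI).2.2.2
    have E0 := Real.exp_pos w.2
    refine ⟨(imp D r (qV w.1 w.2) (cV w.1 w.2), cV w.1 w.2), pnorm_le (by rw [abs_of_nonneg i1]; exact i4) (by linarith), ?_, ?_⟩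
    · exact (h.bdf_pos (cl.trans (by linarith)) i1 (by linarith)).2.1 (by rw [i3]; positivity)
    · rw [ψ1 _ (fun e => sp.ne' (congrArg Prod.fst e))]
      have er : rV D (imp D r (qV w.1 w.2) (cV w.1 w.2), cV w.1 w.2) = Real.exp w.2 := by
        rw [rV, i3, add_comm, q4, Real.sqrt_sq E0.le]
      have ek : kV D (imp D r (qV w.1 w.2) (cV w.1 w.2), cV w.1 w.2) = w := by
        rw [kV, er, Real.log_exp, cV, mul_div_cancel_left₀ _ E0.ne', sub_add_cancel]
      rw [ek, hΦ]
      simp only [hpr, jV, hu, hv]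
      ext <;> simp; ring
  · intro S hS
    rw [h.leafV net hA hB hS, seg_F Fo Fm]
    have ei : ψ '' S = jV '' ((fun p : 𝕍 => (F p.1, F p.2)) '' ((fun p => net.Phi (kV D p)) '' S)) := by
      rw [image_image, image_image]
      refine image_congr fun p hp => ψ1 p ?_
      rintro rfl
      have : bdf D r 0 < 0 := (hS _ hp).2
      rw [bz] at this; exact lt_irrefl _ this
    rw [ei]
    exact ⟨fun k => ⟨_, k, rfl⟩, fun ⟨S', k1, k2⟩ => by rwa [jV_inj.image_injective k2]⟩
end

section
variable {r : ℝ} {D Ds Dc B : 𝕍 → ℝ}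

theorem NF.touch (h : NF (-1) r D Ds Dc B) {γ dγ : ℝ → 𝕍} {a b t : ℝ} (ht : t ∈ Ioo a b)
    (hn : ∀ t ∈ Ioo a b, ‖γ t‖ < r / 4) (hd : HasDerivAt γ (dγ t) t) (hD : ∀ t ∈ Ioo a b, 0 ≤ D (γ t)) (h0 : D (γ t) = 0) :
    Ds (γ t) * (dγ t).1 + Dc (γ t) * (dγ t).2 = 0 := by
  have r0 := h.r0
  refine IsLocalMin.hasDerivAt_eq_zero ?_ (h.D_deriv (by linarith [hn t ht]) hd)
  filter_upwards [Ioo_mem_nhds ht.1 ht.2] with u hu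
  rw [h0]; exact hD u hu

theorem NF.bnds (h : NF (-1) r D Ds Dc B) {p : 𝕍} (hp : ‖p‖ < r / 4) (h0 : D p = 0) (hp0 : p ≠ 0) :
    |B p * Dc p| < |Ds p| ∧ |B p * Ds p| < |Dc p| := by
  have r0 := h.r0
  have r1 := h.r1
  have hr : ‖p‖ ≤ r := by linarith
  have n0 : 0 < ‖p‖ := norm_pos_iff.2 hp0
  have n1 := h.cone_norm hr h0.ge
  have hE := abs_le.1 (h.E0 hr)
  have a1 := abs_le.1 (h.ds hr)
  have a2 := abs_le.1 (h.dc hr)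
  have a3 := h.db hr
  have e1 := sq_abs p.1
  have e2 := sq_abs p.2
  have m1 : |p.1| ≤ ‖p‖ := norm_fst_le p
  have m2 : |p.2| ≤ ‖p‖ := norm_snd_le p
  have n2 : ‖p‖ / 2 ≤ |p.2| := by
    rw [h0] at hE
    by_contra hcon
    push Not at hcon
    nlinarith [abs_nonneg p.1, abs_nonneg p.2]
  have b1 : |B p| ≤ 1 / 1000 := by linarith
  have u1 : |Ds p| ≤ 3 * ‖p‖ := abs_le.2 ⟨by linarith [neg_abs_le p.1], by linarith [le_abs_self p.1]⟩
  have u2 : |Dc p| ≤ 3 * ‖p‖ := abs_le.2 ⟨by linarith [le_abs_self p.2], by linarith [neg_abs_le p.2]⟩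
  have l1 : ‖p‖ / 2 ≤ |Ds p| := by
    rcases abs_cases p.1 with k | k <;> rcases abs_cases (Ds p) with k' | k' <;> linarith
  have l2 : ‖p‖ / 2 ≤ |Dc p| := by
    rcases abs_cases p.2 with k | k <;> rcases abs_cases (Dc p) with k' | k' <;> linarith
  rw [abs_mul, abs_mul]
  constructor <;> nlinarith [abs_nonneg (B p), abs_nonneg (Ds p), abs_nonneg (Dc p)]

theorem NF.touchH (h : NF (-1) r D Ds Dc B) {γ dγ : ℝ → 𝕍} {a b : ℝ} (hc : CurveOn (QH D B) γ dγ a b)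
    (hn : ∀ t ∈ Ioo a b, ‖γ t‖ < r / 4) : ∀ t ∈ Ioo a b, γ t ≠ 0 → 0 < D (γ t) := by
  have v0 : ∀ t ∈ Ioo a b, 0 < (dγ t).1 ^ 2 := fun t ht => by
    have := QH_ne (hc.2 t ht).2.1 (hc.2 t ht).2.2
    positivity
  have hD : ∀ t ∈ Ioo a b, 0 ≤ D (γ t) := fun t ht => by
    have := (hc.2 t ht).2.2
    unfold QH at this
    exact nonneg_of_mul_nonneg_left (this ▸ sq_nonneg _) (v0 t ht)
  intro t ht h0
  refine (hD t ht).lt_of_ne' fun h1 => ?_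
  have k := h.touch ht hn (hc.2 t ht).1 hD h1
  have k1 := (hc.2 t ht).2.2
  unfold QH at k1
  rw [h1, zero_mul, sq_eq_zero_iff] at k1
  have k2 : (Ds (γ t) - B (γ t) * Dc (γ t)) * (dγ t).1 = 0 := by linear_combination k - Dc (γ t) * k1
  have k3 := (mul_eq_zero.1 k2).resolve_right (by rintro e; have := v0 t ht; simp [e] at this)
  have := (h.bnds (hn t ht) h1 h0).1
  rw [sub_eq_zero.1 k3] at this
  exact lt_irrefl _ this

theorem NF.touchV (h : NF (-1) r D Ds Dc B) {γ dγ : ℝ → 𝕍} {a b : ℝ} (hc : CurveOn (QV D B) γ dγ a b)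
    (hn : ∀ t ∈ Ioo a b, ‖γ t‖ < r / 4) : ∀ t ∈ Ioo a b, 0 < D (γ t) := by
  have r0 := h.r0
  have v1 : ∀ t ∈ Ioo a b, (dγ t).2 ≠ 0 := fun t ht h1 => by
    have := (hc.2 t ht).2.2
    unfold QV at this
    rw [h1] at this
    simp at this
    exact (hc.2 t ht).2.1 (Prod.ext this h1)
  have hD : ∀ t ∈ Ioo a b, 0 ≤ D (γ t) := fun t ht => by
    have := (hc.2 t ht).2.2
    unfold QV at this
    have v0 := v1 t ht
    exact nonneg_of_mul_nonneg_left (this ▸ sq_nonneg _) (by positivity : 0 < (dγ t).2 ^ 2)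
  intro t ht
  refine (hD t ht).lt_of_ne' fun h1 => ?_
  have k1 := (hc.2 t ht).2.2
  unfold QV at k1
  rw [h1, zero_mul, sq_eq_zero_iff] at k1
  by_cases h0 : γ t = 0
  · rw [h0, h.B0, zero_mul, add_zero] at k1
    have d1 := (hc.2 t ht).1.fst'
    have d2 := (hc.2 t ht).1.snd'
    apply v1 t ht
    refine d2.unique ?_
    rw [hasDerivAt_iff_isLittleO] at d1 ⊢
    simp only [h0, k1, Prod.fst_zero, Prod.snd_zero, sub_zero, smul_zero] at d1 ⊢
    refine IsBigO.trans_isLittleO ?_ d1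
    refine IsBigO.of_bound (103 / 100) ?_
    filter_upwards [Ioo_mem_nhds ht.1 ht.2] with u hu
    exact h.cone (by linarith [hn u hu]) (hD u hu)
  · have k := h.touch ht hn (hc.2 t ht).1 hD h1
    have k2 : (Dc (γ t) - B (γ t) * Ds (γ t)) * (dγ t).2 = 0 := by linear_combination k - Ds (γ t) * k1
    have k3 := (mul_eq_zero.1 k2).resolve_right (v1 t ht)
    have := (h.bnds (hn t ht) h1 h0).2
    rw [sub_eq_zero.1 k3] at this
    exact lt_irrefl _ this

theorem NF.sides (h : NF (-1) r D Ds Dc B) {S : Set 𝕍} (hS : S ⊆ Metric.ball 0 (r / 4)) (hD : ∀ p ∈ S, 0 < D p) :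
    (S ⊆ {p | 0 < p.1} ↔ S ⊆ {p | bdf D r p.2 < p.1}) ∧
    (S ⊆ {p | p.1 < 0} ↔ S ⊆ {p | bdf (fun p => D (rfl1 p)) r p.2 < -p.1}) ∧
    (IsPreconnected S → S ⊆ {p | 0 < p.1} ∨ S ⊆ {p | p.1 < 0}) := by
  have r0 := h.r0
  have hn : ∀ p ∈ S, ‖p‖ < r / 4 := fun p hp => by simpa using hS hp
  have m1 : ∀ p ∈ S, |p.1| ≤ r := fun p hp => (norm_fst_le p).trans (by linarith [hn p hp])
  have m2 : ∀ p ∈ S, |p.2| ≤ r / 2 := fun p hp => (norm_snd_le p).trans (by linarith [hn p hp])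
  refine ⟨forall₂_congr fun p hp => ?_, forall₂_congr fun p hp => ?_, fun hc => ?_⟩
  · show 0 < p.1 ↔ bdf D r p.2 < p.1
    refine ⟨fun k => ((h.bdf_pos (m2 p hp) k.le (le_of_abs_le (m1 p hp))).1).1 (hD p hp), fun k => ?_⟩
    linarith [(h.bdf_le (m2 p hp)).2.2.1]
  · show p.1 < 0 ↔ bdf (fun p => D (rfl1 p)) r p.2 < -p.1
    refine ⟨fun k => ((h.reflect.bdf_pos (m2 p hp) (s := -p.1) (by linarith) (by linarith [(abs_le.1 (m1 p hp)).1])).1).1 ?_, fun k => ?_⟩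
    · simpa [rfl1_apply] using hD p hp
    · linarith [(h.reflect.bdf_le (m2 p hp)).2.2.1]
  · refine hc.subset_or_subset (isOpen_lt continuous_const continuous_fst) (isOpen_lt continuous_fst continuous_const) ?_ ?_
    · rw [Set.disjoint_left]
      intro p k1 k2
      exact lt_asymm (show 0 < p.1 from k1) (show p.1 < 0 from k2)
    · intro p hp
      rcases lt_trichotomy p.1 0 with k | k | k
      · exact Or.inr k
      · exfalso
        have := h.cone (by linarith [hn p hp]) (hD p hp).le
        rw [k, abs_zero, mul_zero] at this
        have k2 := abs_nonpos_iff.1 this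
        have k3 : p = 0 := Prod.ext k k2
        have := hD p hp
        rw [k3, h.D0] at this
        exact lt_irrefl _ this
      · exact Or.inl k

theorem CurveOn.preconn {Q : 𝕍 → 𝕍 → Prop} {γ dγ : ℝ → 𝕍} {a b : ℝ} (hc : CurveOn Q γ dγ a b) :
    IsPreconnected (γ '' Ioo a b) :=
  isPreconnected_Ioo.image _ fun t ht => (hc.2 t ht).1.continuousAt.continuousWithinAt

def KH (J : Set 𝕍 → Prop) : Fin 2 → Set 𝕍 → Prop :=
  Fam2 J {P | |P.2| < P.1} (fun S => J (rfl1 '' S)) {P | |P.2| < -P.1}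

theorem TEF_H1 (h : NF (-1) r D Ds Dc B) : TEF (Fam (Curve (QH D B)) {p | 0 < p.1} {p | p.1 < 0})
    (fun (i : Fin 3) S => match i with
      | 0 => KH JH 0 S ∨ KH JH 1 S
      | 1 => KH JH 0 S
      | 2 => KH JH 1 S) := by
  obtain ⟨ψ, hR⟩ := secH h
  obtain ⟨ψ', hL⟩ := secH h.reflect
  obtain ⟨e, e1, e2, e3, e4⟩ := glue hR hL
  have key : ∀ S, S ⊆ e.source → 
      (Fam (Curve (QH D B)) {p | 0 < p.1} {p | p.1 < 0} 1 S ↔ KH JH 0 (e '' S)) ∧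
      (Fam (Curve (QH D B)) {p | 0 < p.1} {p | p.1 < 0} 2 S ↔ KH JH 1 (e '' S)) ∧
      (Fam (Curve (QH D B)) {p | 0 < p.1} {p | p.1 < 0} 0 S ↔ Fam (Curve (QH D B)) {p | 0 < p.1} {p | p.1 < 0} 1 S ∨ 
        Fam (Curve (QH D B)) {p | 0 < p.1} {p | p.1 < 0} 2 S) := by
    intro S hS
    have sD : Curve (QH D B) S → 0 ∉ S → ∀ p ∈ S, 0 < D p := by
      rintro ⟨γ, dγ, a, b, hc, rfl⟩ h0 _ ⟨t, ht, rfl⟩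
      refine h.touchH hc (fun t ht => by simpa using e3 (hS (mem_image_of_mem γ ht))) t ht fun k => h0 ⟨t, ht, k⟩
    have z1 : S ⊆ {p | 0 < p.1} → 0 ∉ S := fun k k' => lt_irrefl (0 : ℝ) (k k')
    have z2 : S ⊆ {p | p.1 < 0} → 0 ∉ S := fun k k' => lt_irrefl (0 : ℝ) (k k')
    have z3 : S ⊆ {p | bdf D r p.2 < p.1} → 0 ∉ S := fun k k' => by
      have : bdf D r 0 < 0 := k k'
      rw [hR.ξz] at this; exact lt_irrefl _ this
    have z4 : S ⊆ {p | bdf (fun p => D (rfl1 p)) r p.2 < -p.1} → 0 ∉ S := fun k k' => by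
      have : bdf (fun p => D (rfl1 p)) r 0 < -0 := k k'
      rw [hL.ξz, neg_zero] at this; exact lt_irrefl _ this
    refine ⟨?_, ?_, ?_⟩
    · rw [KH, ← e4 0 S hS]
      show Curve _ S ∧ _ ↔ Curve _ S ∧ _
      exact ⟨fun k => ⟨k.1, (h.sides (hS.trans e3) (sD k.1 (z1 k.2))).1.1 k.2⟩,
        fun k => ⟨k.1, (h.sides (hS.trans e3) (sD k.1 (z3 k.2))).1.2 k.2⟩⟩
    · rw [KH, ← e4 1 S hS]
      show Curve _ S ∧ _ ↔ Curve _ (rfl1 '' S) ∧ _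
      rw [← curve_refl_H]
      exact ⟨fun k => ⟨k.1, (h.sides (hS.trans e3) (sD k.1 (z2 k.2))).2.1.1 k.2⟩,
        fun k => ⟨k.1, (h.sides (hS.trans e3) (sD k.1 (z4 k.2))).2.1.2 k.2⟩⟩
    · show Curve _ S ∧ _ ↔ (Curve _ S ∧ _) ∨ (Curve _ S ∧ _)
      constructor
      · rintro ⟨k1, k2⟩
        have pc : IsPreconnected S := by
          obtain ⟨γ, dγ, a, b, hc, rfl⟩ := k1
          exact hc.preconn
        exact ((h.sides (hS.trans e3) (sD k1 k2)).2.2 pc).imp (fun k => ⟨k1, k⟩) fun k => ⟨k1, k⟩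
      · rintro (k | k)
        exacts [⟨k.1, z1 k.2⟩, ⟨k.1, z2 k.2⟩]
  refine ⟨e, e1, e2, fun i S hS => ?_⟩
  obtain ⟨k1, k2, k3⟩ := key S hS
  match i with
  | 0 => show Fam _ _ _ 0 S ↔ _; rw [k3, k1, k2]
  | 1 => exact k1
  | 2 => exact k2

theorem TEF_V1 (h : NF (-1) r D Ds Dc B) : TEF (fun _ : Unit => Curve (QV D B))
    (fun _ S => KH JV 0 S ∨ KH JV 1 S) := by
  obtain ⟨g, ψ, hR⟩ := secV h
  obtain ⟨g', ψ', hL⟩ := secV h.reflect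
  obtain ⟨e, e1, e2, e3, e4⟩ := glue hR hL
  refine ⟨e, e1, e2, fun _ S hS => ?_⟩
  have sD : Curve (QV D B) S → ∀ p ∈ S, 0 < D p := by
    rintro ⟨γ, dγ, a, b, hc, rfl⟩ _ ⟨t, ht, rfl⟩
    exact h.touchV hc (fun t ht => by simpa using e3 (hS (mem_image_of_mem γ ht))) t ht
  rw [KH]
  beta_reduce
  rw [← e4 0 S hS, ← e4 1 S hS]
  show Curve _ S ↔ (Curve _ S ∧ _) ∨ (Curve _ (rfl1 '' S) ∧ _)
  rw [← curve_refl_V]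
  constructor
  · intro k1
    have pc : IsPreconnected S := by
      obtain ⟨γ, dγ, a, b, hc, rfl⟩ := k1
      exact hc.preconn
    obtain ⟨s1, s2, s3⟩ := h.sides (hS.trans e3) (sD k1)
    exact (s3 pc).imp (fun k => ⟨k1, s1.1 k⟩) fun k => ⟨k1, s2.1 k⟩
  · rintro (k | k)
    exacts [k.1, k.1]

end

section
variable {r : ℝ} {D Ds Dc B : 𝕍 → ℝ} {r' : ℝ} {D' Ds' Dc' B' : 𝕍 → ℝ}

theorem TEF_N (h : NF 1 r D Ds Dc B) (h' : NF 1 r' D' Ds' Dc' B') :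
    TEF (fun _ : Unit => Curve (QH D B)) (fun _ => Curve (QH D' B')) :=
  origin h h' (by simp) ((caseN h).trans (caseN h').symm)

theorem TEF_H (h : NF (-1) r D Ds Dc B) (h' : NF (-1) r' D' Ds' Dc' B') :
    TEF (fun _ : Unit => Curve (QH D B)) (fun _ => Curve (QH D' B')) :=
  origin h h' (by simp) ((TEF_H1 h).trans (TEF_H1 h').symm)

theorem TEF_V (h : NF (-1) r D Ds Dc B) (h' : NF (-1) r' D' Ds' Dc' B') :
    TEF (fun _ : Unit => Curve (QV D B)) (fun _ => Curve (QV D' B')) :=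
  (TEF_V1 h).trans (TEF_V1 h').symm

end

theorem jet_int {F : Type} [NormedAddCommGroup F] [NormedSpace ℝ F] {g : 𝕍 → F} {k : ℕ}
    (hg : ∀ᶠ p in nhds (0 : 𝕍), DifferentiableAt ℝ g p) (g0 : g 0 = 0) (h : fderiv ℝ g =O[nhds 0] fun p => ‖p‖ ^ k) :
    g =O[nhds 0] fun p => ‖p‖ ^ (k + 1) := by
  obtain ⟨C, hC⟩ := h.bound
  obtain ⟨δ, δ0, hδ⟩ := Metric.eventually_nhds_iff_ball.1 (hC.and hg)
  refine IsBigO.of_bound |C| ?_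
  filter_upwards [Metric.ball_mem_nhds (0 : 𝕍) δ0] with p hp
  have hp' : ‖p‖ < δ := by simpa using hp
  have := Convex.norm_image_sub_le_of_norm_fderiv_le (𝕜 := ℝ) (f := g) (s := Metric.closedBall 0 ‖p‖) (C := |C| * ‖p‖ ^ k) (x := 0) (y := p)
    (fun x hx => (hδ x (by simp at hx ⊢; linarith)).2) (fun x hx => ?_) (convex_closedBall _ _) (by simp) (by simp)
  · rw [g0, sub_zero, sub_zero] at this
    rw [norm_pow, norm_norm, pow_succ, ← mul_assoc]; exact this
  · have h1 := (hδ x (by simp at hx ⊢; linarith)).1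
    rw [norm_pow, norm_norm] at h1
    simp at hx
    refine h1.trans (mul_le_mul (le_abs_self C) (pow_le_pow_left₀ (norm_nonneg _) hx _) (by positivity) (abs_nonneg _))

theorem jet_landau {F : Type} [NormedAddCommGroup F] [NormedSpace ℝ F] {g : 𝕍 → F} {m : ℕ}
    (hg : ContDiffAt ℝ (⊤ : ℕ∞) g 0) (h : g =o[nhds 0] fun p => ‖p‖ ^ (m + 2))
    (h2 : fderiv ℝ (fderiv ℝ g) =O[nhds 0] fun p => ‖p‖ ^ m) : fderiv ℝ g =o[nhds 0] fun p => ‖p‖ ^ (m + 1) := by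
  obtain ⟨C, C0, hC⟩ := h2.exists_pos
  have hC := hC.bound
  have s1 : ∀ᶠ p in nhds (0 : 𝕍), ContDiffAt ℝ 2 g p := (hg.of_le (show ((2 : ℕ∞) : WithTop ℕ∞) ≤ ((⊤ : ℕ∞) : WithTop ℕ∞) from WithTop.coe_le_coe.2 le_top)).eventually (by simp)
  rw [isLittleO_iff]
  intro c c0
  set η := min 1 (c / (2 * (C * 2 ^ m))) with hη
  have η0 : 0 < η := lt_min one_pos (by positivity)
  have η1 : η ≤ 1 := min_le_left _ _
  have η2 : C * 2 ^ m * η ≤ c / 2 := by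
    have := min_le_right 1 (c / (2 * (C * 2 ^ m)))
    rw [← hη, le_div_iff₀ (by positivity)] at this
    linarith
  set κ := c * η / (4 * 2 ^ (m + 2)) with hκ
  have κ0 : 0 < κ := by positivity
  obtain ⟨δ, δ0, hδ⟩ := Metric.eventually_nhds_iff_ball.1 ((hC.and s1).and (isLittleO_iff.1 h κ0))
  filter_upwards [Metric.ball_mem_nhds (0 : 𝕍) (half_pos δ0)] with p hp
  have hp' : ‖p‖ < δ / 2 := by simpa using hp
  rw [norm_pow, norm_norm]
  rcases eq_or_ne p 0 with rfl | p0
  · have hz : g =O[nhds 0] fun p : 𝕍 => ‖p‖ ^ (m + 2) := h.isBigO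
    have : HasFDerivAt g (0 : 𝕍 →L[ℝ] F) 0 := by
      exact IsBigO.hasFDerivAt (x₀ := (0 : 𝕍)) (n := m + 2) (by simpa using hz) (by omega)
    rw [this.fderiv]; simp
  have n0 : 0 < ‖p‖ := norm_pos_iff.2 p0
  have B1 : ∀ q, ‖q‖ ≤ 2 * ‖p‖ → ‖fderiv ℝ (fderiv ℝ g) q‖ ≤ C * (2 * ‖p‖) ^ m ∧ ContDiffAt ℝ 2 g q ∧ ‖g q‖ ≤ κ * (2 * ‖p‖) ^ (m + 2) := by
    intro q hq
    obtain ⟨⟨a1, a2⟩, a3⟩ := hδ q (by simp; linarith)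
    rw [norm_pow, norm_norm] at a1 a3
    exact ⟨a1.trans (by gcongr), a2, a3.trans (by gcongr)⟩
  have W : ∀ w : 𝕍, ‖w‖ = η * ‖p‖ → ‖fderiv ℝ g p w‖ ≤ c * ‖p‖ ^ (m + 1) * ‖w‖ := by
    intro w hw
    have wp : ‖w‖ ≤ ‖p‖ := by rw [hw]; nlinarith
    have bq : ∀ q ∈ Metric.closedBall p ‖w‖, ‖q‖ ≤ 2 * ‖p‖ := by
      intro q hq
      rw [mem_closedBall_iff_norm] at hq
      have := norm_le_norm_add_norm_sub' q p
      linarith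
    have D1 : ∀ q ∈ Metric.closedBall p ‖w‖, ‖fderiv ℝ g q - fderiv ℝ g p‖ ≤ C * (2 * ‖p‖) ^ m * ‖w‖ := by
      intro q hq
      refine (Convex.norm_image_sub_le_of_norm_fderiv_le (𝕜 := ℝ) (f := fderiv ℝ g) (s := Metric.closedBall p ‖w‖) (C := C * (2 * ‖p‖) ^ m)
        (fun x hx => ?_) (fun x hx => (B1 x (bq x hx)).1) (convex_closedBall _ _) (by simp) hq).trans ?_
      · exact ((B1 x (bq x hx)).2.1.fderiv_right (m := 1) (by norm_num)).differentiableAt (by norm_num)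
      · rw [mem_closedBall_iff_norm] at hq
        gcongr
    have D2 := Convex.norm_image_sub_le_of_norm_hasFDerivWithin_le' (𝕜 := ℝ) (f := g) (s := Metric.closedBall p ‖w‖) (f' := fderiv ℝ g) (x := p) (y := p + w) (φ := fderiv ℝ g p)
      (C := C * (2 * ‖p‖) ^ m * ‖w‖) (fun x hx => ((B1 x (bq x hx)).2.1.differentiableAt (by norm_num)).hasFDerivAt.hasFDerivWithinAt)
      D1 (convex_closedBall _ _) (by simp) (by simp)
    rw [add_sub_cancel_left] at D2
    have G1 := (B1 p (by linarith)).2.2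
    have G2 := (B1 (p + w) (bq _ (by simp))).2.2
    have tri : ‖fderiv ℝ g p w‖ ≤ ‖g (p + w) - g p - fderiv ℝ g p w‖ + (‖g (p + w)‖ + ‖g p‖) := by
      have e : fderiv ℝ g p w = -(g (p + w) - g p - fderiv ℝ g p w) + (g (p + w) - g p) := by abel
      calc _ ≤ ‖-(g (p + w) - g p - fderiv ℝ g p w)‖ + ‖g (p + w) - g p‖ := by
            conv_lhs => rw [e]
            exact norm_add_le _ _
        _ ≤ _ := by rw [norm_neg]; gcongr; exact norm_sub_le _ _
    have e1 : κ * (2 * ‖p‖) ^ (m + 2) = c / 4 * ‖p‖ ^ (m + 1) * ‖w‖ := by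
      rw [hκ, hw, mul_pow]; field_simp; ring
    have e2 : C * (2 * ‖p‖) ^ m * ‖w‖ * ‖w‖ = C * 2 ^ m * η * (‖p‖ ^ (m + 1) * ‖w‖) := by
      rw [mul_pow]
      nth_rewrite 1 [hw]; ring
    have e3 : C * 2 ^ m * η * (‖p‖ ^ (m + 1) * ‖w‖) ≤ c / 2 * (‖p‖ ^ (m + 1) * ‖w‖) := by gcongr
    linarith
  refine ContinuousLinearMap.opNorm_le_bound _ (by positivity) fun w => ?_
  rcases eq_or_ne w 0 with rfl | w0
  · simp
  have nw : 0 < ‖w‖ := norm_pos_iff.2 w0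
  have := W ((η * ‖p‖ / ‖w‖) • w) (by rw [norm_smul, Real.norm_of_nonneg (by positivity)]; field_simp)
  rw [map_smul, norm_smul, norm_smul, Real.norm_of_nonneg (by positivity)] at this
  have k : 0 < η * ‖p‖ / ‖w‖ := by positivity
  refine le_of_mul_le_mul_left ?_ k
  linarith

theorem ContDiffAt.fd {F : Type} [NormedAddCommGroup F] [NormedSpace ℝ F] {g : 𝕍 → F}
    (hg : ContDiffAt ℝ (⊤ : ℕ∞) g 0) : ContDiffAt ℝ (⊤ : ℕ∞) (fderiv ℝ g) 0 :=
  hg.fderiv_right (by exact_mod_cast le_top)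

theorem ContDiffAt.evd {F : Type} [NormedAddCommGroup F] [NormedSpace ℝ F] {g : 𝕍 → F}
    (hg : ContDiffAt ℝ (⊤ : ℕ∞) g 0) : ∀ᶠ p in nhds (0 : 𝕍), DifferentiableAt ℝ g p :=
  ((hg.of_le (m := 1) (mod_cast (le_top : ((1 : ℕ) : ℕ∞) ≤ ⊤))).eventually (by simp)).mono fun p hp => hp.differentiableAt (by simp)

theorem jet_zero {F : Type} [NormedAddCommGroup F] [NormedSpace ℝ F] {g : 𝕍 → F} {m : ℕ}
    (h : g =o[nhds 0] fun p => ‖p‖ ^ m) : g 0 = 0 := by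
  have := (isLittleO_iff.1 h one_pos).self_of_nhds
  cases m with
  | zero =>
    have h2 : g =o[nhds 0] fun p => (1 : ℝ) := by simpa using h
    by_contra hc
    have := (isLittleO_iff.1 h2 (half_pos (norm_pos_iff.2 hc))).self_of_nhds
    simp only [norm_one, mul_one] at this
    linarith [norm_pos_iff.2 hc]
  | succ k => simpa using this

theorem jet_all (m : ℕ) : ∀ (F : Type) [NormedAddCommGroup F] [NormedSpace ℝ F] (g : 𝕍 → F),
    ContDiffAt ℝ (⊤ : ℕ∞) g 0 → g =o[nhds 0] (fun p => ‖p‖ ^ m) → g =O[nhds 0] (fun p => ‖p‖ ^ (m + 1)) ∧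
      ∀ k, m = k + 1 → fderiv ℝ g =o[nhds 0] fun p => ‖p‖ ^ k := by
  induction m using Nat.strong_induction_on with
  | _ m ih =>
    intro F _ _ g hg h
    have g0 := jet_zero h
    have pw : ∀ a b : ℕ, a ≤ b → (fun p : 𝕍 => ‖p‖ ^ b) =O[nhds 0] fun p => ‖p‖ ^ a := by
      intro a b hab
      refine IsBigO.of_bound 1 ?_
      filter_upwards [Metric.ball_mem_nhds (0 : 𝕍) one_pos] with p hp
      have : ‖p‖ < 1 := by simpa using hp
      rw [norm_pow, norm_pow, norm_norm, one_mul]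
      exact pow_le_pow_of_le_one (norm_nonneg _) this.le hab
    have cont : ∀ {G : Type} [NormedAddCommGroup G] [NormedSpace ℝ G] (u : 𝕍 → G), ContDiffAt ℝ (⊤ : ℕ∞) u 0 →
        u =O[nhds 0] fun p => ‖p‖ ^ 0 := by
      intro G _ _ u hu
      simpa using hu.continuousAt.isBigO_one ℝ
    match m with
    | 0 => exact ⟨jet_int hg.evd g0 (cont _ hg.fd), fun k hk => by omega⟩
    | 1 =>
      have d : fderiv ℝ g =o[nhds 0] fun p => ‖p‖ ^ 0 := by
        have : HasFDerivAt g (0 : 𝕍 →L[ℝ] F) 0 := by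
          rw [hasFDerivAt_iff_isLittleO_nhds_zero]
          have h3 : g =o[nhds 0] fun p => ‖p‖ := by simpa using h
          simpa [g0] using h3.of_norm_right
        have c := hg.fd.continuousAt.tendsto
        rw [this.fderiv] at c
        simpa using c
      refine ⟨jet_int hg.evd g0 (ih 0 (by omega) _ _ hg.fd d).1, fun k hk => ?_⟩
      obtain rfl : k = 0 := by omega
      exact d
    | m + 2 =>
      have d2 : fderiv ℝ (fderiv ℝ g) =O[nhds 0] fun p => ‖p‖ ^ m := by
        have d1 := (ih (m + 1) (by omega) _ g hg (h.trans_isBigO (pw _ _ (by omega)))).2 m rfl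
        match m with
        | 0 => exact cont _ hg.fd.fd
        | m + 1 => exact (ih m (by omega) _ _ hg.fd.fd ((ih (m + 1) (by omega) _ _ hg.fd d1).2 m rfl)).1
      have d := jet_landau hg h d2
      refine ⟨jet_int hg.evd g0 (ih (m + 1) (by omega) _ _ hg.fd d).1, fun k hk => ?_⟩
      obtain rfl : k = m + 1 := by omega
      exact d

theorem lip_of {u : 𝕍 → ℝ} (hu : ContDiffAt ℝ (⊤ : ℕ∞) u 0) (h : u =o[nhds 0] fun p => ‖p‖ ^ 1) :
    ∃ δ > 0, ∀ p p' : 𝕍, ‖p‖ < δ → ‖p'‖ < δ → |u p - u p'| ≤ ‖p - p'‖ / 100 := by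
  have d : HasFDerivAt u (0 : 𝕍 →L[ℝ] ℝ) 0 := by
    have u0 := jet_zero h
    have h3 : u =o[nhds 0] fun p => ‖p‖ := by simpa using h
    rw [hasFDerivAt_iff_isLittleO_nhds_zero]
    simpa [u0] using h3.of_norm_right
  have sd := hu.hasStrictFDerivAt (by simp)
  rw [d.fderiv] at sd
  obtain ⟨δ, δ0, hδ⟩ := Metric.eventually_nhds_iff_ball.1 (isLittleO_iff.1 sd.isLittleO (by norm_num : (0 : ℝ) < 1 / 100))
  refine ⟨δ, δ0, fun p p' hp hp' => ?_⟩
  have := hδ (p, p') (by rw [mem_ball_iff_norm]; simpa [Prod.norm_def] using ⟨max_lt_iff.1 hp, max_lt_iff.1 hp'⟩)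
  simp only [_root_.zero_apply, sub_zero] at this
  rw [Real.norm_eq_abs] at this
  linarith

theorem NF_of {σ : ℝ} {D B : 𝕍 → ℝ} (hD : ContDiffAt ℝ (⊤ : ℕ∞) D 0) (hB : ContDiffAt ℝ (⊤ : ℕ∞) B 0)
    (h1 : (fun p => D p - (p.1 ^ 2 + σ * p.2 ^ 2)) =o[nhds 0] fun p => ‖p‖ ^ 2) (h2 : B =o[nhds 0] fun p => ‖p‖ ^ 1) :
    ∃ r Ds Dc, NF σ r D Ds Dc B := by
  set g : 𝕍 → ℝ := fun p => D p - (p.1 ^ 2 + σ * p.2 ^ 2) with hg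
  have gs : ContDiffAt ℝ (⊤ : ℕ∞) g 0 := hD.sub (by fun_prop)
  have gd : fderiv ℝ g =o[nhds 0] fun p => ‖p‖ ^ 1 := (jet_all 2 _ g gs h1).2 1 rfl
  have g0 := jet_zero h1
  have gd0 := jet_zero gd
  have comp : ∀ w : 𝕍, (fun p => fderiv ℝ g p w) =o[nhds 0] fun p => ‖p‖ ^ 1 := by
    intro w
    refine IsBigO.trans_isLittleO ?_ gd
    refine IsBigO.of_bound ‖w‖ (Eventually.of_forall fun p => ?_)
    rw [mul_comm]; exact (fderiv ℝ g p).le_opNorm w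
  have sm : ∀ w : 𝕍, ContDiffAt ℝ (⊤ : ℕ∞) (fun p => fderiv ℝ g p w) 0 := fun w => gs.fd.clm_apply contDiffAt_const
  obtain ⟨δ1, p1, l1⟩ := lip_of (sm (1, 0)) (comp (1, 0))
  obtain ⟨δ2, p2, l2⟩ := lip_of (sm (0, 1)) (comp (0, 1))
  obtain ⟨δ3, p3, l3⟩ := lip_of hB h2
  obtain ⟨δ4, p4, l4⟩ := Metric.eventually_nhds_iff_ball.1 hD.evd
  have key : ∀ p : 𝕍, ‖p‖ < δ4 → ∀ w : 𝕍, fderiv ℝ g p w = fderiv ℝ D p w - (2 * p.1 * w.1 + 2 * σ * p.2 * w.2) := by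
    intro p hp w
    have d1 := (l4 p (by simpa using hp)).hasFDerivAt
    have d2 : HasFDerivAt (fun p : 𝕍 => p.1 ^ 2 + σ * p.2 ^ 2) ((2 * p.1) • ContinuousLinearMap.fst ℝ ℝ ℝ + (2 * σ * p.2) • ContinuousLinearMap.snd ℝ ℝ ℝ) p := by
      refine ((hasFDerivAt_fst.pow 2).add ((hasFDerivAt_snd.pow 2).const_mul σ)).congr_fderiv ?_
      ext <;> simp
      ring
    rw [(show HasFDerivAt g _ p from d1.sub d2).fderiv]
    simp
  have hr : 0 < min (min δ1 δ2) (min δ3 δ4) := lt_min (lt_min p1 p2) (lt_min p3 p4)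
  set r := min (1 / 10) (min (min δ1 δ2) (min δ3 δ4) / 2) with hrr
  have r0 : 0 < r := lt_min (by norm_num) (half_pos hr)
  have rl : r < min (min δ1 δ2) (min δ3 δ4) := (min_le_right _ _).trans_lt (half_lt_self hr)
  obtain ⟨⟨r1, r2⟩, r3, r4⟩ : (r < δ1 ∧ r < δ2) ∧ r < δ3 ∧ r < δ4 := by simpa [lt_min_iff] using rl
  refine ⟨r, fun p => fderiv ℝ D p (1, 0), fun p => fderiv ℝ D p (0, 1), r0, min_le_left _ _, fun p hp => ?_, ?_, ?_, ?_, jet_zero h2,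
    fun p p' hp hp' => ?_, fun p p' hp hp' => ?_, fun p p' hp hp' => l3 p p' (hp.trans_lt r3) (hp'.trans_lt r3)⟩
  · refine (l4 p (by simpa using hp.trans_lt r4)).hasFDerivAt.congr_fderiv ?_
    ext <;> simp
  · simpa [hg] using g0
  · have := key 0 (by simpa using p4) (1, 0)
    rw [gd0] at this; simpa using this.symm
  · have := key 0 (by simpa using p4) (0, 1)
    rw [gd0] at this; simpa using this.symm
  · have := l1 p p' (hp.trans_lt r1) (hp'.trans_lt r1)
    rw [key p (hp.trans_lt r4), key p' (hp'.trans_lt r4)] at this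
    simpa using this
  · have := l2 p p' (hp.trans_lt r2) (hp'.trans_lt r2)
    rw [key p (hp.trans_lt r4), key p' (hp'.trans_lt r4)] at this
    simpa using this

theorem pdx_eq {f : 𝕍 → ℝ} (hf : ContDiff ℝ (⊤ : ℕ∞) f) : pdx f = fun p => fderiv ℝ f p (1, 0) := by
  funext p
  have h1 : HasDerivAt (fun s : ℝ => ((s, p.2) : 𝕍)) (1, 0) p.1 := (hasDerivAt_id _).prodMk (hasDerivAt_const _ _)
  exact ((hf.differentiable (by simp) (p.1, p.2)).hasFDerivAt.comp_hasDerivAt p.1 h1).deriv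

theorem pdy_eq {f : 𝕍 → ℝ} (hf : ContDiff ℝ (⊤ : ℕ∞) f) : pdy f = fun p => fderiv ℝ f p (0, 1) := by
  funext p
  have h1 : HasDerivAt (fun s : ℝ => ((p.1, s) : 𝕍)) (0, 1) p.2 := (hasDerivAt_const _ _).prodMk (hasDerivAt_id _)
  exact ((hf.differentiable (by simp) (p.1, p.2)).hasFDerivAt.comp_hasDerivAt p.2 h1).deriv

theorem fd_smooth {f : 𝕍 → ℝ} (hf : ContDiff ℝ (⊤ : ℕ∞) f) (w : 𝕍) : ContDiff ℝ (⊤ : ℕ∞) fun p => fderiv ℝ f p w :=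
  (hf.fderiv_right (by exact_mod_cast le_top)).clm_apply contDiff_const

theorem fd_jet {f P : 𝕍 → ℝ} (hf : ContDiff ℝ (⊤ : ℕ∞) f) (hP : ContDiff ℝ (⊤ : ℕ∞) P) {m : ℕ} (h : HasJetAt0 f P (m + 1)) (w : 𝕍) :
    HasJetAt0 (fun p => fderiv ℝ f p w) (fun p => fderiv ℝ P p w) m := by
  have := (jet_all (m + 1) _ _ (hf.sub hP).contDiffAt h).2 m rfl
  unfold HasJetAt0
  refine IsBigO.trans_isLittleO ?_ this
  refine IsBigO.of_bound ‖w‖ (Eventually.of_forall fun p => ?_)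
  have e : fderiv ℝ f p w - fderiv ℝ P p w = fderiv ℝ (fun p => f p - P p) p w := by
    rw [fderiv_fun_sub (hf.differentiable (by simp) p) (hP.differentiable (by simp) p)]; rfl
  rw [e, mul_comm]; exact ContinuousLinearMap.le_opNorm _ w

theorem jets {ε α β : ℝ} {f : 𝕍 → ℝ} (hf : ContDiff ℝ (⊤ : ℕ∞) f)
    (hjet : HasJetAt0 f
      (fun p => p.2 ^ 2 + ε * p.1 ^ 4 + α * p.1 ^ 3 * p.2 + β * p.1 ^ 2 * p.2 ^ 2) 4) :
    (ContDiff ℝ (⊤ : ℕ∞) (fxx f) ∧ ContDiff ℝ (⊤ : ℕ∞) (fxy f) ∧ ContDiff ℝ (⊤ : ℕ∞) (fyy f)) ∧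
    HasJetAt0 (fxx f) (fun p => 12 * ε * p.1 ^ 2 + 6 * α * p.1 * p.2 + 2 * β * p.2 ^ 2) 2 ∧
    HasJetAt0 (fxy f) (fun p => 3 * α * p.1 ^ 2 + 4 * β * p.1 * p.2) 2 ∧ HasJetAt0 (fyy f) (fun p => 2 + 2 * β * p.1 ^ 2) 2 := by
  set P : 𝕍 → ℝ := fun p => p.2 ^ 2 + ε * p.1 ^ 4 + α * p.1 ^ 3 * p.2 + β * p.1 ^ 2 * p.2 ^ 2 with hP
  have sP : ContDiff ℝ (⊤ : ℕ∞) P := by fun_prop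
  have Px : pdx P = fun p => 4 * ε * p.1 ^ 3 + 3 * α * p.1 ^ 2 * p.2 + 2 * β * p.1 * p.2 ^ 2 := by
    funext p; unfold pdx; simp only [hP]
    rw [deriv_fun_add (by fun_prop) (by fun_prop), deriv_fun_add (by fun_prop) (by fun_prop), deriv_fun_add (by fun_prop) (by fun_prop)]
    simp; ring
  have Py : pdy P = fun p => 2 * p.2 + α * p.1 ^ 3 + 2 * β * p.1 ^ 2 * p.2 := by
    funext p; unfold pdy; simp only [hP]
    rw [deriv_fun_add (by fun_prop) (by fun_prop), deriv_fun_add (by fun_prop) (by fun_prop), deriv_fun_add (by fun_prop) (by fun_prop)]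
    simp; ring
  have Pxx : pdx (pdx P) = fun p => 12 * ε * p.1 ^ 2 + 6 * α * p.1 * p.2 + 2 * β * p.2 ^ 2 := by
    rw [Px]; funext p; unfold pdx
    rw [deriv_fun_add (by fun_prop) (by fun_prop), deriv_fun_add (by fun_prop) (by fun_prop)]
    simp; ring
  have Pxy : pdy (pdx P) = fun p => 3 * α * p.1 ^ 2 + 4 * β * p.1 * p.2 := by
    rw [Px]; funext p; unfold pdy
    rw [deriv_fun_add (by fun_prop) (by fun_prop), deriv_fun_add (by fun_prop) (by fun_prop)]
    simp; ring
  have Pyy : pdy (pdy P) = fun p => 2 + 2 * β * p.1 ^ 2 := by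
    rw [Py]; funext p; unfold pdy
    rw [deriv_fun_add (by fun_prop) (by fun_prop), deriv_fun_add (by fun_prop) (by fun_prop)]
    simp
  rw [← Pxx, ← Pxy, ← Pyy]
  unfold fxx fxy fyy
  have fx := fd_smooth hf (1, 0)
  have fy := fd_smooth hf (0, 1)
  have px := fd_smooth sP (1, 0)
  have py := fd_smooth sP (0, 1)
  have jx := fd_jet hf sP hjet (1, 0)
  have jy := fd_jet hf sP hjet (0, 1)
  rw [pdx_eq hf, pdy_eq hf, pdx_eq sP, pdy_eq sP, pdx_eq fx, pdy_eq fx, pdy_eq fy, pdx_eq px, pdy_eq px, pdy_eq py]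
  exact ⟨⟨fd_smooth fx _, fd_smooth fx _, fd_smooth fy _⟩, fd_jet fx px jx _, fd_jet fx px jx _, fd_jet fy py jy _⟩

def Lch (s k t : ℝ) (hs : s ≠ 0) (ht : t ≠ 0) : 𝕍 ≃L[ℝ] 𝕍 :=
  ContinuousLinearEquiv.equivOfInverse
    ((s • ContinuousLinearMap.fst ℝ ℝ ℝ + k • ContinuousLinearMap.snd ℝ ℝ ℝ).prod (t • ContinuousLinearMap.snd ℝ ℝ ℝ))
    ((s⁻¹ • ContinuousLinearMap.fst ℝ ℝ ℝ - (k / (s * t)) • ContinuousLinearMap.snd ℝ ℝ ℝ).prod (t⁻¹ • ContinuousLinearMap.snd ℝ ℝ ℝ))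
    (fun p => by ext <;> simp <;> field_simp; ring)
    (fun p => by ext <;> simp <;> field_simp; ring)

theorem Lch_apply {s k t : ℝ} (hs : s ≠ 0) (ht : t ≠ 0) (p : 𝕍) : Lch s k t hs ht p = (s * p.1 + k * p.2, t * p.2) := by
  simp [Lch]

theorem reduce {a b c : 𝕍 → ℝ} {ε α β κ s k t σ : ℝ} (sa : ContDiff ℝ (⊤ : ℕ∞) a) (sb : ContDiff ℝ (⊤ : ℕ∞) b)
    (sc : ContDiff ℝ (⊤ : ℕ∞) c) (a0 : a 0 = 2) (jb : b =o[nhds 0] fun p => ‖p‖ ^ 1)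
    (jc : HasJetAt0 c (fun p => 12 * ε * p.1 ^ 2 + 6 * α * p.1 * p.2 + 2 * β * p.2 ^ 2) 2) (hs : s ≠ 0) (ht : t ≠ 0)
    (hε : ε ^ 2 = 1) (hk : k = - ε * α * t / 4) (hκ : κ = β - 3 * ε * α ^ 2 / 8) (hst : t ^ 2 = 6 * s ^ 4) (hσ : s ^ 2 * κ = - σ) :
    ∃ D B : 𝕍 → ℝ, ContDiffAt ℝ (⊤ : ℕ∞) D 0 ∧ ContDiffAt ℝ (⊤ : ℕ∞) B 0 ∧
      (fun p => D p - (- ε * p.1 ^ 2 + σ * p.2 ^ 2)) =o[nhds 0] (fun p => ‖p‖ ^ 2) ∧ B =o[nhds 0] (fun p => ‖p‖ ^ 1) ∧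
      TEF (fun _ : Unit => Curve (QH D B)) (fun _ => Curve fun p v => BDE a b c p v = 0) := by
  set L := Lch s k t hs ht with hL
  have sL : ContDiff ℝ (⊤ : ℕ∞) L := L.contDiff
  have L0 : L 0 = 0 := map_zero L
  have tL : Tendsto L (nhds 0) (nhds 0) := by simpa using L.continuous.tendsto 0
  have bL : ∀ n : ℕ, (fun p => ‖L p‖ ^ n) =O[nhds 0] fun p => ‖p‖ ^ n := fun n =>
    ((L : 𝕍 →L[ℝ] 𝕍).isBigO_id _).norm_norm.pow n
  have jb' : (fun p => b (L p)) =o[nhds 0] fun p => ‖p‖ ^ 1 := (jb.comp_tendsto tL).trans_isBigO (bL 1)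
  have jc' : (fun p => c (L p) - (12 * ε * s ^ 2 * p.1 ^ 2 + 2 * t ^ 2 * κ * p.2 ^ 2)) =o[nhds 0] fun p => ‖p‖ ^ 2 := by
    refine (((IsLittleO.comp_tendsto jc tL).trans_isBigO (bL 2))).congr_left fun p => ?_
    simp only [Function.comp, hL, Lch_apply]
    rw [hk, hκ]
    linear_combination ((6 * s * p.1 * p.2 * α * t) - 3 / 4 * ε * α ^ 2 * t ^ 2 * p.2 ^ 2) * hε
  set A : 𝕍 → ℝ := fun p => a (L p) * t ^ 2 + 2 * b (L p) * k * t + c (L p) * k ^ 2 with hA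
  set Bt : 𝕍 → ℝ := fun p => (b (L p) * t + c (L p) * k) * s with hBt
  set Ct : 𝕍 → ℝ := fun p => c (L p) * s ^ 2 with hCt
  set S : 𝕍 → ℝ := fun p => - ε * p.1 ^ 2 + σ * p.2 ^ 2 with hS
  have oX : (fun p : 𝕍 => p.1 ^ 2) =O[nhds 0] fun p => ‖p‖ ^ 2 :=
    IsBigO.of_bound 1 (Eventually.of_forall fun p => by simpa [sq_abs] using pow_le_pow_left₀ (abs_nonneg p.1) (norm_fst_le p) 2)
  have oY : (fun p : 𝕍 => p.2 ^ 2) =O[nhds 0] fun p => ‖p‖ ^ 2 :=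
    IsBigO.of_bound 1 (Eventually.of_forall fun p => by simpa [sq_abs] using pow_le_pow_left₀ (abs_nonneg p.2) (norm_snd_le p) 2)
  have n21 : (fun p : 𝕍 => ‖p‖ ^ 2) =o[nhds 0] fun p => ‖p‖ ^ 1 := by
    simpa using (isLittleO_norm_pow_id (E' := 𝕍) one_lt_two).norm_right
  have oC : (fun p => c (L p)) =o[nhds 0] fun p => ‖p‖ ^ 1 := by
    refine IsBigO.trans_isLittleO ?_ n21
    exact (jc'.isBigO.add ((oX.const_mul_left (12 * ε * s ^ 2)).add (oY.const_mul_left (2 * t ^ 2 * κ)))).congr_left fun p => by ring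
  have oB : Bt =o[nhds 0] fun p => ‖p‖ ^ 1 :=
    ((jb'.const_mul_left (t * s)).add (oC.const_mul_left (k * s))).congr_left fun p => by simp only [hBt]; ring
  have oS : S =O[nhds 0] fun p => ‖p‖ ^ 2 := (oX.const_mul_left _).add (oY.const_mul_left _)
  have sA : ContDiff ℝ (⊤ : ℕ∞) A := by
    have h1 := sa.comp sL; have h2 := sb.comp sL; have h3 := sc.comp sL
    exact ((h1.mul contDiff_const).add (((contDiff_const.mul h2).mul contDiff_const).mul contDiff_const)).add (h3.mul contDiff_const)
  have sB : ContDiff ℝ (⊤ : ℕ∞) Bt := by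
    have h2 := sb.comp sL; have h3 := sc.comp sL
    exact ((h2.mul contDiff_const).add (h3.mul contDiff_const)).mul contDiff_const
  have sC : ContDiff ℝ (⊤ : ℕ∞) Ct := (sc.comp sL).mul contDiff_const
  have b0 : b 0 = 0 := jet_zero jb
  have c0 : c 0 = 0 := by have := jet_zero oC; rwa [L0] at this
  have A0 : A 0 = 2 * t ^ 2 := by simp [hA, L0, a0, b0, c0]
  have A0' : A 0 ≠ 0 := by rw [A0]; positivity
  have sI : ContDiffAt ℝ (⊤ : ℕ∞) (fun p => (A p)⁻¹) 0 := sA.contDiffAt.inv A0'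
  have oI : (fun p => (A p)⁻¹) =O[nhds 0] fun _ => (1 : ℝ) := sI.continuousAt.isBigO_one ℝ
  have oA : (fun p => A p - 2 * t ^ 2) =o[nhds 0] fun _ => (1 : ℝ) := by
    rw [isLittleO_one_iff]
    have := sA.continuous.tendsto 0
    rw [A0] at this
    have := this.sub_const (2 * t ^ 2)
    rwa [sub_self] at this
  have oB' : (fun p => Bt p * (A p)⁻¹) =o[nhds 0] fun p => ‖p‖ ^ 1 := (oB.mul_isBigO oI).congr_right fun p => by ring
  have oW : IsOpen {p | A p ≠ 0} := isOpen_ne_fun sA.continuous continuous_const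
  refine ⟨fun p => (Bt p * (A p)⁻¹) ^ 2 - Ct p * (A p)⁻¹, fun p => Bt p * (A p)⁻¹, ((sB.contDiffAt.mul sI).pow 2).sub (sC.contDiffAt.mul sI),
    sB.contDiffAt.mul sI, ?_, oB', ?_⟩
  · have m1 : (fun p => (Bt p * (A p)⁻¹) ^ 2) =o[nhds 0] fun p => ‖p‖ ^ 2 :=
      ((oB'.mul oB').congr_left fun p => by ring).congr_right fun p => by ring
    have m2 : (fun p => (Ct p + 2 * t ^ 2 * S p) * (A p)⁻¹) =o[nhds 0] fun p => ‖p‖ ^ 2 := by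
      refine IsLittleO.congr_right (IsLittleO.mul_isBigO ?_ oI) fun p => mul_one _
      refine (jc'.const_mul_left (s ^ 2)).congr_left fun p => ?_
      simp only [hCt, hS]
      linear_combination (-2 * t ^ 2 * p.2 ^ 2) * hσ + (2 * ε * p.1 ^ 2) * hst
    have m3 : (fun p => (A p - 2 * t ^ 2) * S p * (A p)⁻¹) =o[nhds 0] fun p => ‖p‖ ^ 2 :=
      ((oA.mul_isBigO oS).mul_isBigO oI).congr_right fun p => by ring
    refine ((m1.sub m2).sub m3).congr' ?_ EventuallyEq.rfl
    filter_upwards [oW.mem_nhds A0'] with p hp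
    have hp' : A p ≠ 0 := hp
    field_simp
    ring
  · have base : TEF (fun _ : Unit => Curve fun p v => BDE a b c (L p) (L v) = 0) (fun _ => Curve fun p v => BDE a b c p v = 0) :=
      ⟨L.toHomeomorph.toOpenPartialHomeomorph, by simp, by simp, fun _ S _ => by
        simpa using Curve.linear (Q := fun p v => BDE a b c p v = 0) L (S := S)⟩
    refine base.congr oW A0' fun _ S hS => Curve.congr (W := {p | A p ≠ 0}) (fun p hp v => ?_) hS
    have hp' : A p ≠ 0 := hp
    have e : BDE a b c (L p) (L v) = A p * v.2 ^ 2 + 2 * Bt p * v.1 * v.2 + Ct p * v.1 ^ 2 := by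
      simp only [BDE, hA, hBt, hCt]
      rw [hL, Lch_apply, Lch_apply]
      ring
    rw [e, QH, ← sub_eq_zero (a := (v.2 + _) ^ 2)]
    have e2 : (v.2 + Bt p * (A p)⁻¹ * v.1) ^ 2 - ((Bt p * (A p)⁻¹) ^ 2 - Ct p * (A p)⁻¹) * v.1 ^ 2 =
        (A p * v.2 ^ 2 + 2 * Bt p * v.1 * v.2 + Ct p * v.1 ^ 2) * (A p)⁻¹ := by
      field_simp
      ring
    rw [e2, mul_eq_zero]
    simp [hp']

theorem neg_curve {D B : 𝕍 → ℝ} (h : (fun p => D p - (- 1 * p.1 ^ 2 + - 1 * p.2 ^ 2)) =o[nhds 0] fun p => ‖p‖ ^ 2) :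
    ∃ W, IsOpen W ∧ (0 : 𝕍) ∈ W ∧ ∀ S ⊆ W, Curve (QH D B) S ↔ S = ∅ := by
  obtain ⟨δ, δ0, hδ⟩ := Metric.eventually_nhds_iff_ball.1 (isLittleO_iff.1 h (half_pos one_pos))
  refine ⟨Metric.ball 0 δ, Metric.isOpen_ball, Metric.mem_ball_self δ0, fun S hS => ⟨?_, ?_⟩⟩
  · rintro ⟨γ, dγ, a, b, hc, rfl⟩
    rw [image_eq_empty]
    by_contra hne
    obtain ⟨t, ht⟩ := nonempty_iff_ne_empty.2 hne
    have z : ∀ u ∈ Ioo a b, γ u = 0 := by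
      intro u hu
      by_contra h0
      have k1 := hδ _ (hS (mem_image_of_mem _ hu))
      rw [norm_pow, norm_norm, Real.norm_eq_abs] at k1
      have k2 := (abs_le.1 k1).2
      have k3 : ‖γ u‖ ^ 2 ≤ (γ u).1 ^ 2 + (γ u).2 ^ 2 := by
        rw [Prod.norm_def, Real.norm_eq_abs, Real.norm_eq_abs]
        rcases max_choice |(γ u).1| |(γ u).2| with e | e <;> rw [e, sq_abs] <;> nlinarith [sq_nonneg (γ u).1, sq_nonneg (γ u).2]
      have k4 : 0 < ‖γ u‖ := norm_pos_iff.2 h0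
      have k5 := QH_ne (hc.2 u hu).2.1 (hc.2 u hu).2.2
      have k6 := (hc.2 u hu).2.2
      unfold QH at k6
      have k7 : 0 < (dγ u).1 ^ 2 := by positivity
      have k8 := nonneg_of_mul_nonneg_left (k6 ▸ sq_nonneg _) k7
      nlinarith
    have d : HasDerivAt γ 0 t := (hasDerivAt_const t (0 : 𝕍)).congr_of_eventuallyEq (by
      filter_upwards [Ioo_mem_nhds ht.1 ht.2] with u hu using z u hu)
    exact (hc.2 t ht).2.1 ((hc.2 t ht).1.unique d)
  · rintro rfl
    exact ⟨fun _ => 0, fun _ => 0, 0, 0, ⟨by simp, by simp⟩, by simp⟩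

theorem four {D B D' B' : 𝕍 → ℝ} {σ τ : ℝ} (hσ : σ = 1 ∨ σ = -1) (hτ : τ = 1 ∨ τ = -1)
    (h1 : ContDiffAt ℝ (⊤ : ℕ∞) D 0) (h2 : ContDiffAt ℝ (⊤ : ℕ∞) B 0)
    (h3 : (fun p => D p - (σ * p.1 ^ 2 + τ * p.2 ^ 2)) =o[nhds 0] fun p => ‖p‖ ^ 2) (h4 : B =o[nhds 0] fun p => ‖p‖ ^ 1)
    (h1' : ContDiffAt ℝ (⊤ : ℕ∞) D' 0) (h2' : ContDiffAt ℝ (⊤ : ℕ∞) B' 0)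
    (h3' : (fun p => D' p - (σ * p.1 ^ 2 + τ * p.2 ^ 2)) =o[nhds 0] fun p => ‖p‖ ^ 2) (h4' : B' =o[nhds 0] fun p => ‖p‖ ^ 1) :
    TEF (fun _ : Unit => Curve (QH D B)) (fun _ => Curve (QH D' B')) := by
  rcases hσ with rfl | rfl
  · simp only [one_mul] at h3 h3'
    obtain ⟨r, Ds, Dc, h⟩ := NF_of h1 h2 h3 h4
    obtain ⟨r', Ds', Dc', h'⟩ := NF_of h1' h2' h3' h4'
    rcases hτ with rfl | rfl
    · exact TEF_N h h'
    · exact TEF_H h h'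
  rcases hτ with rfl | rfl
  · set L := ContinuousLinearEquiv.prodComm ℝ ℝ ℝ with hL
    have L0 : L 0 = 0 := map_zero L
    have tL : Tendsto L (nhds 0) (nhds 0) := by simpa using L.continuous.tendsto 0
    have nL : ∀ p, ‖L p‖ = ‖p‖ := fun p => by simp [hL, Prod.norm_def, max_comm]
    have T : ∀ D B : 𝕍 → ℝ, ContDiffAt ℝ (⊤ : ℕ∞) D 0 → ContDiffAt ℝ (⊤ : ℕ∞) B 0 →
        ((fun p => D p - (-1 * p.1 ^ 2 + 1 * p.2 ^ 2)) =o[nhds 0] fun p => ‖p‖ ^ 2) → (B =o[nhds 0] fun p => ‖p‖ ^ 1) →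
        (∃ r Ds Dc, NF (-1) r (fun p => D (L p)) Ds Dc (fun p => B (L p))) ∧
        TEF (fun _ : Unit => Curve (QV (fun p => D (L p)) (fun p => B (L p)))) (fun _ => Curve (QH D B)) := by
      intro D B h1 h2 h3 h4
      refine ⟨NF_of (ContDiffAt.comp 0 (by rwa [L0]) L.contDiff.contDiffAt) (ContDiffAt.comp 0 (by rwa [L0]) L.contDiff.contDiffAt)
        (((h3.comp_tendsto tL).congr_left fun p => ?_).congr_right fun p => ?_) ((h4.comp_tendsto tL).congr_right fun p => ?_), ?_⟩
      · simp [hL]; ring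
      · simp only [Function.comp, nL]
      · simp only [Function.comp, nL]
      · refine ⟨L.toHomeomorph.toOpenPartialHomeomorph, by simp, by simp, fun _ S _ => ?_⟩
        exact Curve.linear (Q := QH D B) L (S := S)
    obtain ⟨⟨r, Ds, Dc, h⟩, t⟩ := T D B h1 h2 h3 h4
    obtain ⟨⟨r', Ds', Dc', h'⟩, t'⟩ := T D' B' h1' h2' h3' h4'
    exact t.symm.trans ((TEF_V h h').trans t')
  · obtain ⟨W, w1, w2, w3⟩ := neg_curve (B := B) h3
    obtain ⟨W', w1', w2', w3'⟩ := neg_curve (B := B') h3'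
    have := TEF.congr (C := fun _ : Unit => Curve (QH D B)) (C' := fun _ => Curve (QH D' B')) (D := fun _ => Curve (QH D B))
      ⟨OpenPartialHomeomorph.refl _, by simp, by simp, by simp⟩ (w1.inter w1') ⟨w2, w2'⟩ fun _ S hS => by
        rw [w3 S (hS.trans inter_subset_left), w3' S (hS.trans inter_subset_right)]
    exact this.symm

theorem stmt5 (ε α β : ℝ) (hε : ε = 1 ∨ ε = -1) (hS : 3 * α ^ 2 - 8 * ε * β ≠ 0)
    (f : ℝ × ℝ → ℝ) (hf : ContDiff ℝ (⊤ : ℕ∞) f)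
    (hjet : HasJetAt0 f
      (fun p => p.2 ^ 2 + ε * p.1 ^ 4 + α * p.1 ^ 3 * p.2 + β * p.1 ^ 2 * p.2 ^ 2) 4) :
    ∃ ε₁ ε₂ : ℝ, (ε₁ = 1 ∨ ε₁ = -1) ∧ (ε₂ = 1 ∨ ε₂ = -1) ∧
      TopEquivAt0 (asymBDE f)
        (BDE (fun _ => 1) (fun _ => 0) (fun p => ε₁ * p.1 ^ 2 + ε₂ * p.2 ^ 2)) := by
  obtain ⟨⟨sc, sb, sa⟩, jc, jb, ja⟩ := jets hf hjet
  have hε2 : ε ^ 2 = 1 := by rcases hε with rfl | rfl <;> norm_num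
  set κ := β - 3 * ε * α ^ 2 / 8 with hκ
  have κ0 : κ ≠ 0 := by
    intro h
    apply hS
    linear_combination (-8 * ε) * h - 3 * α ^ 2 * hε2
  obtain ⟨τ, hτ, hτκ⟩ : ∃ τ : ℝ, (τ = 1 ∨ τ = -1) ∧ κ = - τ * |κ| := by
    rcases lt_or_gt_of_ne κ0 with h | h
    · exact ⟨1, Or.inl rfl, by rw [abs_of_neg h]; ring⟩
    · exact ⟨-1, Or.inr rfl, by rw [abs_of_pos h]; ring⟩
  have κp : 0 < |κ| := abs_pos.2 κ0
  set s := (Real.sqrt |κ|)⁻¹ with hs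
  have s0 : s ≠ 0 := by positivity
  have s2 : s ^ 2 * |κ| = 1 := by
    rw [hs, inv_pow, Real.sq_sqrt κp.le, inv_mul_cancel₀ κp.ne']
  set t := Real.sqrt 6 * s ^ 2 with ht
  have t0 : t ≠ 0 := by positivity
  have t2 : t ^ 2 = 6 * s ^ 4 := by rw [ht, mul_pow, Real.sq_sqrt (by norm_num)]; ring
  have n21 : (fun p : ℝ × ℝ => ‖p‖ ^ 2) =o[nhds 0] fun p => ‖p‖ ^ 1 := by
    simpa using (isLittleO_norm_pow_id (E' := ℝ × ℝ) one_lt_two).norm_right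
  have a0 : fyy f 0 = 2 := by
    have := jet_zero ja
    simp at this; linarith
  have jb' : fxy f =o[nhds 0] fun p => ‖p‖ ^ 1 := by
    have q : (fun p : ℝ × ℝ => 3 * α * p.1 ^ 2 + 4 * β * p.1 * p.2) =O[nhds 0] fun p => ‖p‖ ^ 2 := by
      refine IsBigO.of_bound (3 * |α| + 4 * |β|) (Eventually.of_forall fun p => ?_)
      have m1 : |p.1| ≤ ‖p‖ := norm_fst_le p
      have m2 : |p.2| ≤ ‖p‖ := norm_snd_le p
      rw [Real.norm_eq_abs, norm_pow, norm_norm]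
      calc _ ≤ |3 * α * p.1 ^ 2| + |4 * β * p.1 * p.2| := abs_add_le _ _
        _ = 3 * |α| * |p.1| ^ 2 + 4 * |β| * (|p.1| * |p.2|) := by simp [abs_mul]; ring
        _ ≤ 3 * |α| * ‖p‖ ^ 2 + 4 * |β| * (‖p‖ * ‖p‖) := by gcongr
        _ = _ := by ring
    exact ((jb.trans n21).add (q.trans_isLittleO n21)).congr_left fun p => by ring
  obtain ⟨D, B, d1, d2, d3, d4, d5⟩ := reduce (κ := κ) (σ := τ) sa sb sc a0 jb' jc s0 t0 hε2 rfl hκ t2 (by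
    rw [hτκ]; linear_combination (-τ) * s2)
  refine ⟨ε, -τ, hε, ?_, topEquiv_of_TEF ?_⟩
  · rcases hτ with rfl | rfl
    · right; rfl
    · left; norm_num
  have F := four (D' := fun p => - ε * p.1 ^ 2 + τ * p.2 ^ 2) (B' := fun _ => 0) (σ := - ε) (τ := τ)
    (by rcases hε with rfl | rfl <;> simp) hτ d1 d2 d3 d4 (by fun_prop) (by fun_prop) (by simp) (isLittleO_zero _ _)
  refine d5.symm.trans (F.trans ?_)
  refine ⟨OpenPartialHomeomorph.refl _, by simp, by simp, fun _ S _ => ?_⟩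
  have : Curve (QH (fun p => - ε * p.1 ^ 2 + τ * p.2 ^ 2) fun _ => 0) S ↔
      Curve (fun p v => BDE (fun _ => 1) (fun _ => 0) (fun p => ε * p.1 ^ 2 + -τ * p.2 ^ 2) p v = 0) S := by
    refine Curve.congr (W := univ) (fun p _ v => ?_) (subset_univ _)
    simp only [QH, BDE]
    rw [← sub_eq_zero (a := (v.2 + 0 * v.1) ^ 2)]
    constructor <;> intro h <;> linear_combination h
  simpa using this
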